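/- arXiv:1805.06859 — 4 statements merged into one kernel-verified Lean document; each statement's English description precedes it below -/
import Mathlib

section
/- Let n ≥ 1 and let P ⊆ ℝⁿ be a bounded DH-polytope. Then lim_{ε→0⁺} ε · ∫_P (x₀ − εi)^{−(n+1)} dx = 0. (Lemma 6.4(2): the quantity ε · g_{u,ε}(P) tends to 0 as ε → 0⁺.) -/
open MeasureTheory Filter Metric

variable {n : ℕ} [NeZero n]

/-- A *DH-half-space* in `ℝⁿ` (upper half-space model of the double hyperbolic space `DHⁿ`):
either a closed ball whose center has first coordinate `0`, or the complement of an open ball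
whose center has first coordinate `0`, or a closed affine half-space whose normal vector is
nonzero with first coordinate `0`. -/
def IsDHHalfSpace (H : Set (EuclideanSpace ℝ (Fin n))) : Prop :=
  (∃ (c : EuclideanSpace ℝ (Fin n)) (r : ℝ), 0 < r ∧ c 0 = 0 ∧ H = closedBall c r) ∨
  (∃ (c : EuclideanSpace ℝ (Fin n)) (r : ℝ), 0 < r ∧ c 0 = 0 ∧ H = (ball c r)ᶜ) ∨
  (∃ (v : EuclideanSpace ℝ (Fin n)) (t : ℝ), v ≠ 0 ∧ v 0 = 0 ∧
    H = {x | t ≤ inner v x (𝕜 := ℝ)})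

/-- A *DH-polytope* in `ℝⁿ`: a finite intersection of DH-half-spaces. -/
def IsDHPolytope (P : Set (EuclideanSpace ℝ (Fin n))) : Prop :=
  ∃ S : Finset (Set (EuclideanSpace ℝ (Fin n))), (∀ H ∈ S, IsDHHalfSpace H) ∧ P = ⋂₀ ↑S

namespace DHPolytope

section Decomposition

variable {V : Type*} [NormedAddCommGroup V] [InnerProductSpace ℝ V]

/-- The affine functional `x ↦ ⟪a, x⟫ + b` attached to a pair `(a, b)`. -/
def affineVal (p : V × ℝ) (x : V) : ℝ := inner ℝ p.1 x + p.2

lemma affineVal_sub (p q : V × ℝ) (x : V) :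
    affineVal (p - q) x = affineVal p x - affineVal q x := by
  simp only [affineVal, Prod.fst_sub, Prod.snd_sub, inner_sub_left]
  ring

lemma continuous_affineVal (p : V × ℝ) : Continuous (affineVal p) := by
  unfold affineVal
  fun_prop

/-- The polyhedron cut out by finitely many affine inequalities. -/
def polyhedron (L : List (V × ℝ)) : Set V := {x | ∀ p ∈ L, affineVal p x ≤ 0}

/-- A polyhedron further cut by lower and upper affine bounds on a function `φ`. -/
def boundedCell (φ : V → ℝ) (L U D : List (V × ℝ)) : Set V :=
  {x | x ∈ polyhedron L ∧ (∀ p ∈ U, φ x ≤ affineVal p x) ∧ ∀ p ∈ D, affineVal p x ≤ φ x}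

lemma isClosed_polyhedron (L : List (V × ℝ)) : IsClosed (polyhedron L) := by
  simp only [polyhedron, Set.ofPred_forall]
  exact isClosed_iInter fun p ↦ isClosed_iInter fun _ ↦
    isClosed_le (continuous_affineVal p) continuous_const

lemma isClosed_boundedCell {φ : V → ℝ} (hφ : Continuous φ) (L U D : List (V × ℝ)) :
    IsClosed (boundedCell φ L U D) := by
  have hU : IsClosed {x | ∀ p ∈ U, φ x ≤ affineVal p x} := by
    simp only [Set.ofPred_forall]
    exact isClosed_iInter fun p ↦ isClosed_iInter fun _ ↦
      isClosed_le hφ (continuous_affineVal p)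
  have hD : IsClosed {x | ∀ p ∈ D, affineVal p x ≤ φ x} := by
    simp only [Set.ofPred_forall]
    exact isClosed_iInter fun p ↦ isClosed_iInter fun _ ↦
      isClosed_le (continuous_affineVal p) hφ
  exact (isClosed_polyhedron L).inter (hU.inter hD)

variable [MeasurableSpace V] [BorelSpace V] [FiniteDimensional ℝ V]

/-- The integrals over `A` of a family of functions stay bounded for parameters in `(0, 1]`. -/
def BoundedIntegrals (f : ℝ → V → ℂ) (A : Set V) : Prop :=
  ∃ C : ℝ, ∀ ε ∈ Set.Ioc (0 : ℝ) 1, ‖∫ x in A, f ε x‖ ≤ C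

lemma BoundedIntegrals.union {f : ℝ → V → ℂ} {A B : Set V} (hB : MeasurableSet B)
    (hAB : volume (A ∩ B) = 0) (hf : ∀ ε ∈ Set.Ioc (0 : ℝ) 1, IntegrableOn (f ε) (A ∪ B))
    (h₁ : BoundedIntegrals f A) (h₂ : BoundedIntegrals f B) : BoundedIntegrals f (A ∪ B) := by
  obtain ⟨C₁, h₁⟩ := h₁
  obtain ⟨C₂, h₂⟩ := h₂
  refine ⟨C₁ + C₂, fun ε hε ↦ ?_⟩
  rw [setIntegral_union₀ hAB hB.nullMeasurableSet ((hf ε hε).mono_set Set.subset_union_left)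
    ((hf ε hε).mono_set Set.subset_union_right)]
  exact (norm_add_le _ _).trans (add_le_add (h₁ ε hε) (h₂ ε hε))

lemma BoundedIntegrals.of_union {f : ℝ → V → ℂ} {A B : Set V} (hB : MeasurableSet B)
    (hAB : volume (A ∩ B) = 0) (hf : ∀ ε ∈ Set.Ioc (0 : ℝ) 1, IntegrableOn (f ε) (A ∪ B))
    (h : BoundedIntegrals f (A ∪ B)) (h₁ : BoundedIntegrals f A) : BoundedIntegrals f B := by
  obtain ⟨C, h⟩ := h
  obtain ⟨C₁, h₁⟩ := h₁
  refine ⟨C + C₁, fun ε hε ↦ ?_⟩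
  have := setIntegral_union₀ hAB hB.nullMeasurableSet
    ((hf ε hε).mono_set Set.subset_union_left) ((hf ε hε).mono_set Set.subset_union_right)
  rw [← sub_eq_of_eq_add' this]
  exact (norm_sub_le _ _).trans (add_le_add (h ε hε) (h₁ ε hε))

lemma volume_affineVal_eq_zero {p : V × ℝ} (hp : p ≠ 0) :
    volume {x : V | affineVal p x = 0} = 0 := by
  obtain ⟨a, b⟩ := p
  rcases Set.eq_empty_or_nonempty {x : V | affineVal (a, b) x = 0} with h | ⟨x₀, hx₀⟩
  · rw [h, measure_empty]
  · have ha : a ≠ 0 := by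
      rintro rfl
      apply hp
      simpa [affineVal] using hx₀
    refine measure_mono_null (t := (AffineSubspace.mk' x₀ (innerₛₗ ℝ a).ker : Set V)) ?_
      (Measure.addHaar_affineSubspace _ _ fun h ↦ ha ?_)
    · intro x hx
      simp only [affineVal, Set.mem_ofPred_eq] at hx hx₀
      simp only [SetLike.mem_coe, AffineSubspace.mem_mk', vsub_eq_sub, LinearMap.mem_ker,
        innerₛₗ_apply_apply, inner_sub_right]
      linarith
    · have : a + x₀ ∈ AffineSubspace.mk' x₀ (innerₛₗ ℝ a).ker := by
        rw [h]; trivial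
      simpa [AffineSubspace.mem_mk'] using this

variable {W : AddSubgroup (V × ℝ)} {φ : V → ℝ} {f : ℝ → V → ℂ}

lemma boundedIntegrals_boundedCell_upper (hφ : Continuous φ)
    (hf : ∀ p ∈ W, ∀ ε ∈ Set.Ioc (0 : ℝ) 1, IntegrableOn (f ε) {x | φ x ≤ affineVal p x})
    (hpiece : ∀ p ∈ W, ∀ L : List (V × ℝ), (∀ q ∈ L, q ∈ W) →
      BoundedIntegrals f (boundedCell φ L [p] [])) (U : List (V × ℝ)) :
    ∀ p ∈ W, ∀ L : List (V × ℝ), (∀ q ∈ L, q ∈ W) → (∀ q ∈ U, q ∈ W) →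
      BoundedIntegrals f (boundedCell φ L (p :: U) []) := by
  induction U with
  | nil => exact fun p hp L hL _ ↦ hpiece p hp L hL
  | cons q U ih =>
    intro p hp L hL hU
    have hq : q ∈ W := hU q (by simp)
    have hU' : ∀ q ∈ U, q ∈ W := fun r hr ↦ hU r (by simp [hr])
    by_cases hpq : p = q
    · subst hpq
      have : boundedCell φ L (p :: p :: U) [] = boundedCell φ L (p :: U) [] := by
        ext x; simp [boundedCell]
      rw [this]
      exact ih p hp L hL hU'
    · have h₁ := ih p hp ((p - q) :: L) (by simpa using ⟨W.sub_mem hp hq, fun a b ↦ hL (a, b)⟩) hU'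
      have h₂ := ih q hq ((q - p) :: L) (by simpa using ⟨W.sub_mem hq hp, fun a b ↦ hL (a, b)⟩) hU'
      have heq : boundedCell φ L (p :: q :: U) [] =
          boundedCell φ ((p - q) :: L) (p :: U) [] ∪ boundedCell φ ((q - p) :: L) (q :: U) [] := by
        ext x
        simp only [boundedCell, polyhedron, List.forall_mem_cons, affineVal_sub, Set.mem_ofPred_eq,
          Set.mem_union]
        constructor
        · rintro ⟨hx, ⟨hxp, hxq, hU⟩, hD⟩
          rcases le_total (affineVal p x) (affineVal q x) with h | h
          · exact Or.inl ⟨⟨by linarith, hx⟩, ⟨hxp, hU⟩, hD⟩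
          · exact Or.inr ⟨⟨by linarith, hx⟩, ⟨hxq, hU⟩, hD⟩
        · rintro (⟨⟨h, hx⟩, ⟨hxp, hU⟩, hD⟩ | ⟨⟨h, hx⟩, ⟨hxp, hU⟩, hD⟩)
          · exact ⟨hx, ⟨hxp, by linarith, hU⟩, hD⟩
          · exact ⟨hx, ⟨by linarith, hxp, hU⟩, hD⟩
      have hInt := fun ε hε ↦ (hf p hp ε hε).mono_set
        (s := boundedCell φ L (p :: q :: U) []) fun x hx ↦ hx.2.1 p (by simp)
      rw [heq] at hInt ⊢
      refine BoundedIntegrals.union (isClosed_boundedCell hφ _ _ _).measurableSet ?_ hInt h₁ h₂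
      refine measure_mono_null (fun x hx ↦ ?_) (volume_affineVal_eq_zero (sub_ne_zero.2 hpq))
      have h₁ := hx.1.1 (p - q) (by simp)
      have h₂ := hx.2.1 (q - p) (by simp)
      rw [affineVal_sub] at h₁ h₂
      simp only [Set.mem_ofPred_eq, affineVal_sub]
      linarith

lemma boundedIntegrals_boundedCell (hφ : Continuous φ)
    (hnull : ∀ p ∈ W, volume {x | φ x = affineVal p x} = 0)
    (hf : ∀ p ∈ W, ∀ ε ∈ Set.Ioc (0 : ℝ) 1, IntegrableOn (f ε) {x | φ x ≤ affineVal p x})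
    (hpiece : ∀ p ∈ W, ∀ L : List (V × ℝ), (∀ q ∈ L, q ∈ W) →
      BoundedIntegrals f (boundedCell φ L [p] []))
    {p : V × ℝ} (hp : p ∈ W) {L : List (V × ℝ)} (hL : ∀ q ∈ L, q ∈ W) (D : List (V × ℝ)) :
    ∀ U : List (V × ℝ), (∀ q ∈ U, q ∈ W) → (∀ q ∈ D, q ∈ W) →
      BoundedIntegrals f (boundedCell φ L (p :: U) D) := by
  induction D with
  | nil =>
    exact fun U hU _ ↦ boundedIntegrals_boundedCell_upper hφ hf hpiece U p hp L hL hU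
  | cons q D ih =>
    intro U hU hD
    have hq : q ∈ W := hD q (by simp)
    have hD' : ∀ q ∈ D, q ∈ W := fun r hr ↦ hD r (by simp [hr])
    have h := ih U hU hD'
    have h₁ := ih (q :: U) (by simpa using ⟨hq, fun a b ↦ hU (a, b)⟩) hD'
    have heq : boundedCell φ L (p :: U) D =
        boundedCell φ L (p :: q :: U) D ∪ boundedCell φ L (p :: U) (q :: D) := by
      ext x
      simp only [boundedCell, List.forall_mem_cons, Set.mem_ofPred_eq, Set.mem_union]
      have := le_total (affineVal q x) (φ x)
      tauto
    have hInt := fun ε hε ↦ (hf p hp ε hε).mono_set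
      (s := boundedCell φ L (p :: U) D) fun x hx ↦ hx.2.1 p (by simp)
    rw [heq] at hInt h
    refine BoundedIntegrals.of_union (isClosed_boundedCell hφ _ _ _).measurableSet ?_ hInt h h₁
    refine measure_mono_null (fun x hx ↦ ?_) (hnull q hq)
    exact le_antisymm (hx.1.2.1 q (by simp)) (hx.2.2.2 q (by simp))

end Decomposition

section Coordinates

variable {k : ℕ}

/-- Orthonormal coordinates on `ℝᵏ⁺¹` whose first axis is a given unit vector. -/
lemma exists_adapted_coordinates (e : EuclideanSpace ℝ (Fin (k + 1))) (he : ‖e‖ = 1) :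
    ∃ J : (ℝ × EuclideanSpace ℝ (Fin k)) ≃L[ℝ] EuclideanSpace ℝ (Fin (k + 1)),
      MeasurePreserving J volume volume ∧
      (∀ p q, inner ℝ (J p) (J q) = p.1 * q.1 + inner ℝ p.2 q.2) ∧ J (1, 0) = e := by
  obtain ⟨b, hb⟩ := Orthonormal.exists_orthonormalBasis_extension_of_card_eq (𝕜 := ℝ)
    (E := EuclideanSpace ℝ (Fin (k + 1))) (ι := Fin (k + 1)) (by simp) (v := fun _ ↦ e) (s := {0})
    ⟨fun _ ↦ he, fun i j hij ↦ (hij (Subsingleton.elim i j)).elim⟩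
  let J : (ℝ × EuclideanSpace ℝ (Fin k)) ≃L[ℝ] EuclideanSpace ℝ (Fin (k + 1)) :=
    (((ContinuousLinearEquiv.refl ℝ ℝ).prodCongr (EuclideanSpace.equiv (Fin k) ℝ)).trans
      (Fin.consEquivL ℝ fun _ ↦ ℝ)).trans
      ((EuclideanSpace.equiv (Fin (k + 1)) ℝ).symm.trans b.repr.symm.toContinuousLinearEquiv)
  have hJ (p) : J p = b.repr.symm (WithLp.toLp 2 (Fin.cons p.1 p.2.ofLp)) := rfl
  refine ⟨J, ?_, fun p q ↦ ?_, ?_⟩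
  · have h₁ : MeasurePreserving
        (fun p : ℝ × EuclideanSpace ℝ (Fin k) ↦ (p.1, p.2.ofLp)) volume volume :=
      (MeasurePreserving.id volume).prod (PiLp.volume_preserving_ofLp (Fin k))
    have h₂ := (volume_preserving_piFinSuccAbove (fun _ : Fin (k + 1) ↦ ℝ) 0).symm
    have h₃ := b.measurePreserving_repr_symm.comp
      ((PiLp.volume_preserving_toLp (Fin (k + 1))).comp (h₂.comp h₁))
    convert! h₃ using 1
    ext1 p
    simp [hJ, Function.comp_def, MeasurableEquiv.piFinSuccAbove]
    rfl
  · rw [hJ, hJ, LinearIsometryEquiv.inner_map_map]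
    simp [PiLp.inner_apply, Fin.sum_univ_succ, mul_comm]
  · rw [hJ, ← hb 0 rfl, LinearIsometryEquiv.symm_apply_eq, b.repr_self]
    ext i
    refine Fin.cases ?_ (fun j ↦ ?_) i <;> simp

/-- Integration over `ℝ × ℝᵏ` in the coordinates `(s, w) ↦ (s * τ, s • w)`. -/
lemma integral_eq_integral_radial {h : ℝ × EuclideanSpace ℝ (Fin k) → ℂ}
    (hm : Measurable h) (hh : Integrable h) {τ : ℝ} (hτ : 0 < τ) :
    ∫ p, h p = ∫ w, ∫ s : ℝ, ((τ * |s| ^ k : ℝ) : ℂ) * h (s * τ, s • w) := by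
  have hscale (F : EuclideanSpace ℝ (Fin k) → ℂ) (s : ℝ) (hs : s ≠ 0) :
      ((|s| ^ k : ℝ) : ℂ) * ∫ w, F (s • w) = ∫ w, F w := by
    rw [Measure.integral_comp_smul, finrank_euclideanSpace_fin, abs_inv, abs_pow,
      Complex.real_smul, ← mul_assoc, ← Complex.ofReal_mul, mul_inv_cancel₀ (by positivity)]
    simp
  have hscaleR (F : EuclideanSpace ℝ (Fin k) → ℝ) (s : ℝ) (hs : s ≠ 0) :
      |s| ^ k * ∫ w, F (s • w) = ∫ w, F w := by
    rw [Measure.integral_comp_smul, finrank_euclideanSpace_fin, abs_inv, abs_pow,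
      smul_eq_mul, ← mul_assoc, mul_inv_cancel₀ (by positivity), one_mul]
  have hne : ∀ᵐ s : ℝ, s ≠ 0 := by simp [ae_iff]
  have hqmp : Measure.QuasiMeasurePreserving (fun s : ℝ ↦ s * τ) volume volume := by
    refine ⟨by fun_prop, ?_⟩
    have := Real.map_volume_mul_right hτ.ne'
    rw [this]
    exact Measure.smul_absolutelyContinuous
  have hInt : Integrable (fun p : ℝ × EuclideanSpace ℝ (Fin k) ↦
      ((τ * |p.1| ^ k : ℝ) : ℂ) * h (p.1 * τ, p.1 • p.2)) (volume.prod volume) := by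
    have hmeas : AEStronglyMeasurable (fun p : ℝ × EuclideanSpace ℝ (Fin k) ↦
        h (p.1 * τ, p.1 • p.2)) (volume.prod volume) :=
      (hm.comp (by fun_prop)).aestronglyMeasurable
    refine (integrable_prod_iff ?_).2 ⟨?_, ?_⟩
    · exact (by fun_prop : Continuous fun p : ℝ × EuclideanSpace ℝ (Fin k) ↦
        ((τ * |p.1| ^ k : ℝ) : ℂ)).aestronglyMeasurable.mul hmeas
    · filter_upwards [hne, hqmp.ae (hh.prod_right_ae)] with s hs hi
      exact (hi.comp_smul hs).const_mul _
    · refine ((hh.integral_norm_prod_left.comp_mul_right' hτ.ne').const_mul τ).congr ?_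
      filter_upwards [hne] with s hs
      simp only [norm_mul, Complex.norm_real, Real.norm_eq_abs, abs_of_pos hτ,
        abs_pow, abs_abs]
      rw [integral_const_mul, mul_assoc, hscaleR (fun w ↦ ‖h (s * τ, w)‖) s hs]
  calc ∫ p, h p = ∫ z, ∫ w, h (z, w) := integral_prod _ hh
    _ = ∫ s : ℝ, (τ : ℂ) * ∫ w, h (s * τ, w) := by
      rw [integral_const_mul, Measure.integral_comp_mul_right (fun z ↦ ∫ w, h (z, w)), abs_inv,
        abs_of_pos hτ, Complex.real_smul, ← mul_assoc, ← Complex.ofReal_mul,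
        mul_inv_cancel₀ hτ.ne', Complex.ofReal_one, one_mul]
    _ = ∫ s : ℝ, ∫ w, ((τ * |s| ^ k : ℝ) : ℂ) * h (s * τ, s • w) := by
      refine integral_congr_ae ?_
      filter_upwards [hne] with s hs
      rw [integral_const_mul, ← hscale (fun w ↦ h (s * τ, w)) s hs]
      push_cast
      ring
    _ = _ := integral_integral_swap hInt

end Coordinates

section Kernel

open Complex (I)

/-- The regularized kernel `(t - εi)⁻ʲ`. -/
noncomputable def poleKernel (j : ℕ) (ε t : ℝ) : ℂ := (((t : ℂ) - ε * I) ^ j)⁻¹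

/-- Twice the odd part of `t ↦ (t - εi)⁻ʲ`. -/
noncomputable def oddKernel (j : ℕ) (ε t : ℝ) : ℂ := poleKernel j ε t - poleKernel j ε (-t)

variable {ε : ℝ}

lemma le_norm_sub_mul_I (t : ℝ) : ε ≤ ‖(t : ℂ) - ε * I‖ := by
  refine (le_abs_self ε).trans ?_
  simpa using Complex.abs_im_le_norm ((t : ℂ) - ε * I)

lemma sub_mul_I_ne_zero (hε : 0 < ε) (t : ℝ) : (t : ℂ) - ε * I ≠ 0 :=
  norm_pos_iff.1 (hε.trans_le (le_norm_sub_mul_I t))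

lemma norm_poleKernel_le (hε : 0 < ε) (j : ℕ) (t : ℝ) : ‖poleKernel j ε t‖ ≤ (ε ^ j)⁻¹ := by
  rw [poleKernel, norm_inv, norm_pow]
  have := le_norm_sub_mul_I (ε := ε) t
  gcongr

lemma norm_oddKernel_le (hε : 0 < ε) (j : ℕ) (t : ℝ) : ‖oddKernel j ε t‖ ≤ 2 * (ε ^ j)⁻¹ := by
  refine (norm_sub_le _ _).trans ?_
  have h₁ := norm_poleKernel_le hε j t
  have h₂ := norm_poleKernel_le hε j (-t)
  linarith

@[simp] lemma oddKernel_zero_right (j : ℕ) : oddKernel j ε 0 = 0 := by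
  simp [oddKernel]

lemma continuous_poleKernel (hε : 0 < ε) (j : ℕ) : Continuous (poleKernel j ε) := by
  unfold poleKernel
  exact Continuous.inv₀ (by fun_prop) fun t ↦ pow_ne_zero _ (sub_mul_I_ne_zero hε t)

lemma continuous_oddKernel (hε : 0 < ε) (j : ℕ) : Continuous (oddKernel j ε) :=
  (continuous_poleKernel hε j).sub ((continuous_poleKernel hε j).comp continuous_neg)

lemma hasDerivAt_poleKernel (hε : 0 < ε) (j : ℕ) (t : ℝ) :
    HasDerivAt (poleKernel j ε) (-j * poleKernel (j + 1) ε t) t := by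
  have h0 := sub_mul_I_ne_zero hε t
  have h₁ : HasDerivAt (fun s : ℝ ↦ (s : ℂ) - ε * I) 1 t :=
    (Complex.ofRealCLM.hasDerivAt (x := t)).sub_const _
  refine ((h₁.pow j).inv (pow_ne_zero _ h0)).congr_deriv ?_
  simp only [poleKernel]
  rcases j with _ | j
  · simp
  · simp only [Nat.add_sub_cancel, Pi.pow_apply]
    field_simp
    ring

lemma hasDerivAt_poleKernel_param (hε : 0 < ε) (j : ℕ) (t : ℝ) :
    HasDerivAt (fun δ ↦ poleKernel j δ t) (I * j * poleKernel (j + 1) ε t) ε := by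
  have h0 := sub_mul_I_ne_zero hε t
  have h₁ : HasDerivAt (fun s : ℝ ↦ (t : ℂ) - s * I) (-I) ε := by
    simpa using ((Complex.ofRealCLM.hasDerivAt (x := ε)).mul_const I).const_sub (t : ℂ)
  refine ((h₁.pow j).inv (pow_ne_zero _ h0)).congr_deriv ?_
  simp only [poleKernel]
  rcases j with _ | j
  · simp
  · simp only [Nat.add_sub_cancel, Pi.pow_apply]
    field_simp
    ring

lemma hasDerivAt_oddKernel (hε : 0 < ε) (j : ℕ) (t : ℝ) :
    HasDerivAt (oddKernel j ε)
      (-j * (poleKernel (j + 1) ε t + poleKernel (j + 1) ε (-t))) t := by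
  refine ((hasDerivAt_poleKernel hε j t).sub
    ((hasDerivAt_poleKernel hε j (-t)).scomp t (hasDerivAt_neg t))).congr_deriv ?_
  simp
  ring

lemma hasDerivAt_oddKernel_param (hε : 0 < ε) (j : ℕ) (t : ℝ) :
    HasDerivAt (fun δ ↦ oddKernel j δ t) (I * j * oddKernel (j + 1) ε t) ε := by
  refine ((hasDerivAt_poleKernel_param hε j t).sub
    (hasDerivAt_poleKernel_param hε j (-t))).congr_deriv ?_
  simp only [oddKernel]
  ring

/-- The combination of kernels whose integral over a truncated cone reduces to its base. -/
noncomputable def coneKernel (k : ℕ) (R ε t : ℝ) : ℂ :=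
  I * (k + 2) * (R + ε ^ 2) * oddKernel (k + 3) ε t + (k + 3) * ε * oddKernel (k + 2) ε t

/-- The kernel on the base of a cone corresponding to `coneKernel`. -/
noncomputable def baseKernel (k : ℕ) (ε t : ℝ) : ℂ :=
  I * ((k + 2) / (k + 1)) * oddKernel (k + 1) ε t - ε * oddKernel (k + 2) ε t

lemma poleKernel_identity (hε : 0 < ε) (k : ℕ) (R t : ℝ) :
    t * (I * (k + 2) * (R + ε ^ 2) * poleKernel (k + 3) ε t +
        (k + 3) * ε * poleKernel (k + 2) ε t) =
      (k + 1) * t * (I * ((k + 2) / (k + 1)) * poleKernel (k + 1) ε t -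
        ε * poleKernel (k + 2) ε t) -
      (R - t ^ 2) * (I * ((k + 2) / (k + 1)) * (-(k + 1) * poleKernel (k + 2) ε t) +
        ε * (k + 2) * poleKernel (k + 3) ε t) := by
  have h0 := sub_mul_I_ne_zero hε t
  have hk : (k + 1 : ℂ) ≠ 0 := by exact_mod_cast k.succ_ne_zero
  obtain ⟨v, hv⟩ : ∃ v : ℂ, v = (t : ℂ) - ε * I := ⟨_, rfl⟩
  have ht : (t : ℂ) = v + ε * I := by rw [hv]; ring
  have hp : ∀ j : ℕ, poleKernel j ε t = (v ^ j)⁻¹ := fun j ↦ by rw [hv]; rfl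
  rw [← hv] at h0
  simp only [hp, ht, pow_succ]
  field_simp
  ring_nf
  simp only [Complex.I_sq, Complex.I_pow_three]
  ring

lemma hasDerivAt_baseKernel (hε : 0 < ε) (k : ℕ) (R : ℝ) {t : ℝ} (ht : t ≠ 0) :
    ∃ d : ℂ, HasDerivAt (baseKernel k ε) d t ∧
      coneKernel k R ε t = (k + 1) * baseKernel k ε t - (R - t ^ 2) * d / t := by
  refine ⟨_, ((hasDerivAt_oddKernel hε (k + 1) t).const_mul _).sub
    ((hasDerivAt_oddKernel hε (k + 2) t).const_mul _), ?_⟩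
  have h₁ := poleKernel_identity hε k R t
  have h₂ := poleKernel_identity hε k R (-t)
  have ht' : (t : ℂ) ≠ 0 := by exact_mod_cast ht
  rw [eq_sub_iff_add_eq, ← mul_right_inj' ht', mul_add, mul_div_cancel₀ _ ht']
  simp only [coneKernel, baseKernel, oddKernel]
  push_cast at h₁ h₂ ⊢
  linear_combination h₁ + h₂

lemma continuous_coneKernel (hε : 0 < ε) (k : ℕ) (R : ℝ) : Continuous (coneKernel k R ε) := by
  have h₁ := continuous_oddKernel hε (k + 2)
  have h₂ := continuous_oddKernel hε (k + 3)
  unfold coneKernel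
  fun_prop

lemma continuous_baseKernel (hε : 0 < ε) (k : ℕ) : Continuous (baseKernel k ε) := by
  have h₁ := continuous_oddKernel hε (k + 1)
  have h₂ := continuous_oddKernel hε (k + 2)
  unfold baseKernel
  fun_prop

lemma integral_coneKernel (hε : 0 < ε) (k : ℕ) {R N : ℝ} (hN : 0 < N) :
    ∫ s in (0 : ℝ)..1, (s : ℂ) ^ k * coneKernel k R ε √(R - s ^ 2 * N) =
      baseKernel k ε √(R - N) := by
  have hc := continuous_coneKernel hε k R
  have hb := continuous_baseKernel hε k
  rw [integral_eq_of_hasDerivAt_off_countable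
    (fun s : ℝ ↦ (s : ℂ) ^ (k + 1) * baseKernel k ε √(R - s ^ 2 * N)) _
    (Set.countable_singleton √(R / N)) (by fun_prop) ?_
    (Continuous.intervalIntegrable (by fun_prop) _ _)]
  · simp
  · intro s hs
    simp only [zero_le_one, inf_of_le_left, sup_of_le_right, Set.mem_sdiff, Set.mem_Ioo,
      Set.mem_singleton_iff] at hs
    obtain ⟨⟨hs0, hs1⟩, hs⟩ := hs
    have hpow : HasDerivAt (fun s : ℝ ↦ (s : ℂ) ^ (k + 1)) ((k + 1) * (s : ℂ) ^ k) s := by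
      simpa [Pi.pow_def] using (Complex.ofRealCLM.hasDerivAt (x := s)).pow (k + 1)
    rcases lt_trichotomy (s ^ 2 * N) R with h | h | h
    · have hpos : 0 < R - s ^ 2 * N := by linarith
      have ht : 0 < √(R - s ^ 2 * N) := Real.sqrt_pos.2 hpos
      obtain ⟨d, hd, hid⟩ := hasDerivAt_baseKernel hε k R ht.ne'
      have hq : HasDerivAt (fun s : ℝ ↦ R - s ^ 2 * N) (-(2 * s * N)) s := by
        simpa using ((hasDerivAt_pow 2 s).mul_const N).const_sub R
      refine (hpow.mul (hd.scomp s (hq.sqrt hpos.ne'))).congr_deriv ?_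
      have ht' : ((√(R - s ^ 2 * N) : ℝ) : ℂ) ≠ 0 := by exact_mod_cast ht.ne'
      have hsq : ((√(R - s ^ 2 * N) : ℝ) : ℂ) ^ 2 = R - s ^ 2 * N := by
        rw [← Complex.ofReal_pow, Real.sq_sqrt hpos.le]; push_cast; ring
      rw [hid, hsq, Complex.real_smul]
      simp only [Function.comp_apply]
      push_cast
      field_simp
      ring
    · exact (hs (by rw [← h, mul_div_cancel_right₀ _ hN.ne', Real.sqrt_sq hs0.le])).elim
    · have hz : √(R - s ^ 2 * N) = 0 := Real.sqrt_eq_zero_of_nonpos (by linarith)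
      have hc0 : coneKernel k R ε 0 = 0 := by simp [coneKernel]
      have hb0 : baseKernel k ε 0 = 0 := by simp [baseKernel]
      rw [hz, hc0, mul_zero]
      refine (hasDerivAt_const s (0 : ℂ)).congr_of_eventuallyEq ?_
      have hcont : Continuous fun s : ℝ ↦ s ^ 2 * N := by fun_prop
      filter_upwards [hcont.continuousAt.eventually (lt_mem_nhds h)] with x hx
      rw [Real.sqrt_eq_zero_of_nonpos (by linarith), hb0, mul_zero]

end Kernel

section BallKernel

open Complex (I)

variable {V : Type*} [NormedAddCommGroup V] {ε R : ℝ}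

/-- The odd kernel evaluated on the height of the sphere of squared radius `R` above `y`. -/
noncomputable def ballKernel (j : ℕ) (R ε : ℝ) (y : V) : ℂ := oddKernel j ε √(R - ‖y‖ ^ 2)

lemma ballKernel_eq_zero {y : V} (hy : R ≤ ‖y‖ ^ 2) (j : ℕ) : ballKernel j R ε y = 0 := by
  rw [ballKernel, Real.sqrt_eq_zero_of_nonpos (by linarith), oddKernel_zero_right]

lemma continuous_ballKernel (hε : 0 < ε) (j : ℕ) (R : ℝ) :
    Continuous (ballKernel j R ε : V → ℂ) :=
  (continuous_oddKernel hε j).comp (by fun_prop)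

lemma hasDerivAt_ballKernel (hε : 0 < ε) (j : ℕ) (R : ℝ) (y : V) :
    HasDerivAt (fun δ ↦ ballKernel j R δ y) (I * j * ballKernel (j + 1) R ε y) ε :=
  hasDerivAt_oddKernel_param hε j _

lemma norm_ballKernel_le (hε : 0 < ε) (j : ℕ) (R : ℝ) (y : V) :
    ‖ballKernel j R ε y‖ ≤ (closedBall (0 : V) √R).indicator (fun _ ↦ 2 * (ε ^ j)⁻¹) y := by
  by_cases hy : y ∈ closedBall (0 : V) √R
  · rw [Set.indicator_of_mem hy]
    exact norm_oddKernel_le hε j _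
  · rw [Set.indicator_of_notMem hy, ballKernel_eq_zero, norm_zero]
    rw [mem_closedBall_zero_iff, not_le] at hy
    exact ((Real.sqrt_lt' ((Real.sqrt_nonneg _).trans_lt hy)).1 hy).le

variable [MeasurableSpace V] [BorelSpace V] [InnerProductSpace ℝ V] [FiniteDimensional ℝ V]

lemma integrable_indicator_closedBall (r c : ℝ) :
    Integrable ((closedBall (0 : V) r).indicator fun _ ↦ c) :=
  (integrable_indicator_iff measurableSet_closedBall).2
    (integrableOn_const measure_closedBall_lt_top.ne)

lemma integrable_ballKernel (hε : 0 < ε) (j : ℕ) (R : ℝ) :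
    Integrable (ballKernel j R ε : V → ℂ) :=
  (integrable_indicator_closedBall _ _).mono' (continuous_ballKernel hε j R).aestronglyMeasurable
    (ae_of_all _ (norm_ballKernel_le hε j R))

lemma hasDerivAt_setIntegral_ballKernel (hε : 0 < ε) (j : ℕ) (R : ℝ) (A : Set V) :
    HasDerivAt (fun δ ↦ ∫ y in A, ballKernel j R δ y)
      (I * j * ∫ y in A, ballKernel (j + 1) R ε y) ε := by
  rw [← integral_const_mul]
  refine (hasDerivAt_integral_of_dominated_loc_of_deriv_le (s := Set.Ioi (ε / 2))
    (F' := fun δ y ↦ I * j * ballKernel (j + 1) R δ y)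
    (bound := (closedBall (0 : V) √R).indicator fun _ ↦ j * (2 * ((ε / 2) ^ (j + 1))⁻¹))
    (Ioi_mem_nhds (by linarith)) ?_ (integrable_ballKernel hε j R).integrableOn ?_ ?_ ?_ ?_).2
  · filter_upwards [Ioi_mem_nhds hε] with δ hδ
    exact (continuous_ballKernel hδ j R).aestronglyMeasurable
  · exact ((continuous_ballKernel hε (j + 1) R).const_mul _).aestronglyMeasurable
  · refine ae_of_all _ fun y δ hδ ↦ ?_
    have hδ' : ε / 2 < δ := hδ
    have hδ0 : 0 < δ := by linarith
    refine (norm_mul_le _ _).trans ?_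
    have h := norm_ballKernel_le hδ0 (j + 1) R y
    by_cases hy : y ∈ closedBall (0 : V) √R
    · rw [Set.indicator_of_mem hy] at h ⊢
      have : 2 * (δ ^ (j + 1))⁻¹ ≤ 2 * ((ε / 2) ^ (j + 1))⁻¹ := by gcongr
      simp only [Complex.norm_mul, Complex.norm_I, Complex.norm_natCast, one_mul]
      exact mul_le_mul_of_nonneg_left (h.trans this) (by positivity)
    · rw [Set.indicator_of_notMem hy] at h ⊢
      rw [norm_le_zero_iff.1 h]; simp
  · exact (integrable_indicator_closedBall _ _).integrableOn
  · refine ae_of_all _ fun y δ hδ ↦ hasDerivAt_ballKernel ?_ j R y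
    have hδ' : ε / 2 < δ := hδ
    linarith

lemma boundedIntegrals_ballKernel_of_nonpos (hR : R ≤ 0) (j : ℕ) (A : Set V) :
    BoundedIntegrals (ballKernel j R) A := by
  refine ⟨0, fun ε _ ↦ ?_⟩
  have (y : V) : ballKernel j R ε y = 0 := ballKernel_eq_zero (hR.trans (by positivity)) j
  simp [this]

lemma norm_oddKernel_one_le {t : ℝ} (ht : 0 < t) : ‖oddKernel 1 ε t‖ ≤ 2 * t⁻¹ := by
  have hb : ∀ s : ℝ, |s| = t → ‖poleKernel 1 ε s‖ ≤ t⁻¹ := by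
    intro s hs
    rw [poleKernel, pow_one, norm_inv]
    have := Complex.abs_re_le_norm ((s : ℂ) - ε * I)
    simp [hs] at this
    gcongr
  refine (norm_sub_le _ _).trans ?_
  have h₁ := hb t (abs_of_pos ht)
  have h₂ := hb (-t) (by rw [abs_neg, abs_of_pos ht])
  linarith

/-- A solution of a first order linear ODE with an exact right-hand side is bounded. -/
lemma bounded_of_ode (k : ℕ) (hR : 0 < R) {τ C : ℝ} {f f' e e' : ℝ → ℂ}
    (hf : ∀ ε, 0 < ε → HasDerivAt f (f' ε) ε) (he : ∀ ε, 0 < ε → HasDerivAt e (e' ε) ε)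
    (hode : ∀ ε : ℝ, 0 < ε → ((R + ε ^ 2 : ℝ) : ℂ) * f' ε + (k + 3) * ε * f ε =
      τ * I / (k + 1) * ((k + 2) * e ε + ε * e' ε))
    (hC : ∀ ε ∈ Set.Ioc (0 : ℝ) 1, ‖e ε‖ ≤ C) :
    ∃ C' : ℝ, ∀ ε ∈ Set.Ioc (0 : ℝ) 1, ‖f ε‖ ≤ C' := by
  set c : ℂ := τ * I / (k + 1) with hc
  set Q : ℝ := √(R + 1) with hQ
  let q : ℝ → ℝ := fun ε ↦ √(R + ε ^ 2)
  have hpos (ε : ℝ) : 0 < R + ε ^ 2 := by positivity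
  have hq0 (ε : ℝ) : 0 < q ε := Real.sqrt_pos.2 (hpos ε)
  have hqsq (ε : ℝ) : q ε ^ 2 = R + ε ^ 2 := Real.sq_sqrt (hpos ε).le
  have hqR (ε : ℝ) : √R ≤ q ε := Real.sqrt_le_sqrt (by nlinarith [sq_nonneg ε])
  have hqQ (ε : ℝ) (h : ε ∈ Set.Ioc (0 : ℝ) 1) : q ε ≤ Q :=
    Real.sqrt_le_sqrt (by nlinarith [h.1, h.2])
  have hqd (ε : ℝ) : HasDerivAt q (ε / q ε) ε := by
    refine (((hasDerivAt_pow 2 ε).const_add R).sqrt (hpos ε).ne').congr_deriv ?_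
    have := (hq0 ε).ne'
    change _ / (2 * q ε) = _
    field_simp
    norm_num
  have hC0 : 0 ≤ C := (norm_nonneg _).trans (hC 1 (by simp))
  have hR' : 0 < √R := Real.sqrt_pos.2 hR
  let u : ℝ → ℂ := fun ε ↦
    ((q ε ^ (k + 3) : ℝ) : ℂ) * f ε - c * (((q ε ^ (k + 1) * ε : ℝ) : ℂ) * e ε)
  let u' : ℝ → ℂ := fun ε ↦ c * (((k + 1) * R * (q ε ^ (k + 1) / q ε ^ 2) : ℝ) : ℂ) * e ε
  have hu (ε : ℝ) (hε : 0 < ε) : HasDerivAt u (u' ε) ε := by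
    have h₁ := (((hqd ε).pow (k + 3)).ofReal_comp).mul (hf ε hε)
    have h₂ := ((((hqd ε).pow (k + 1)).mul (hasDerivAt_id ε)).ofReal_comp.mul
      (he ε hε)).const_mul c
    refine (h₁.sub h₂).congr_deriv ?_
    have hq := hq0 ε
    have hqc : (q ε : ℂ) ≠ 0 := by exact_mod_cast hq.ne'
    have hsq : (q ε : ℂ) ^ 2 = R + (ε : ℂ) ^ 2 := by exact_mod_cast hqsq ε
    have ho := hode ε hε
    rw [← hqsq] at ho
    have hRe : (R : ℂ) = (q ε : ℂ) ^ 2 - (ε : ℂ) ^ 2 := by rw [hsq]; ring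
    simp only [u', Pi.pow_apply, Pi.mul_apply, id]
    push_cast at ho ⊢
    rw [hRe]
    field_simp
    linear_combination (q ε : ℂ) ^ (k + 3) * ho
  have hu'b (ε : ℝ) (hε : ε ∈ Set.Ioc (0 : ℝ) 1) :
      ‖u' ε‖ ≤ ‖c‖ * ((k + 1) * R * (Q ^ (k + 1) / √R ^ 2)) * C := by
    have hq := hq0 ε
    rw [norm_mul, norm_mul, Complex.norm_real, Real.norm_of_nonneg (by positivity)]
    have h₁ := hqQ ε hε
    have h₂ := hqR ε
    have h₃ := hC ε hε
    gcongr
  set K := ‖c‖ * ((k + 1) * R * (Q ^ (k + 1) / √R ^ 2)) * C with hK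
  have hub (ε : ℝ) (hε : ε ∈ Set.Ioc (0 : ℝ) 1) : ‖u ε‖ ≤ ‖u 1‖ + K := by
    have h := (convex_Ioc (0 : ℝ) 1).norm_image_sub_le_of_norm_hasDerivWithin_le
      (fun x hx ↦ (hu x hx.1).hasDerivWithinAt) hu'b (y := ε) (x := 1) (by simp) hε
    have hK0 : 0 ≤ K := (norm_nonneg _).trans (hu'b 1 (by simp))
    have h1 : ‖ε - 1‖ ≤ 1 := by
      rw [Real.norm_eq_abs, abs_le]; constructor <;> linarith [hε.1, hε.2]
    have h2 : ‖u ε‖ ≤ ‖u 1‖ + ‖u ε - u 1‖ := by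
      simpa using norm_add_le (u 1) (u ε - u 1)
    nlinarith
  refine ⟨(‖u 1‖ + K + ‖c‖ * (Q ^ (k + 1) * C)) / √R ^ (k + 3), fun ε hε ↦ ?_⟩
  rw [le_div_iff₀ (by positivity)]
  have hq := hq0 ε
  have h₁ : ‖f ε‖ * √R ^ (k + 3) ≤ ‖((q ε ^ (k + 3) : ℝ) : ℂ) * f ε‖ := by
    rw [norm_mul, Complex.norm_real, Real.norm_of_nonneg (by positivity), mul_comm]
    have := hqR ε
    gcongr
  have h₂ : ((q ε ^ (k + 3) : ℝ) : ℂ) * f ε =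
      u ε + c * (((q ε ^ (k + 1) * ε : ℝ) : ℂ) * e ε) := by simp only [u]; ring
  have h₃ : ‖c * (((q ε ^ (k + 1) * ε : ℝ) : ℂ) * e ε)‖ ≤ ‖c‖ * (Q ^ (k + 1) * C) := by
    have hε0 := hε.1
    rw [norm_mul, norm_mul, Complex.norm_real, Real.norm_of_nonneg (by positivity)]
    have h₁ := hqQ ε hε
    have h₃ := hC ε hε
    have h₄ : q ε ^ (k + 1) * ε ≤ Q ^ (k + 1) * 1 := by
      have := hε.2
      gcongr
    rw [mul_one] at h₄
    gcongr
  rw [h₂] at h₁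
  linarith [norm_add_le (u ε) (c * (((q ε ^ (k + 1) * ε : ℝ) : ℂ) * e ε)), hub ε hε]

end BallKernel

section Cone

open Complex (I)

variable {k : ℕ}

lemma integrable_coneKernel {ε : ℝ} (hε : 0 < ε) (R : ℝ) :
    Integrable fun y : EuclideanSpace ℝ (Fin (k + 1)) ↦ coneKernel k R ε √(R - ‖y‖ ^ 2) :=
  ((integrable_ballKernel hε (k + 3) R).const_mul _).add
    ((integrable_ballKernel hε (k + 2) R).const_mul _)

lemma measurableSet_truncatedCone (α : EuclideanSpace ℝ (Fin (k + 1)))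
    (L : List (EuclideanSpace ℝ (Fin (k + 1)) × ℝ)) :
    MeasurableSet (polyhedron L ∩ {y | 0 < inner ℝ α y ∧ inner ℝ α y ≤ 1}) := by
  have h : Continuous fun y ↦ inner ℝ α y := by fun_prop
  refine (isClosed_polyhedron L).measurableSet.inter (MeasurableSet.inter ?_ ?_)
  · exact (isOpen_lt continuous_const h).measurableSet
  · exact (isClosed_le h continuous_const).measurableSet

/-- The divergence theorem on a truncated cone, in integrated radial form. -/
lemma exists_setIntegral_coneKernel {α : EuclideanSpace ℝ (Fin (k + 1))} (hα : α ≠ 0)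
    {L : List (EuclideanSpace ℝ (Fin (k + 1)) × ℝ)} (hL : ∀ p ∈ L, p.2 = 0) :
    ∃ (τ : ℝ) (L' : List (EuclideanSpace ℝ (Fin k) × ℝ)), ∀ R ε : ℝ, 0 < ε →
      ∫ y in polyhedron L ∩ {y | 0 < inner ℝ α y ∧ inner ℝ α y ≤ 1},
          coneKernel k R ε √(R - ‖y‖ ^ 2) =
        τ * ∫ w in polyhedron L', baseKernel k ε √(R - τ ^ 2 - ‖w‖ ^ 2) := by
  set T := polyhedron L ∩ {y | 0 < inner ℝ α y ∧ inner ℝ α y ≤ 1} with hT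
  have hTm : MeasurableSet T := measurableSet_truncatedCone α L
  have hα' : 0 < ‖α‖ := norm_pos_iff.2 hα
  obtain ⟨J, hJm, hJi, hJe⟩ := exists_adapted_coordinates (‖α‖⁻¹ • α)
    (by rw [norm_smul, norm_inv, norm_norm, inv_mul_cancel₀ hα'.ne'])
  set τ := ‖α‖⁻¹ with hτ
  have hτ0 : 0 < τ := inv_pos.2 hα'
  have hαJ (p) : inner ℝ α (J p) = ‖α‖ * p.1 := by
    have : α = ‖α‖ • J (1, 0) := by rw [hJe, smul_smul, mul_inv_cancel₀ hα'.ne', one_smul]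
    rw [this, inner_smul_left, hJi, ← this]
    simp
  have hnorm (p) : ‖J p‖ ^ 2 = p.1 ^ 2 + ‖p.2‖ ^ 2 := by
    rw [← real_inner_self_eq_norm_sq, hJi, real_inner_self_eq_norm_sq]; ring
  let L' : List (EuclideanSpace ℝ (Fin k) × ℝ) :=
    L.map fun p ↦ ((J.symm p.1).2, τ * (J.symm p.1).1)
  have hL' (w) : w ∈ polyhedron L' ↔ J (τ, w) ∈ polyhedron L := by
    simp only [polyhedron, L', List.forall_mem_map, Set.mem_ofPred_eq]
    refine forall₂_congr fun p hp ↦ ?_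
    have : inner ℝ p.1 (J (τ, w)) = (J.symm p.1).1 * τ + inner ℝ (J.symm p.1).2 w := by
      simpa using hJi (J.symm p.1) (τ, w)
    rw [affineVal, affineVal, this, hL p hp]
    ring_nf
  have hmemT (s : ℝ) (w) : J (s * τ, s • w) ∈ T ↔ s ∈ Set.Ioc (0 : ℝ) 1 ∧ w ∈ polyhedron L' := by
    have hs : J (s * τ, s • w) = s • J (τ, w) := by rw [← map_smul]; rfl
    have h₁ : inner ℝ α (J (s * τ, s • w)) = s := by
      rw [hαJ, hτ]; field_simp
    rw [hL', hT, Set.mem_inter_iff, Set.mem_ofPred_eq, h₁, and_comm]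
    refine and_congr_right fun h ↦ ?_
    rw [hs]
    simp only [polyhedron, Set.mem_ofPred_eq]
    refine forall₂_congr fun p hp ↦ ?_
    rw [affineVal, affineVal, hL p hp, inner_smul_right, add_zero, add_zero,
      mul_nonpos_iff_pos_imp_nonpos]
    constructor
    · exact fun h' ↦ h'.1 h.1
    · exact fun h' ↦ ⟨fun _ ↦ h', fun _ ↦ h.1.le⟩
  refine ⟨τ, L', fun R ε hε ↦ ?_⟩
  set G : EuclideanSpace ℝ (Fin (k + 1)) → ℂ := fun y ↦ coneKernel k R ε √(R - ‖y‖ ^ 2) with hG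
  have hGi : Integrable G := integrable_coneKernel hε R
  have hGm : Measurable G :=
    ((continuous_coneKernel hε k R).comp
      (by fun_prop : Continuous fun y ↦ √(R - ‖y‖ ^ 2))).measurable
  have hJemb : MeasurableEmbedding J := J.toHomeomorph.measurableEmbedding
  rw [← integral_indicator hTm, ← hJm.integral_comp hJemb,
    integral_eq_integral_radial (h := fun p ↦ T.indicator G (J p))
      ((hGm.indicator hTm).comp hJm.measurable)
      ((hJm.integrable_comp_emb hJemb).2 (hGi.indicator hTm)) hτ0,
    ← integral_const_mul, ← integral_indicator (isClosed_polyhedron L').measurableSet]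
  congr 1 with w
  by_cases hw : w ∈ polyhedron L'
  · rw [Set.indicator_of_mem hw]
    have hN : 0 < τ ^ 2 + ‖w‖ ^ 2 := by positivity
    rw [sub_sub, ← integral_coneKernel hε k hN, intervalIntegral.integral_of_le zero_le_one,
      ← integral_const_mul, ← integral_indicator measurableSet_Ioc]
    congr 1 with s
    by_cases hs : s ∈ Set.Ioc (0 : ℝ) 1
    · rw [Set.indicator_of_mem hs, Set.indicator_of_mem ((hmemT s w).2 ⟨hs, hw⟩), hG,
        abs_of_pos hs.1]
      simp only [hnorm, norm_smul, mul_pow, Real.norm_eq_abs, sq_abs]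
      push_cast
      rw [mul_assoc, mul_add]
    · rw [Set.indicator_of_notMem hs, Set.indicator_of_notMem fun h ↦ hs ((hmemT s w).1 h).1,
        mul_zero]
  · rw [Set.indicator_of_notMem hw]
    refine integral_eq_zero_of_ae (ae_of_all _ fun s ↦ ?_)
    simp only [Pi.zero_apply]
    rw [Set.indicator_of_notMem fun h ↦ hw ((hmemT s w).1 h).2, mul_zero]

lemma boundedIntegrals_truncatedCone
    (ih : ∀ (R : ℝ) (L : List (EuclideanSpace ℝ (Fin k) × ℝ)),
      BoundedIntegrals (ballKernel (k + 1) R) (polyhedron L))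
    {R : ℝ} (hR : 0 < R) {α : EuclideanSpace ℝ (Fin (k + 1))} (hα : α ≠ 0)
    {L : List (EuclideanSpace ℝ (Fin (k + 1)) × ℝ)} (hL : ∀ p ∈ L, p.2 = 0) :
    BoundedIntegrals (ballKernel (k + 2) R)
      (polyhedron L ∩ {y | 0 < inner ℝ α y ∧ inner ℝ α y ≤ 1}) := by
  obtain ⟨τ, L', h⟩ := exists_setIntegral_coneKernel hα hL
  obtain ⟨C, hC⟩ := ih (R - τ ^ 2) L'
  refine bounded_of_ode k hR (τ := τ)
    (fun ε hε ↦ hasDerivAt_setIntegral_ballKernel hε (k + 2) R _)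
    (fun ε hε ↦ hasDerivAt_setIntegral_ballKernel hε (k + 1) (R - τ ^ 2) (polyhedron L'))
    (fun ε hε ↦ ?_) hC
  have h₁ := h R ε hε
  have h₂ : ∫ y in polyhedron L ∩ {y | 0 < inner ℝ α y ∧ inner ℝ α y ≤ 1},
      coneKernel k R ε √(R - ‖y‖ ^ 2) = I * (k + 2) * (R + ε ^ 2) *
        (∫ y in polyhedron L ∩ {y | 0 < inner ℝ α y ∧ inner ℝ α y ≤ 1}, ballKernel (k + 3) R ε y) +
        (k + 3) * ε * ∫ y in polyhedron L ∩ {y | 0 < inner ℝ α y ∧ inner ℝ α y ≤ 1},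
          ballKernel (k + 2) R ε y := by
    rw [← integral_const_mul, ← integral_const_mul, ← integral_add]
    · rfl
    · exact ((integrable_ballKernel hε (k + 3) R).const_mul _).integrableOn
    · exact ((integrable_ballKernel hε (k + 2) R).const_mul _).integrableOn
  have h₃ : ∫ w in polyhedron L', baseKernel k ε √(R - τ ^ 2 - ‖w‖ ^ 2) =
      I * ((k + 2) / (k + 1)) * (∫ w in polyhedron L', ballKernel (k + 1) (R - τ ^ 2) ε w) -
        ε * ∫ w in polyhedron L', ballKernel (k + 2) (R - τ ^ 2) ε w := by
    rw [← integral_const_mul, ← integral_const_mul, ← integral_sub]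
    · rfl
    · exact ((integrable_ballKernel hε (k + 1) _).const_mul _).integrableOn
    · exact ((integrable_ballKernel hε (k + 2) _).const_mul _).integrableOn
  rw [h₂, h₃] at h₁
  have hk : (k + 1 : ℂ) ≠ 0 := by exact_mod_cast k.succ_ne_zero
  push_cast
  have hI : I * I = -1 := Complex.I_mul_I
  field_simp at h₁ ⊢
  ring_nf at h₁ ⊢
  simp only [Complex.I_sq] at h₁ ⊢
  linear_combination h₁

end Cone

section Polyhedron

variable {k : ℕ} {R : ℝ}

lemma polyhedron_cons {V : Type*} [NormedAddCommGroup V] [InnerProductSpace ℝ V] (p : V × ℝ)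
    (L : List (V × ℝ)) : polyhedron (p :: L) = {x | affineVal p x ≤ 0} ∩ polyhedron L := by
  ext x
  simp [polyhedron]

lemma boundedIntegrals_halfCone
    (ih : ∀ (R : ℝ) (L : List (EuclideanSpace ℝ (Fin k) × ℝ)),
      BoundedIntegrals (ballKernel (k + 1) R) (polyhedron L))
    (hR : 0 < R) {α : EuclideanSpace ℝ (Fin (k + 1))} (hα : α ≠ 0)
    {L : List (EuclideanSpace ℝ (Fin (k + 1)) × ℝ)} (hL : ∀ p ∈ L, p.2 = 0) :
    BoundedIntegrals (ballKernel (k + 2) R) (polyhedron L ∩ {y | 0 < inner ℝ α y}) := by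
  have hα' : 0 < ‖α‖ := norm_pos_iff.2 hα
  have hR' : 0 < √R := Real.sqrt_pos.2 hR
  set δ := (‖α‖ * √R)⁻¹ with hδ
  have hδ0 : 0 < δ := by positivity
  obtain ⟨C, hC⟩ := boundedIntegrals_truncatedCone ih hR (smul_ne_zero hδ0.ne' hα) hL
  refine ⟨C, fun ε hε ↦ ?_⟩
  rw [setIntegral_eq_of_subset_of_forall_sdiff_eq_zero _ _ _]
  · exact hC ε hε
  · have h : Continuous fun y ↦ inner ℝ α y := by fun_prop
    exact (isClosed_polyhedron L).measurableSet.inter (isOpen_lt continuous_const h).measurableSet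
  · rintro y ⟨hy, hy', -⟩
    rw [inner_smul_left] at hy'
    exact ⟨hy, pos_of_mul_pos_right hy' hδ0.le⟩
  · rintro y ⟨⟨hy, hy0⟩, hy'⟩
    apply ballKernel_eq_zero
    rw [Set.mem_ofPred_eq] at hy0
    simp only [Set.mem_inter_iff, hy, Set.mem_ofPred_eq, inner_smul_left, conj_trivial, true_and,
      mul_pos hδ0 hy0, not_le] at hy'
    rw [hδ] at hy'
    rw [inv_mul_eq_div, one_lt_div (by positivity)] at hy'
    have := real_inner_le_norm α y
    have : √R < ‖y‖ := lt_of_mul_lt_mul_left (hy'.trans_le this) hα'.le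
    exact ((Real.sqrt_lt' (hR'.trans this)).1 this).le

lemma boundedIntegrals_cone
    (ih : ∀ (R : ℝ) (L : List (EuclideanSpace ℝ (Fin k) × ℝ)),
      BoundedIntegrals (ballKernel (k + 1) R) (polyhedron L))
    (hR : 0 < R) {L : List (EuclideanSpace ℝ (Fin (k + 1)) × ℝ)} (hL : ∀ p ∈ L, p.2 = 0) :
    BoundedIntegrals (ballKernel (k + 2) R) (polyhedron L) := by
  obtain ⟨α, hα⟩ := exists_ne (0 : EuclideanSpace ℝ (Fin (k + 1)))
  have h : Continuous fun y ↦ inner ℝ α y := by fun_prop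
  have hLm := (isClosed_polyhedron L).measurableSet
  have hnull : volume (polyhedron L ∩ {y | inner ℝ α y = 0}) = 0 := by
    refine measure_mono_null Set.inter_subset_right ?_
    have := volume_affineVal_eq_zero (p := (α, (0 : ℝ))) (by simpa using hα)
    simpa [affineVal] using this
  have heq : polyhedron L = (polyhedron L ∩ {y | 0 < inner ℝ α y} ∪
      polyhedron L ∩ {y | 0 < inner ℝ (-α) y}) ∪ polyhedron L ∩ {y | inner ℝ α y = 0} := by
    ext y
    simp only [Set.mem_union, Set.mem_inter_iff, Set.mem_ofPred_eq, inner_neg_left,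
      Left.neg_pos_iff]
    have := lt_trichotomy (inner ℝ α y) 0
    tauto
  have hInt (A : Set (EuclideanSpace ℝ (Fin (k + 1)))) (ε : ℝ) (hε : ε ∈ Set.Ioc (0 : ℝ) 1) :
      IntegrableOn (ballKernel (k + 2) R ε) A := (integrable_ballKernel hε.1 _ _).integrableOn
  rw [heq]
  refine BoundedIntegrals.union (hLm.inter (isClosed_eq h continuous_const).measurableSet)
    (measure_mono_null Set.inter_subset_right hnull) (hInt _)
    (BoundedIntegrals.union (hLm.inter (isOpen_lt continuous_const (by fun_prop)).measurableSet)
      ?_ (hInt _) (boundedIntegrals_halfCone ih hR hα hL)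
      (boundedIntegrals_halfCone ih hR (neg_ne_zero.2 hα) hL))
    ⟨0, fun ε _ ↦ by rw [setIntegral_measure_zero _ hnull, norm_zero]⟩
  refine measure_mono_null (fun y hy ↦ ?_) hnull
  have h₁ : 0 < inner ℝ α y := hy.1.2
  have h₂ : 0 < inner ℝ (-α) y := hy.2.2
  rw [inner_neg_left] at h₂
  linarith

lemma boundedIntegrals_coneCell
    (ih : ∀ (R : ℝ) (L : List (EuclideanSpace ℝ (Fin k) × ℝ)),
      BoundedIntegrals (ballKernel (k + 1) R) (polyhedron L))
    (hR : 0 < R) (a : EuclideanSpace ℝ (Fin (k + 1)))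
    {L : List (EuclideanSpace ℝ (Fin (k + 1)) × ℝ)} (hL : ∀ p ∈ L, p.2 = 0) :
    BoundedIntegrals (ballKernel (k + 2) R) (boundedCell (fun _ ↦ -1) L [(a, 0)] []) := by
  by_cases ha : a = 0
  · have : boundedCell (fun _ ↦ -1) L [(a, 0)] [] = polyhedron L := by
      ext y
      simp [boundedCell, affineVal, ha]
    rw [this]
    exact boundedIntegrals_cone ih hR hL
  · have heq : boundedCell (fun _ ↦ -1) L [(a, 0)] [] =
        (polyhedron L ∩ {y | 0 < inner ℝ (-a) y ∧ inner ℝ (-a) y ≤ 1}) ∪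
          polyhedron ((-a, 0) :: L) := by
      ext y
      simp only [boundedCell, polyhedron_cons, affineVal, List.forall_mem_cons, Set.mem_union,
        Set.mem_inter_iff, Set.mem_ofPred_eq, inner_neg_left, Left.neg_pos_iff, add_zero,
        List.not_mem_nil, false_imp_iff, forall_const, and_true]
      constructor
      · rintro ⟨h₁, h₂⟩
        rcases lt_or_ge (inner ℝ a y) 0 with h | h
        · exact Or.inl ⟨h₁, h, by linarith⟩
        · exact Or.inr ⟨by linarith, h₁⟩
      · rintro (⟨h₁, -, h₂⟩ | ⟨h, h₁⟩)
        · exact ⟨h₁, by linarith⟩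
        · exact ⟨h₁, by linarith⟩
    rw [heq]
    refine BoundedIntegrals.union (isClosed_polyhedron _).measurableSet ?_
      (fun ε hε ↦ (integrable_ballKernel hε.1 _ _).integrableOn)
      (boundedIntegrals_truncatedCone ih hR (neg_ne_zero.2 ha) hL)
      (boundedIntegrals_cone ih hR (by simpa using fun a b ↦ hL (a, b)))
    rw [polyhedron_cons]
    convert measure_empty (μ := volume)
    refine Set.eq_empty_of_forall_notMem fun y hy ↦ ?_
    have h₁ : 0 < inner ℝ (-a) y := hy.1.2.1
    have h₂ : inner ℝ (-a) y + 0 ≤ 0 := hy.2.1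
    linarith

lemma exists_polyhedron_eq_boundedCell {V : Type*} [NormedAddCommGroup V] [InnerProductSpace ℝ V]
    (L : List (V × ℝ)) : ∃ L' U D : List (V × ℝ), (∀ p ∈ L', p.2 = 0) ∧ (∀ p ∈ U, p.2 = 0) ∧
      (∀ p ∈ D, p.2 = 0) ∧ polyhedron L = boundedCell (fun _ ↦ -1) L' U D := by
  induction L with
  | nil => exact ⟨[], [], [], by simp, by simp, by simp, by ext; simp [polyhedron, boundedCell]⟩
  | cons p L ih =>
    obtain ⟨L', U, D, hL', hU, hD, h⟩ := ih
    obtain ⟨a, b⟩ := p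
    have hval (y : V) (hb : b ≠ 0) : affineVal (a, b) y = b * (inner ℝ (b⁻¹ • a) y + 1) := by
      simp only [affineVal, inner_smul_left, conj_trivial]
      field_simp
    rcases lt_trichotomy b 0 with hb | hb | hb
    · refine ⟨L', (b⁻¹ • a, 0) :: U, D, hL', by simpa using fun a b ↦ hU (a, b), hD, ?_⟩
      have h₁ (y : V) : affineVal (a, b) y ≤ 0 ↔ -1 ≤ affineVal (b⁻¹ • a, 0) y := by
        rw [affineVal.eq_def (b⁻¹ • a, 0), add_zero, hval y hb.ne]
        constructor <;> intro <;> nlinarith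
      rw [polyhedron_cons, h]
      ext y
      simp only [boundedCell, List.forall_mem_cons, Set.mem_inter_iff, Set.mem_ofPred_eq, h₁]
      tauto
    · refine ⟨(a, b) :: L', U, D, by simpa [hb] using fun a b ↦ hL' (a, b), hU, hD, ?_⟩
      rw [polyhedron_cons, h]
      ext y
      simp only [boundedCell, polyhedron_cons, Set.mem_inter_iff, Set.mem_ofPred_eq]
      tauto
    · refine ⟨L', U, (b⁻¹ • a, 0) :: D, hL', hU, by simpa using fun a b ↦ hD (a, b), ?_⟩
      have h₁ (y : V) : affineVal (a, b) y ≤ 0 ↔ affineVal (b⁻¹ • a, 0) y ≤ -1 := by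
        rw [affineVal.eq_def (b⁻¹ • a, 0), add_zero, hval y hb.ne']
        constructor <;> intro <;> nlinarith
      rw [polyhedron_cons, h]
      ext y
      simp only [boundedCell, List.forall_mem_cons, Set.mem_inter_iff, Set.mem_ofPred_eq, h₁]
      tauto

theorem boundedIntegrals_polyhedron (k : ℕ) : ∀ (R : ℝ) (L : List (EuclideanSpace ℝ (Fin k) × ℝ)),
    BoundedIntegrals (ballKernel (k + 1) R) (polyhedron L) := by
  induction k with
  | zero =>
    intro R L
    rcases le_or_gt R 0 with hR | hR
    · exact boundedIntegrals_ballKernel_of_nonpos hR _ _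
    · refine ⟨2 * (√R)⁻¹ * volume.real (polyhedron L), fun ε _ ↦
        norm_setIntegral_le_of_norm_le_const
          ((Set.toFinite _).isBounded.measure_lt_top) fun y _ ↦ ?_⟩
      have : √(R - ‖y‖ ^ 2) = √R := by simp [Subsingleton.elim y 0]
      rw [ballKernel, this]
      exact norm_oddKernel_one_le (Real.sqrt_pos.2 hR)
  | succ k ih =>
    intro R L
    rcases le_or_gt R 0 with hR | hR
    · exact boundedIntegrals_ballKernel_of_nonpos hR _ _
    obtain ⟨L', U, D, hL', hU, hD, h⟩ := exists_polyhedron_eq_boundedCell L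
    have h' : polyhedron L = boundedCell (fun _ ↦ -1) L' ((0, 0) :: U) D := by
      rw [h]
      ext y
      simp [boundedCell, affineVal]
    rw [h']
    refine boundedIntegrals_boundedCell
      (W := (AddMonoidHom.snd (EuclideanSpace ℝ (Fin (k + 1))) ℝ).ker) continuous_const ?_
      (fun p _ ε hε ↦ (integrable_ballKernel hε.1 _ _).integrableOn) ?_
      (AddMonoidHom.mem_ker.2 rfl) hL' D U hU hD
    · rintro ⟨a, b⟩ hb
      obtain rfl : b = 0 := hb
      have := volume_affineVal_eq_zero (p := (a, (1 : ℝ))) (by simp)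
      convert! this using 3 with x
      simp only [affineVal, add_zero, eq_neg_iff_add_eq_zero, eq_comm (a := (-1 : ℝ))]
    · rintro ⟨a, b⟩ hb L hL
      obtain rfl : b = 0 := hb
      exact boundedIntegrals_coneCell ih hR a hL

end Polyhedron

section Cell

variable {k : ℕ}

lemma setIntegral_poleKernel {ε : ℝ} (hε : 0 < ε) (k : ℕ) (r : ℝ) :
    ∫ t in {t : ℝ | t ^ 2 ≤ r}, poleKernel (k + 2) ε t =
      -((k : ℂ) + 1)⁻¹ * oddKernel (k + 1) ε √r := by
  rcases lt_or_ge r 0 with hr | hr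
  · have : {t : ℝ | t ^ 2 ≤ r} = ∅ :=
      Set.eq_empty_of_forall_notMem fun t (ht : t ^ 2 ≤ r) ↦ by nlinarith [sq_nonneg t]
    rw [this, Real.sqrt_eq_zero_of_nonpos hr.le]
    simp
  · have : {t : ℝ | t ^ 2 ≤ r} = Set.Icc (-√r) √r := by
      ext t
      exact Real.sq_le hr
    have hk : (k + 1 : ℂ) ≠ 0 := by exact_mod_cast k.succ_ne_zero
    have hd (t : ℝ) : HasDerivAt (fun t ↦ -((k : ℂ) + 1)⁻¹ * poleKernel (k + 1) ε t)
        (poleKernel (k + 2) ε t) t := by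
      refine ((hasDerivAt_poleKernel hε (k + 1) t).const_mul _).congr_deriv ?_
      push_cast
      field_simp
    rw [this, integral_Icc_eq_integral_Ioc, ← intervalIntegral.integral_of_le
      (by linarith [Real.sqrt_nonneg r]), intervalIntegral.integral_eq_sub_of_hasDerivAt
      (fun t _ ↦ hd t) ((continuous_poleKernel hε _).intervalIntegrable _ _), oddKernel]
    ring

lemma isCompact_norm_sq_le_affineVal {V : Type*} [NormedAddCommGroup V] [InnerProductSpace ℝ V]
    [FiniteDimensional ℝ V] (p : V × ℝ) : IsCompact {x : V | ‖x‖ ^ 2 ≤ affineVal p x} := by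
  refine Metric.isCompact_of_isClosed_isBounded
    (isClosed_le (by fun_prop) (continuous_affineVal p))
    ((isBounded_iff_subset_closedBall 0).2 ⟨‖p.1‖ + |p.2| + 1, fun x hx ↦ ?_⟩)
  rw [mem_closedBall_zero_iff]
  have h₁ : ‖x‖ ^ 2 ≤ inner ℝ p.1 x + p.2 := hx
  have h₂ := real_inner_le_norm p.1 x
  have h₃ := le_abs_self p.2
  have h₄ := abs_nonneg p.2
  by_contra! h
  nlinarith [norm_nonneg x, norm_nonneg p.1]

lemma volume_norm_sq_eq_affineVal {V : Type*} [NormedAddCommGroup V] [InnerProductSpace ℝ V]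
    [FiniteDimensional ℝ V] [Nontrivial V] [MeasurableSpace V] [BorelSpace V] (p : V × ℝ) :
    volume {x : V | ‖x‖ ^ 2 = affineVal p x} = 0 := by
  set m := (2 : ℝ)⁻¹ • p.1 with hm
  refine measure_mono_null (fun x hx ↦ ?_) (Measure.addHaar_sphere volume m √(p.2 + ‖m‖ ^ 2))
  have h₁ : ‖x‖ ^ 2 = inner ℝ p.1 x + p.2 := hx
  have h₂ : p.1 = (2 : ℝ) • m := by simp [hm]
  have h₃ := norm_sub_sq_real x m
  rw [h₂, inner_smul_left, conj_trivial, real_inner_comm] at h₁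
  rw [mem_sphere_iff_norm, show p.2 + ‖m‖ ^ 2 = ‖x - m‖ ^ 2 by linarith,
    Real.sqrt_sq (norm_nonneg _)]

lemma continuous_poleKernel_inner {ε : ℝ} (hε : 0 < ε) (j : ℕ)
    (e : EuclideanSpace ℝ (Fin (k + 1))) : Continuous fun x ↦ poleKernel j ε (inner ℝ e x) :=
  (continuous_poleKernel hε j).comp (by fun_prop)

lemma integrableOn_poleKernel {ε : ℝ} (hε : 0 < ε) (j : ℕ) (e : EuclideanSpace ℝ (Fin (k + 1)))
    (p : EuclideanSpace ℝ (Fin (k + 1)) × ℝ) :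
    IntegrableOn (fun x ↦ poleKernel j ε (inner ℝ e x)) {x | ‖x‖ ^ 2 ≤ affineVal p x} :=
  (continuous_poleKernel_inner hε j e).continuousOn.integrableOn_compact
    (isCompact_norm_sq_le_affineVal p)

lemma boundedIntegrals_ballCell {e : EuclideanSpace ℝ (Fin (k + 1))} (he : ‖e‖ = 1)
    {p : EuclideanSpace ℝ (Fin (k + 1)) × ℝ} (hp : inner ℝ e p.1 = 0)
    {L : List (EuclideanSpace ℝ (Fin (k + 1)) × ℝ)} (hL : ∀ q ∈ L, inner ℝ e q.1 = 0) :
    BoundedIntegrals (fun ε x ↦ poleKernel (k + 2) ε (inner ℝ e x))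
      (boundedCell (fun x ↦ ‖x‖ ^ 2) L [p] []) := by
  obtain ⟨J, hJm, hJi, hJe⟩ := exists_adapted_coordinates e he
  set A := boundedCell (fun x ↦ ‖x‖ ^ 2) L [p] [] with hA
  have hAm : MeasurableSet A := (isClosed_boundedCell (by fun_prop) _ _ _).measurableSet
  have heJ (q) : inner ℝ e (J q) = q.1 := by rw [← hJe, hJi]; simp
  have hnorm (q) : ‖J q‖ ^ 2 = q.1 ^ 2 + ‖q.2‖ ^ 2 := by
    rw [← real_inner_self_eq_norm_sq, hJi, real_inner_self_eq_norm_sq]; ring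
  have hinner {a : EuclideanSpace ℝ (Fin (k + 1))} (ha : inner ℝ e a = 0) (q) :
      inner ℝ a (J q) = inner ℝ (J.symm a).2 q.2 := by
    have h₁ : (J.symm a).1 = 0 := by rw [← heJ, J.apply_symm_apply, ha]
    simpa [h₁] using hJi (J.symm a) q
  set m := (2 : ℝ)⁻¹ • (J.symm p.1).2 with hm
  have hpm : (J.symm p.1).2 = (2 : ℝ) • m := by simp [hm]
  set R := p.2 + ‖m‖ ^ 2 with hR
  let L' : List (EuclideanSpace ℝ (Fin k) × ℝ) :=
    L.map fun q ↦ ((J.symm q.1).2, q.2 + inner ℝ (J.symm q.1).2 m)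
  have hmem (t : ℝ) (w) : J (t, w + m) ∈ A ↔ w ∈ polyhedron L' ∧ t ^ 2 ≤ R - ‖w‖ ^ 2 := by
    simp only [hA, boundedCell, List.forall_mem_cons, Set.mem_ofPred_eq, List.not_mem_nil,
      false_imp_iff, forall_const, and_true]
    refine and_congr ?_ ?_
    · simp only [polyhedron, L', List.forall_mem_map, Set.mem_ofPred_eq]
      refine forall₂_congr fun q hq ↦ ?_
      rw [affineVal, affineVal, hinner (hL q hq), inner_add_right]
      ring_nf
    · rw [hnorm, affineVal, hinner hp, hpm, inner_smul_left, conj_trivial, inner_add_right,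
        real_inner_self_eq_norm_sq, norm_add_sq_real, real_inner_comm w m, hR]
      constructor <;> intro <;> linarith
  obtain ⟨C, hC⟩ := boundedIntegrals_polyhedron k R L'
  refine ⟨‖-((k : ℂ) + 1)⁻¹‖ * C, fun ε hε ↦ ?_⟩
  suffices h : ∫ x in A, poleKernel (k + 2) ε (inner ℝ e x) =
      -((k : ℂ) + 1)⁻¹ * ∫ w in polyhedron L', ballKernel (k + 1) R ε w by
    rw [h, norm_mul]
    exact mul_le_mul_of_nonneg_left (hC ε hε) (norm_nonneg _)
  have hInt : IntegrableOn (fun x ↦ poleKernel (k + 2) ε (inner ℝ e x)) A :=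
    (integrableOn_poleKernel hε.1 (k + 2) e p).mono_set fun x hx ↦ hx.2.1 p (by simp)
  have hJemb : MeasurableEmbedding J := J.toHomeomorph.measurableEmbedding
  have hInt' := (hJm.integrable_comp_emb hJemb).2 (hInt.integrable_indicator hAm)
  rw [← integral_indicator hAm, ← hJm.integral_comp hJemb, Measure.volume_eq_prod,
    integral_prod_symm (fun q ↦ A.indicator _ (J q)) hInt', ← integral_add_right_eq_self _ m,
    ← integral_const_mul,
    ← integral_indicator (isClosed_polyhedron L').measurableSet]
  congr 1 with w
  by_cases hw : w ∈ polyhedron L'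
  · rw [Set.indicator_of_mem hw, ballKernel, ← setIntegral_poleKernel hε.1,
      ← integral_indicator (measurableSet_le (by fun_prop) measurable_const)]
    congr 1 with t
    by_cases ht : t ^ 2 ≤ R - ‖w‖ ^ 2
    · rw [Set.indicator_of_mem (s := {t : ℝ | t ^ 2 ≤ R - ‖w‖ ^ 2}) ht,
        Set.indicator_of_mem ((hmem t w).2 ⟨hw, ht⟩), heJ]
    · rw [Set.indicator_of_notMem (s := {t : ℝ | t ^ 2 ≤ R - ‖w‖ ^ 2}) ht,
        Set.indicator_of_notMem fun h ↦ ht ((hmem t w).1 h).2]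
  · rw [Set.indicator_of_notMem hw]
    refine integral_eq_zero_of_ae (ae_of_all _ fun t ↦ ?_)
    exact Set.indicator_of_notMem (fun h ↦ hw ((hmem t w).1 h).1) _

lemma boundedIntegrals_normSqCell {e : EuclideanSpace ℝ (Fin (k + 1))} (he : ‖e‖ = 1)
    {p : EuclideanSpace ℝ (Fin (k + 1)) × ℝ} (hp : inner ℝ e p.1 = 0)
    {L U D : List (EuclideanSpace ℝ (Fin (k + 1)) × ℝ)} (hL : ∀ q ∈ L, inner ℝ e q.1 = 0)
    (hU : ∀ q ∈ U, inner ℝ e q.1 = 0) (hD : ∀ q ∈ D, inner ℝ e q.1 = 0) :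
    BoundedIntegrals (fun ε x ↦ poleKernel (k + 2) ε (inner ℝ e x))
      (boundedCell (fun x ↦ ‖x‖ ^ 2) L (p :: U) D) :=
  boundedIntegrals_boundedCell
    (W := ((innerₛₗ ℝ e).toAddMonoidHom.comp (AddMonoidHom.fst _ ℝ)).ker) (by fun_prop)
    (fun p _ ↦ volume_norm_sq_eq_affineVal p)
    (fun p _ ε hε ↦ integrableOn_poleKernel hε.1 (k + 2) e p)
    (fun _ hp _ hL ↦ boundedIntegrals_ballCell he hp hL) hp hL D U hU hD

end Cell

lemma exists_inter_boundedCell_eq {H : Set (EuclideanSpace ℝ (Fin n))}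
    (hH : IsDHHalfSpace H) {L U D : List (EuclideanSpace ℝ (Fin n) × ℝ)}
    (hL : ∀ p ∈ L, p.1 0 = 0) (hU : ∀ p ∈ U, p.1 0 = 0) (hD : ∀ p ∈ D, p.1 0 = 0) :
    ∃ L' U' D' : List (EuclideanSpace ℝ (Fin n) × ℝ), (∀ p ∈ L', p.1 0 = 0) ∧
      (∀ p ∈ U', p.1 0 = 0) ∧ (∀ p ∈ D', p.1 0 = 0) ∧
      H ∩ boundedCell (fun x ↦ ‖x‖ ^ 2) L U D = boundedCell (fun x ↦ ‖x‖ ^ 2) L' U' D' := by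
  have hball (c : EuclideanSpace ℝ (Fin n)) (r : ℝ) (x : EuclideanSpace ℝ (Fin n)) :
      ‖x - c‖ ^ 2 - r ^ 2 = ‖x‖ ^ 2 - affineVal ((2 : ℝ) • c, r ^ 2 - ‖c‖ ^ 2) x := by
    rw [norm_sub_sq_real, affineVal, inner_smul_left, conj_trivial, real_inner_comm]
    ring
  rcases hH with ⟨c, r, hr, hc, rfl⟩ | ⟨c, r, hr, hc, rfl⟩ | ⟨v, t, -, hv, rfl⟩
  · refine ⟨L, ((2 : ℝ) • c, r ^ 2 - ‖c‖ ^ 2) :: U, D, hL, ?_, hD, ?_⟩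
    · simpa [hc] using fun a b ↦ hU (a, b)
    · ext x
      have : x ∈ closedBall c r ↔
          ‖x‖ ^ 2 ≤ affineVal ((2 : ℝ) • c, r ^ 2 - ‖c‖ ^ 2) x := by
        rw [mem_closedBall_iff_norm, ← sub_nonpos (a := ‖x‖ ^ 2), ← hball, sub_nonpos,
          sq_le_sq₀ (norm_nonneg _) hr.le]
      simp only [boundedCell, List.forall_mem_cons, Set.mem_inter_iff, this, Set.mem_ofPred_eq]
      tauto
  · refine ⟨L, U, ((2 : ℝ) • c, r ^ 2 - ‖c‖ ^ 2) :: D, hL, hU, ?_, ?_⟩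
    · simpa [hc] using fun a b ↦ hD (a, b)
    · ext x
      have : x ∈ (ball c r)ᶜ ↔
          affineVal ((2 : ℝ) • c, r ^ 2 - ‖c‖ ^ 2) x ≤ ‖x‖ ^ 2 := by
        rw [Set.mem_compl_iff, mem_ball_iff_norm, not_lt, ← sub_nonneg (a := ‖x‖ ^ 2), ← hball,
          sub_nonneg, sq_le_sq₀ hr.le (norm_nonneg _)]
      simp only [boundedCell, List.forall_mem_cons, Set.mem_inter_iff, this, Set.mem_ofPred_eq]
      tauto
  · refine ⟨(-v, t) :: L, U, D, ?_, hU, hD, ?_⟩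
    · simpa [hv] using fun a b ↦ hL (a, b)
    · ext x
      have : t ≤ inner ℝ v x ↔ affineVal (-v, t) x ≤ 0 := by
        rw [affineVal, inner_neg_left]
        constructor <;> intro <;> linarith
      simp only [boundedCell, polyhedron_cons, Set.mem_inter_iff, this, Set.mem_ofPred_eq]
      tauto

lemma exists_eq_boundedCell {P : Set (EuclideanSpace ℝ (Fin n))}
    (hP : IsDHPolytope P) : ∃ L U D : List (EuclideanSpace ℝ (Fin n) × ℝ),
      (∀ p ∈ L, p.1 0 = 0) ∧ (∀ p ∈ U, p.1 0 = 0) ∧ (∀ p ∈ D, p.1 0 = 0) ∧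
      P = boundedCell (fun x ↦ ‖x‖ ^ 2) L U D := by
  classical
  obtain ⟨S, hS, rfl⟩ := hP
  induction S using Finset.induction_on with
  | empty => exact ⟨[], [], [], by simp, by simp, by simp, by ext; simp [boundedCell, polyhedron]⟩
  | insert H S _ ih =>
    obtain ⟨L, U, D, hL, hU, hD, h⟩ := ih fun H' hH' ↦ hS H' (Finset.mem_insert_of_mem hH')
    obtain ⟨L', U', D', hL', hU', hD', h'⟩ :=
      exists_inter_boundedCell_eq (hS H (Finset.mem_insert_self H S)) hL hU hD
    exact ⟨L', U', D', hL', hU', hD', by rw [Finset.coe_insert, Set.sInter_insert, h, h']⟩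

lemma boundedIntegrals_of_isDHPolytope {k : ℕ} [NeZero (k + 1)]
    {P : Set (EuclideanSpace ℝ (Fin (k + 1)))} (hP : IsDHPolytope P)
    (hPb : Bornology.IsBounded P) :
    BoundedIntegrals (fun ε x ↦ poleKernel (k + 2) ε (x 0)) P := by
  obtain ⟨L, U, D, hL, hU, hD, rfl⟩ := exists_eq_boundedCell hP
  obtain ⟨ρ, hρ⟩ := (isBounded_iff_subset_closedBall 0).1 hPb
  have h : boundedCell (fun x ↦ ‖x‖ ^ 2) L U D =
      boundedCell (fun x ↦ ‖x‖ ^ 2) L ((0, ρ ^ 2) :: U) D := by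
    ext x
    have : x ∈ boundedCell (fun x ↦ ‖x‖ ^ 2) L U D → ‖x‖ ^ 2 ≤ affineVal (0, ρ ^ 2) x := by
      intro hx
      have := mem_closedBall_zero_iff.1 (hρ hx)
      simp only [affineVal, inner_zero_left, zero_add]
      gcongr
    simp only [boundedCell, List.forall_mem_cons, Set.mem_ofPred_eq] at this ⊢
    tauto
  have he (x : EuclideanSpace ℝ (Fin (k + 1))) :
      inner ℝ (EuclideanSpace.single (0 : Fin (k + 1)) (1 : ℝ)) x = x 0 := by
    simp [EuclideanSpace.inner_single_left]
  have := boundedIntegrals_normSqCell (e := EuclideanSpace.single (0 : Fin (k + 1)) (1 : ℝ))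
    (p := (0, ρ ^ 2)) (L := L) (U := U) (D := D) (by simp) (by simp) (by simpa [he] using hL)
    (by simpa [he] using hU) (by simpa [he] using hD)
  rw [h]
  simpa only [he] using this

end DHPolytope

/-- **Lemma 6.4(2)**: for a bounded DH-polytope `P ⊆ ℝⁿ`,
`ε · g_{u,ε}(P) = ε · ∫_P (x₀ - εi)^{-(n+1)} dx → 0` as `ε → 0⁺`. -/
theorem dh_eps_g_tendsto_zero (n : ℕ) [NeZero n]
    (P : Set (EuclideanSpace ℝ (Fin n)))
    (hP : IsDHPolytope P) (hPb : Bornology.IsBounded P) :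
    Tendsto
      (fun ε : ℝ => (ε : ℂ) *
        ∫ x in P, ((x 0 : ℂ) - (ε : ℂ) * Complex.I) ^ (-(n + 1 : ℤ)))
      (nhdsWithin 0 (Set.Ioi 0)) (nhds 0) := by
  obtain ⟨k, rfl⟩ := Nat.exists_eq_succ_of_ne_zero (NeZero.ne n)
  obtain ⟨C, hC⟩ := DHPolytope.boundedIntegrals_of_isDHPolytope hP hPb
  have hkernel (ε : ℝ) (x : EuclideanSpace ℝ (Fin (k + 1))) :
      ((x 0 : ℂ) - (ε : ℂ) * Complex.I) ^ (-((k + 1 : ℕ) + 1 : ℤ)) =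
        DHPolytope.poleKernel (k + 2) ε (x 0) := by
    rw [DHPolytope.poleKernel, zpow_neg, ← Nat.cast_succ, zpow_natCast]
  simp only [Nat.succ_eq_add_one, hkernel]
  have hlim : Tendsto (fun ε : ℝ ↦ ε * C) (nhdsWithin 0 (Set.Ioi 0)) (nhds 0) := by
    have : Continuous fun ε : ℝ ↦ ε * C := by fun_prop
    simpa using (this.tendsto 0).mono_left nhdsWithin_le_nhds
  refine squeeze_zero_norm' ?_ hlim
  filter_upwards [Ioc_mem_nhdsGT (zero_lt_one' ℝ)] with ε hε
  rw [norm_mul, Complex.norm_real, Real.norm_of_nonneg hε.1.le]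
  exact mul_le_mul_of_nonneg_left (hC ε hε) hε.1.le
end

section
/- Let n ≥ 1 and let P be a spherical DH-polytope in Sⁿ ⊆ ℝ^{n+1}. Then lim_{ε→0⁺} ε · ∫_P (x₀ − εi)^{−(n+1)} dσ(x) = 0. Consequently, the two families of integrals ∫_P x₀ (x₀ − εi)^{−(n+1)} dσ(x) and ∫_P (x₀ − εi)^{−n} dσ(x), whose difference equals εi · ∫_P (x₀ − εi)^{−(n+1)} dσ(x), have the same limiting behavior as ε → 0⁺. (Lemma 7.3(2) and the resulting Corollary 7.4 that μ′_h(P) = μ_h(P).) -/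
open MeasureTheory Filter Metric

/-- The spherical surface measure on the unit sphere `Sⁿ ⊆ ℝ^{n+1}`, obtained from the
polar decomposition of Lebesgue measure. -/
noncomputable def sphereMeasure (n : ℕ) :
    Measure (sphere (0 : EuclideanSpace ℝ (Fin (n + 1))) 1) :=
  (volume : Measure (EuclideanSpace ℝ (Fin (n + 1)))).toSphere

/-- A *spherical DH-polytope* in `Sⁿ ⊆ ℝ^{n+1}` (hemisphere model of `DHⁿ`): an intersection
of the unit sphere with finitely many closed affine half-spaces whose normal vectors are
nonzero with first coordinate `0`. -/
def IsSphericalDHPolytope (n : ℕ) (P : Set (EuclideanSpace ℝ (Fin (n + 1)))) : Prop :=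
  ∃ S : Finset (EuclideanSpace ℝ (Fin (n + 1)) × ℝ),
    (∀ p ∈ S, p.1 ≠ 0 ∧ p.1 0 = 0) ∧
    P = sphere (0 : EuclideanSpace ℝ (Fin (n + 1))) 1 ∩
      ⋂ p ∈ S, {x : EuclideanSpace ℝ (Fin (n + 1)) | p.2 ≤ inner p.1 x (𝕜 := ℝ)}

/-- The holomorphic extension of `s ↦ √(b² + c (s² + ρ²))` to the strip `|Im s| < ρ`. -/
noncomputable def stripRoot (b c ρ : ℝ) (s : ℂ) : ℂ :=
  ((b : ℂ) ^ 2 + c * (s ^ 2 + (ρ : ℂ) ^ 2)) ^ (2⁻¹ : ℂ)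

lemma stripRoot_sq (b c ρ : ℝ) (s : ℂ) :
    stripRoot b c ρ s ^ 2 = (b : ℂ) ^ 2 + c * (s ^ 2 + (ρ : ℂ) ^ 2) := by
  simp [stripRoot]

lemma radicand_re_gt {b c ρ : ℝ} (hc : 0 < c) {s : ℂ} (hs : |s.im| < ρ) :
    b ^ 2 < ((b : ℂ) ^ 2 + c * (s ^ 2 + (ρ : ℂ) ^ 2)).re := by
  have h1 : s.im ^ 2 < ρ ^ 2 := by
    rw [← sq_abs s.im]
    exact pow_lt_pow_left₀ hs (abs_nonneg _) (by norm_num)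
  have h2 : ((b : ℂ) ^ 2 + c * (s ^ 2 + (ρ : ℂ) ^ 2)).re
      = b ^ 2 + c * (s.re ^ 2 - s.im ^ 2 + ρ ^ 2) := by
    simp [pow_two]
  rw [h2]
  have : 0 < c * (s.re ^ 2 - s.im ^ 2 + ρ ^ 2) := mul_pos hc (by nlinarith [sq_nonneg s.re])
  linarith

lemma abs_lt_stripRoot_re {b c ρ : ℝ} (hc : 0 < c) {s : ℂ} (hs : |s.im| < ρ) :
    |b| < (stripRoot b c ρ s).re := by
  have h0 : 0 ≤ (stripRoot b c ρ s).re := by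
    rw [stripRoot, Complex.cpow_inv_two_re]
    positivity
  have h1 := radicand_re_gt (b := b) hc hs
  rw [← stripRoot_sq] at h1
  have h2 : (stripRoot b c ρ s ^ 2).re
      = (stripRoot b c ρ s).re ^ 2 - (stripRoot b c ρ s).im ^ 2 := by
    simp [pow_two]
  rw [h2] at h1
  apply abs_lt_of_sq_lt_sq _ h0
  nlinarith [sq_nonneg (stripRoot b c ρ s).im]

lemma stripRoot_ofReal {b c ρ : ℝ} (hc : 0 < c) (s : ℝ) :
    stripRoot b c ρ s = (√(b ^ 2 + c * (s ^ 2 + ρ ^ 2)) : ℝ) := by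
  have h : 0 ≤ b ^ 2 + c * (s ^ 2 + ρ ^ 2) := by positivity
  rw [stripRoot, Real.sqrt_eq_rpow, Complex.ofReal_cpow h]
  push_cast
  norm_num

lemma differentiableAt_stripRoot {b c ρ : ℝ} (hc : 0 < c) {s : ℂ} (hs : |s.im| < ρ) :
    DifferentiableAt ℂ (stripRoot b c ρ) s := by
  unfold stripRoot
  refine DifferentiableAt.cpow_const (by fun_prop) (Or.inl ?_)
  exact (sq_nonneg b).trans_lt (radicand_re_gt hc hs)

/-- The integrand of the projected kernel along a vertical line, extended to a strip. -/
noncomputable def stripKernel (m : ℕ) (ε b c ρ : ℝ) (s : ℂ) : ℂ :=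
  ((s - ε * Complex.I * ((b + stripRoot b c ρ s) / c)) ^ m)⁻¹ *
    (((b + stripRoot b c ρ s) / c) / stripRoot b c ρ s)

lemma stripKernel_base_im {ε b c ρ : ℝ} (s : ℂ) :
    (s - ε * Complex.I * ((b + stripRoot b c ρ s) / c)).im
      = s.im - ε * ((b + (stripRoot b c ρ s).re) / c) := by
  have : ε * Complex.I * ((b + stripRoot b c ρ s) / c)
    = ((ε / c : ℝ) : ℂ) * (Complex.I * (b + stripRoot b c ρ s)) := by push_cast; ring
  rw [this, Complex.sub_im, Complex.im_ofReal_mul]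
  simp
  ring

lemma stripKernel_base_im_lt {ε b c ρ : ℝ} (hε : 0 < ε) (hc : 0 < c) {s : ℂ} (hs : |s.im| < ρ) :
    (s - ε * Complex.I * ((b + stripRoot b c ρ s) / c)).im < s.im := by
  have h1 := abs_lt_stripRoot_re (b := b) hc hs
  have h2 : 0 < (b + (stripRoot b c ρ s).re) / c := div_pos (by linarith [neg_abs_le b]) hc
  rw [stripKernel_base_im]
  linarith [mul_pos hε h2]

lemma stripRoot_ne_zero {b c ρ : ℝ} (hc : 0 < c) {s : ℂ} (hs : |s.im| < ρ) :
    stripRoot b c ρ s ≠ 0 := by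
  intro h
  have h1 := abs_lt_stripRoot_re (b := b) hc hs
  rw [h] at h1
  exact absurd h1 (by simp)

lemma differentiableAt_stripKernel {m : ℕ} {ε b c ρ : ℝ} (hε : 0 < ε) (hc : 0 < c) {s : ℂ}
    (hs : |s.im| < ρ) (him : s.im ≤ 0) : DifferentiableAt ℂ (stripKernel m ε b c ρ) s := by
  have h0 := differentiableAt_stripRoot (b := b) hc hs
  have h1 := stripRoot_ne_zero (b := b) hc hs
  have h2 : (s - ε * Complex.I * ((b + stripRoot b c ρ s) / c)) ^ m ≠ 0 := by
    apply pow_ne_zero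
    intro h
    have := stripKernel_base_im_lt (b := b) hε hc hs
    rw [h] at this
    exact absurd this (by simpa using him)
  unfold stripKernel
  fun_prop (disch := assumption)

lemma norm_add_stripRoot_le {b c ρ : ℝ} (hc : 0 < c) {s : ℂ} (hs : |s.im| < ρ) :
    ‖(b + stripRoot b c ρ s) / c‖ ≤ 2 / c * ‖stripRoot b c ρ s‖ := by
  have h1 := abs_lt_stripRoot_re (b := b) hc hs
  have h2 := (Complex.re_le_norm (stripRoot b c ρ s))
  rw [norm_div, Complex.norm_real, Real.norm_of_nonneg hc.le, div_mul_eq_mul_div]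
  gcongr
  refine (norm_add_le _ _).trans ?_
  rw [Complex.norm_real, Real.norm_eq_abs]
  linarith

lemma norm_stripKernel_le {m : ℕ} {ε b c ρ : ℝ} (hc : 0 < c) {s : ℂ} (hs : |s.im| < ρ)
    (h : 1 / 2 ≤ ‖s - ε * Complex.I * ((b + stripRoot b c ρ s) / c)‖) :
    ‖stripKernel m ε b c ρ s‖ ≤ 2 ^ m * (2 / c) := by
  have h1 : 0 < ‖stripRoot b c ρ s‖ := norm_pos_iff.2 (stripRoot_ne_zero hc hs)
  rw [stripKernel, norm_mul, norm_inv, norm_pow, norm_div _ (stripRoot b c ρ s)]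
  refine mul_le_mul ?_ ((div_le_iff₀ h1).2 (norm_add_stripRoot_le hc hs)) (by positivity)
    (by positivity)
  rw [← inv_pow]
  refine pow_le_pow_left₀ (by positivity) ?_ m
  rw [inv_le_comm₀ (by linarith) (by norm_num)]
  linarith

lemma norm_stripRoot_le {b c ρ : ℝ} (hc : 0 < c) (hc1 : c ≤ 1) (hb : |b| ≤ 2) (hρ : |ρ| ≤ 2)
    {s : ℂ} (hs : ‖s‖ ≤ 5 / 2) : ‖stripRoot b c ρ s‖ ≤ 4 := by
  have h : ‖stripRoot b c ρ s‖ ^ 2 ≤ 4 ^ 2 := by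
    rw [← norm_pow, stripRoot_sq]
    have h1 : ‖(b : ℂ) ^ 2‖ ≤ 2 ^ 2 := by
      rw [norm_pow, Complex.norm_real]
      exact pow_le_pow_left₀ (norm_nonneg _) hb 2
    have h2 : ‖(ρ : ℂ) ^ 2‖ ≤ 2 ^ 2 := by
      rw [norm_pow, Complex.norm_real]
      exact pow_le_pow_left₀ (norm_nonneg _) hρ 2
    have h3 : ‖s ^ 2‖ ≤ (5 / 2) ^ 2 := by
      rw [norm_pow]
      exact pow_le_pow_left₀ (norm_nonneg _) hs 2
    have h4 : ‖(c : ℂ)‖ ≤ 1 := by rwa [Complex.norm_real, Real.norm_of_nonneg hc.le]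
    have h5 : ‖(c : ℂ) * (s ^ 2 + (ρ : ℂ) ^ 2)‖ ≤ 1 * ((5 / 2) ^ 2 + 2 ^ 2) := by
      rw [norm_mul]
      have := (norm_add_le (s ^ 2) ((ρ : ℂ) ^ 2)).trans (add_le_add h3 h2)
      gcongr
    refine (norm_add_le _ _).trans ((add_le_add h1 h5).trans (by norm_num))
  exact le_of_sq_le_sq h (by norm_num)

lemma norm_stripKernel_side_le {m : ℕ} {ε b c ρ : ℝ} (hε : 0 < ε) (hc : 0 < c) (hc1 : c ≤ 1)
    (hεc : ε ≤ c / 16) (hb : |b| ≤ 2) (hρ1 : 1 ≤ ρ) (hρ2 : ρ ≤ 2) {s : ℂ}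
    (hre : |s.re| = ρ) (him : |s.im| ≤ 1 / 2) :
    ‖stripKernel m ε b c ρ s‖ ≤ 2 ^ m * (2 / c) := by
  have hs : |s.im| < ρ := by linarith
  refine norm_stripKernel_le hc hs ?_
  have h1 : ‖s‖ ≤ 5 / 2 := (Complex.norm_le_abs_re_add_abs_im s).trans (by linarith)
  have h2 : 1 ≤ ‖s‖ := by linarith [Complex.abs_re_le_norm s]
  have h3 := norm_stripRoot_le (b := b) hc hc1 hb (ρ := ρ) (by rw [abs_of_nonneg] <;> linarith) h1
  have h4 := norm_add_stripRoot_le (b := b) hc hs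
  have h5 : ‖ε * Complex.I * ((b + stripRoot b c ρ s) / c)‖ ≤ 1 / 2 := by
    rw [norm_mul, norm_mul, Complex.norm_I, Complex.norm_real, Real.norm_of_nonneg hε.le, mul_one]
    calc ε * ‖(b + stripRoot b c ρ s) / c‖ ≤ c / 16 * (2 / c * 4) := by
          gcongr
          exact h4.trans (by gcongr)
      _ = 1 / 2 := by field_simp; norm_num
  have := norm_sub_norm_le s (ε * Complex.I * ((b + stripRoot b c ρ s) / c))
  linarith

/-- Shifting the contour into the lower half-plane bounds the integral uniformly in `ε`. -/
lemma norm_integral_stripKernel_le {m : ℕ} {ε b c ρ : ℝ} (hε : 0 < ε) (hc : 0 < c) (hc1 : c ≤ 1)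
    (hεc : ε ≤ c / 16) (hb : |b| ≤ 2) (hρ1 : 1 ≤ ρ) (hρ2 : ρ ≤ 2) :
    ‖∫ s in (-ρ)..ρ, stripKernel m ε b c ρ s‖ ≤ 5 * (2 ^ m * (2 / c)) := by
  set f := stripKernel m ε b c ρ
  have key := Complex.integral_boundary_rect_eq_zero_of_differentiableOn f
    ⟨-ρ, -(1 / 2)⟩ ⟨ρ, 0⟩ (by
      intro s hs
      obtain ⟨-, h2⟩ := Complex.mem_reProdIm.1 hs
      rw [Set.uIcc_of_le (by norm_num)] at h2
      refine (differentiableAt_stripKernel hε hc ?_ h2.2).differentiableWithinAt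
      rw [abs_of_nonpos h2.2]
      linarith [h2.1])
  have hbot : ‖∫ x in (-ρ)..ρ, f (x + ((-(1 / 2) : ℝ) : ℂ) * Complex.I)‖
      ≤ 2 ^ m * (2 / c) * |ρ - -ρ| := by
    refine intervalIntegral.norm_integral_le_of_norm_le_const fun x _ => ?_
    have him : ((x : ℂ) + ((-(1 / 2) : ℝ) : ℂ) * Complex.I).im = -(1 / 2) := by simp
    have hs : |((x : ℂ) + ((-(1 / 2) : ℝ) : ℂ) * Complex.I).im| < ρ := by
      rw [him, abs_neg, abs_of_pos] <;> linarith
    refine norm_stripKernel_le hc hs ?_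
    have h1 := stripKernel_base_im_lt (b := b) hε hc hs
    refine le_trans ?_ (Complex.abs_im_le_norm _)
    rw [him] at h1
    rw [abs_of_neg (by linarith)]
    linarith
  have hside : ∀ u : ℝ, |u| = ρ → ‖∫ y in (-(1 / 2) : ℝ)..0, f ((u : ℂ) + y * Complex.I)‖
      ≤ 2 ^ m * (2 / c) * |0 - -(1 / 2)| := by
    intro u hu
    refine intervalIntegral.norm_integral_le_of_norm_le_const fun y hy => ?_
    rw [Set.uIoc_of_le (by norm_num)] at hy
    refine norm_stripKernel_side_le hε hc hc1 hεc hb hρ1 hρ2 (by simpa using hu) ?_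
    have : ((u : ℂ) + y * Complex.I).im = y := by simp
    rw [this, abs_of_nonpos hy.2]
    linarith [hy.1]
  have hr := hside ρ (abs_of_nonneg (by linarith))
  have hl := hside (-ρ) (by rw [abs_neg, abs_of_nonneg (by linarith)])
  have e1 : |ρ - -ρ| = 2 * ρ := by rw [abs_of_nonneg] <;> linarith
  have e2 : |(0 : ℝ) - -(1 / 2)| = 1 / 2 := by rw [abs_of_nonneg] <;> norm_num
  rw [e1] at hbot
  rw [e2] at hr hl
  simp only [Complex.ofReal_zero, zero_mul, add_zero] at key
  have htop : (∫ s in (-ρ)..ρ, f s) = (∫ x in (-ρ)..ρ, f (x + ((-(1 / 2) : ℝ) : ℂ) * Complex.I))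
      + Complex.I • (∫ y in (-(1 / 2) : ℝ)..0, f ((ρ : ℂ) + y * Complex.I))
      - Complex.I • (∫ y in (-(1 / 2) : ℝ)..0, f (((-ρ : ℝ) : ℂ) + y * Complex.I)) := by
    linear_combination -key
  rw [htop]
  refine (norm_sub_le _ _).trans ((add_le_add_left (norm_add_le _ _) _).trans ?_)
  rw [norm_smul, norm_smul, Complex.norm_I, one_mul, one_mul]
  have : 0 ≤ 2 ^ m * (2 / c) := by positivity
  nlinarith

lemma norm_integral_fibre_le {m : ℕ} {ε b c ρ : ℝ} (hε : 0 < ε) (hc : 0 < c) (hc1 : c ≤ 1)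
    (hεc : ε ≤ c / 16) (hb : |b| ≤ 2) (hρ1 : 1 ≤ ρ) (hρ2 : ρ ≤ 2) :
    ‖∫ s in (-ρ)..ρ, (((s : ℂ) - ε * Complex.I *
      ((b + √(b ^ 2 + c * (s ^ 2 + ρ ^ 2))) / c : ℝ)) ^ m)⁻¹ *
        (((b + √(b ^ 2 + c * (s ^ 2 + ρ ^ 2))) / c / √(b ^ 2 + c * (s ^ 2 + ρ ^ 2)) : ℝ) : ℂ)‖
      ≤ 5 * (2 ^ m * (2 / c)) := by
  convert norm_integral_stripKernel_le (m := m) hε hc hc1 hεc hb hρ1 hρ2 using 5 with s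
  rw [stripKernel, stripRoot_ofReal hc]
  push_cast
  rfl

lemma one_sub_norm_sq_pos {E : Type*} [NormedAddCommGroup E] {p : E} (hp : ‖p‖ < 1) :
    0 < 1 - ‖p‖ ^ 2 := by
  nlinarith [norm_nonneg p]

section ApexShift

open scoped RealInnerProductSpace

variable {E : Type*} [NormedAddCommGroup E] [InnerProductSpace ℝ E]

/-- The positively homogeneous map which sends the cone over a region of the unit sphere
bounded by affine hyperplanes through `p` to a region bounded by linear hyperplanes. -/
def apexShift (p x : E) : E := x - ‖x‖ • p

/-- The square root occurring in the inverse of `apexShift p`. -/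
noncomputable def apexRoot (p w : E) : ℝ := √(⟪p, w⟫ ^ 2 + (1 - ‖p‖ ^ 2) * ‖w‖ ^ 2)

/-- The norm of the preimage of `w` under `apexShift p`. -/
noncomputable def apexRadius (p w : E) : ℝ := (⟪p, w⟫ + apexRoot p w) / (1 - ‖p‖ ^ 2)

lemma inner_le_norm_of_norm_lt_one {p : E} (hp : ‖p‖ < 1) (x : E) : ⟪p, x⟫ ≤ ‖x‖ :=
  (real_inner_le_norm p x).trans (mul_le_of_le_one_left (norm_nonneg x) hp.le)

lemma apexRoot_apexShift {p : E} (hp : ‖p‖ < 1) (x : E) :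
    apexRoot p (apexShift p x) = ‖x‖ - ⟪p, x⟫ := by
  have h : ⟪p, apexShift p x⟫ ^ 2 + (1 - ‖p‖ ^ 2) * ‖apexShift p x‖ ^ 2
      = (‖x‖ - ⟪p, x⟫) ^ 2 := by
    rw [apexShift, norm_sub_sq_real, inner_sub_right, inner_smul_right, inner_smul_right,
      norm_smul, norm_norm, real_inner_self_eq_norm_sq, real_inner_comm]
    ring
  rw [apexRoot, h, Real.sqrt_sq (sub_nonneg.2 (inner_le_norm_of_norm_lt_one hp x))]

lemma apexRadius_apexShift {p : E} (hp : ‖p‖ < 1) (x : E) :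
    apexRadius p (apexShift p x) = ‖x‖ := by
  rw [apexRadius, apexRoot_apexShift hp, div_eq_iff (one_sub_norm_sq_pos hp).ne', apexShift,
    inner_sub_right, inner_smul_right, real_inner_self_eq_norm_sq]
  ring

lemma norm_add_apexRadius_smul {p : E} (hp : ‖p‖ < 1) (w : E) :
    ‖w + apexRadius p w • p‖ = apexRadius p w := by
  have hc := one_sub_norm_sq_pos hp
  have h0 : 0 ≤ ⟪p, w⟫ ^ 2 + (1 - ‖p‖ ^ 2) * ‖w‖ ^ 2 := by positivity
  have hr : 0 ≤ apexRadius p w := by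
    refine div_nonneg ?_ hc.le
    have : |⟪p, w⟫| ≤ apexRoot p w := by
      rw [apexRoot]
      refine Real.abs_le_sqrt ?_
      have : 0 ≤ (1 - ‖p‖ ^ 2) * ‖w‖ ^ 2 := by positivity
      linarith
    linarith [neg_abs_le ⟪p, w⟫]
  have hq : (1 - ‖p‖ ^ 2) * apexRadius p w - ⟪p, w⟫ = apexRoot p w := by
    rw [apexRadius]
    field_simp
    ring
  have hq2 : apexRoot p w ^ 2 = ⟪p, w⟫ ^ 2 + (1 - ‖p‖ ^ 2) * ‖w‖ ^ 2 := Real.sq_sqrt h0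
  rw [← hq] at hq2
  have h : ‖w + apexRadius p w • p‖ ^ 2 = apexRadius p w ^ 2 := by
    rw [norm_add_sq_real, inner_smul_right, norm_smul, mul_pow, Real.norm_eq_abs, sq_abs,
      real_inner_comm]
    apply mul_left_cancel₀ hc.ne'
    linear_combination -hq2
  exact (pow_left_inj₀ (norm_nonneg _) hr (by norm_num)).1 h

lemma apexShift_add_apexRadius_smul {p : E} (hp : ‖p‖ < 1) (w : E) :
    apexShift p (w + apexRadius p w • p) = w := by
  rw [apexShift, norm_add_apexRadius_smul hp, add_sub_cancel_right]

lemma apexShift_injective {p : E} (hp : ‖p‖ < 1) : Function.Injective (apexShift p) := by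
  intro x y h
  have hn : ‖x‖ = ‖y‖ := by rw [← apexRadius_apexShift hp x, h, apexRadius_apexShift hp]
  simpa [apexShift, hn] using h

lemma apexShift_smul (p x : E) {r : ℝ} (hr : 0 ≤ r) :
    apexShift p (r • x) = r • apexShift p x := by
  rw [apexShift, apexShift, norm_smul, Real.norm_of_nonneg hr, smul_sub, smul_smul]

lemma apexShift_image_compl_zero {p : E} (hp : ‖p‖ < 1) :
    apexShift p '' {0}ᶜ = {0}ᶜ := by
  have h0 : apexShift p (0 : E) = 0 := by simp [apexShift]
  have hsurj : Function.Surjective (apexShift p) :=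
    fun w => ⟨_, apexShift_add_apexRadius_smul hp w⟩
  rw [Set.image_compl_eq ⟨apexShift_injective hp, hsurj⟩, Set.image_singleton, h0]

lemma hasFDerivAt_apexShift (p : E) {x : E} (hx : x ≠ 0) :
    HasFDerivAt (apexShift p)
      (ContinuousLinearMap.id ℝ E - (‖x‖⁻¹ • innerSL ℝ x).smulRight p) x := by
  have hnorm : HasFDerivAt (fun y : E => ‖y‖) (‖x‖⁻¹ • innerSL ℝ x) x := by
    have h := (hasStrictFDerivAt_norm_sq x).hasFDerivAt.sqrt (by positivity)
    have e : (fun y : E => √(‖y‖ ^ 2)) = fun y => ‖y‖ := by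
      ext y
      exact Real.sqrt_sq (norm_nonneg y)
    rw [e, Real.sqrt_sq (norm_nonneg x)] at h
    convert h using 1
    ext y
    simp
    field_simp
  exact (hasFDerivAt_id x).sub (hnorm.smul_const p)

variable [FiniteDimensional ℝ E]

lemma det_fderiv_apexShift (p x : E) :
    (ContinuousLinearMap.id ℝ E - (‖x‖⁻¹ • innerSL ℝ x).smulRight p).det
      = 1 - ⟪p, x⟫ / ‖x‖ := by
  have h : ((ContinuousLinearMap.id ℝ E - (‖x‖⁻¹ • innerSL ℝ x).smulRight p : E →L[ℝ] E) :
      E →ₗ[ℝ] E) = LinearMap.transvection ((‖x‖⁻¹ • innerSL ℝ x : E →L[ℝ] ℝ) : E →ₗ[ℝ] ℝ) (-p) := by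
    ext y
    simp [LinearMap.transvection.apply, sub_eq_add_neg]
  rw [ContinuousLinearMap.det, h, LinearMap.transvection.det]
  simp [real_inner_comm, div_eq_inv_mul]
  ring

lemma abs_det_fderiv_apexShift_smul {p x : E} (hp : ‖p‖ < 1) (hx : x ≠ 0) (H : E → ℝ → ℂ) :
    |(ContinuousLinearMap.id ℝ E - (‖x‖⁻¹ • innerSL ℝ x).smulRight p).det| •
      (H (apexShift p x) (apexRadius p (apexShift p x)) *
        ((apexRadius p (apexShift p x) / apexRoot p (apexShift p x) : ℝ) : ℂ)) =
      H (apexShift p x) ‖x‖ := by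
  have hx : 0 < ‖x‖ := norm_pos_iff.2 hx
  have hlt : ⟪p, x⟫ < ‖x‖ := (real_inner_le_norm p x).trans_lt (by nlinarith)
  have hJ : 0 < 1 - ⟪p, x⟫ / ‖x‖ := by rw [sub_pos, div_lt_one hx]; exact hlt
  rw [det_fderiv_apexShift, apexRadius_apexShift hp, apexRoot_apexShift hp,
    abs_of_pos hJ, Complex.real_smul, mul_left_comm, ← Complex.ofReal_mul]
  have : (1 - ⟪p, x⟫ / ‖x‖) * (‖x‖ / (‖x‖ - ⟪p, x⟫)) = 1 := by
    have : ‖x‖ - ⟪p, x⟫ ≠ 0 := (sub_pos.2 hlt).ne'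
    field_simp
  rw [this]
  simp

variable [MeasurableSpace E] [BorelSpace E] [Nontrivial E]

lemma integral_comp_apexShift {p : E} (hp : ‖p‖ < 1) (H : E → ℝ → ℂ) :
    ∫ x, H (apexShift p x) ‖x‖ =
      ∫ w, H w (apexRadius p w) * ((apexRadius p w / apexRoot p w : ℝ) : ℂ) := by
  have hs := (measurableSet_singleton (0 : E)).compl
  have key := integral_image_eq_integral_abs_det_fderiv_smul volume hs
    (fun x hx => (hasFDerivAt_apexShift p hx).hasFDerivWithinAt) (apexShift_injective hp).injOn
    (fun w => H w (apexRadius p w) * ((apexRadius p w / apexRoot p w : ℝ) : ℂ))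
  rw [apexShift_image_compl_zero hp,
    setIntegral_congr_fun hs fun x hx => abs_det_fderiv_apexShift_smul hp hx H] at key
  simpa only [restrict_compl_singleton] using key.symm

lemma integrable_comp_apexShift_iff {p : E} (hp : ‖p‖ < 1) (H : E → ℝ → ℂ) :
    Integrable (fun w => H w (apexRadius p w) * ((apexRadius p w / apexRoot p w : ℝ) : ℂ)) ↔
      Integrable fun x => H (apexShift p x) ‖x‖ := by
  have hs := (measurableSet_singleton (0 : E)).compl
  have key := integrableOn_image_iff_integrableOn_abs_det_fderiv_smul volume hs
    (fun x hx => (hasFDerivAt_apexShift p hx).hasFDerivWithinAt) (apexShift_injective hp).injOn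
    (fun w => H w (apexRadius p w) * ((apexRadius p w / apexRoot p w : ℝ) : ℂ))
  rw [apexShift_image_compl_zero hp,
    integrableOn_congr_fun (s := {0}ᶜ)
      (fun x hx => abs_det_fderiv_apexShift_smul hp hx H) hs] at key
  simpa only [IntegrableOn, restrict_compl_singleton] using key

end ApexShift

section Polar

open Module

variable {E : Type*} [NormedAddCommGroup E] [NormedSpace ℝ E] [FiniteDimensional ℝ E]
  [Nontrivial E] [MeasurableSpace E] [BorelSpace E]

lemma integral_eq_integral_toSphere (μ : Measure E) [μ.IsAddHaarMeasure] {F : E → ℂ}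
    (hF : Integrable F μ) :
    ∫ x, F x ∂μ = ∫ x : sphere (0 : E) 1, (∫ r in Set.Ioi (0 : ℝ),
      r ^ (finrank ℝ E - 1) • F (r • (x : E))) ∂μ.toSphere := by
  have hmp := μ.measurePreserving_homeomorphUnitSphereProd
  have hemb := (homeomorphUnitSphereProd E).measurableEmbedding
  set G : sphere (0 : E) 1 × Set.Ioi (0 : ℝ) → ℂ := fun q => F ((q.2 : ℝ) • (q.1 : E)) with hG
  have hcomp : ∀ x : ({0}ᶜ : Set E), G (homeomorphUnitSphereProd E x) = F x := by
    intro x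
    simp only [hG]
    rw [← homeomorphUnitSphereProd_symm_apply_coe, Homeomorph.symm_apply_apply]
  have hint : Integrable G (μ.toSphere.prod (Measure.volumeIoiPow (finrank ℝ E - 1))) := by
    rw [← hmp.integrable_comp_emb hemb]
    simp only [Function.comp_def, hcomp]
    exact (integrableOn_iff_comap_subtypeVal (measurableSet_singleton _).compl).1
      hF.integrableOn
  calc ∫ x, F x ∂μ = ∫ x : ({0}ᶜ : Set E), F x ∂(μ.comap (↑)) := by
        rw [integral_subtype_comap (measurableSet_singleton _).compl F,
          restrict_compl_singleton]
    _ = ∫ q, G q ∂μ.toSphere.prod (Measure.volumeIoiPow (finrank ℝ E - 1)) := by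
        rw [← hmp.integral_comp hemb]
        simp only [hcomp]
    _ = ∫ x, ∫ r, G (x, r) ∂Measure.volumeIoiPow (finrank ℝ E - 1) ∂μ.toSphere :=
        integral_prod _ hint
    _ = _ := by
        congr 1 with x
        simp only [Measure.volumeIoiPow, ENNReal.ofReal]
        rw [integral_withDensity_eq_integral_smul (by fun_prop),
          integral_subtype_comap measurableSet_Ioi
            fun r : ℝ => Real.toNNReal (r ^ (finrank ℝ E - 1)) • F (r • (x : E))]
        refine setIntegral_congr_fun measurableSet_Ioi fun r hr => ?_
        rw [NNReal.smul_def, Real.coe_toNNReal _ (pow_nonneg (Set.mem_Ioi.1 hr).le _)]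

open Classical in
/-- Integrating a function that is homogeneous of degree `-dim E` over a dyadic shell
amounts to integrating it over the unit sphere. -/
lemma integral_shell_eq_log_two_mul (μ : Measure E) [μ.IsAddHaarMeasure] {F : E → ℂ}
    (hF : Integrable F μ) {A : Set (sphere (0 : E) 1)} (hA : MeasurableSet A)
    (f : sphere (0 : E) 1 → ℂ) (z : sphere (0 : E) 1 → ℝ) (hz : ∀ x ∈ A, 0 < z x)
    (h : ∀ (x : sphere (0 : E) 1) (r : ℝ), 0 < r → F (r • (x : E)) =
      if x ∈ A ∧ 1 ≤ r * z x ∧ r * z x ≤ 2 then ((r : ℂ) ^ finrank ℝ E)⁻¹ * f x else 0) :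
    ∫ x, F x ∂μ = Real.log 2 * ∫ x in A, f x ∂μ.toSphere := by
  rw [integral_eq_integral_toSphere μ hF, ← integral_const_mul, ← integral_indicator hA]
  congr 1 with x
  by_cases hx : x ∈ A
  · have hzx := hz x hx
    rw [Set.indicator_of_mem hx]
    have hle : 1 / z x ≤ 2 / z x := by gcongr; norm_num
    have e : ∀ r ∈ Set.Ioi (0 : ℝ), r ^ (finrank ℝ E - 1) • F (r • (x : E)) =
        (Set.Icc (1 / z x) (2 / z x)).indicator (fun r : ℝ => ((r⁻¹ : ℝ) : ℂ) * f x) r := by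
      intro r hr
      have hr : 0 < r := hr
      rw [h x r hr]
      by_cases hmem : r ∈ Set.Icc (1 / z x) (2 / z x)
      · rw [Set.indicator_of_mem hmem, if_pos ⟨hx, (div_le_iff₀ hzx).1 hmem.1,
          (le_div_iff₀ hzx).1 hmem.2⟩, Complex.real_smul]
        have hd : finrank ℝ E = finrank ℝ E - 1 + 1 :=
          (Nat.sub_add_cancel (finrank_pos (R := ℝ) (M := E))).symm
        have hr' : (r : ℂ) ≠ 0 := by exact_mod_cast hr.ne'
        conv_lhs => rw [hd, Nat.add_sub_cancel]
        push_cast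
        field_simp
        ring
      · rw [Set.indicator_of_notMem hmem, if_neg, smul_zero]
        rintro ⟨-, h1, h2⟩
        exact hmem ⟨(div_le_iff₀ hzx).2 h1, (le_div_iff₀ hzx).2 h2⟩
    rw [setIntegral_congr_fun measurableSet_Ioi e, setIntegral_indicator measurableSet_Icc]
    have hsub : Set.Ioi (0 : ℝ) ∩ Set.Icc (1 / z x) (2 / z x) = Set.Icc (1 / z x) (2 / z x) := by
      refine Set.inter_eq_right.2 fun r hr => ?_
      exact (div_pos one_pos hzx).trans_le hr.1
    rw [hsub, integral_mul_const, integral_complex_ofReal, integral_Icc_eq_integral_Ioc,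
      ← intervalIntegral.integral_of_le hle, integral_inv_of_pos (by positivity) (by positivity)]
    congr 3
    field_simp
  · rw [Set.indicator_of_notMem hx, setIntegral_congr_fun (g := fun _ => 0) measurableSet_Ioi]
    · simp
    · intro r hr
      simp only
      rw [h x r hr, if_neg (fun h => hx h.1), smul_zero]

end Polar

section Null

open scoped RealInnerProductSpace

instance (n : ℕ) : IsFiniteMeasure (sphereMeasure n) := by
  unfold sphereMeasure
  infer_instance

lemma sphereMeasure_inner_eq_zero_of_finite {n : ℕ} {v u : EuclideanSpace ℝ (Fin (n + 1))} {t : ℝ}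
    (h : ∀ y : EuclideanSpace ℝ (Fin (n + 1)), {s : ℝ | ⟪v, y + s • u⟫ = t * ‖y + s • u‖}.Finite) :
    sphereMeasure n {x | ⟪v, (x : EuclideanSpace ℝ (Fin (n + 1)))⟫ = t} = 0 := by
  have hmeas : MeasurableSet {y : EuclideanSpace ℝ (Fin (n + 1)) | ⟪v, y⟫ = t * ‖y‖}ᶜ :=
    (isClosed_eq (by fun_prop) (by fun_prop)).measurableSet.compl
  have hcone : volume {y : EuclideanSpace ℝ (Fin (n + 1)) | ⟪v, y⟫ = t * ‖y‖} = 0 := by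
    have := ae_mem_of_ae_add_linearMap_mem (LinearMap.toSpanSingleton ℝ _ u) volume volume hmeas
      (fun y => by
        have : {s : ℝ | ¬ y + LinearMap.toSpanSingleton ℝ _ u s ∈
            {y : EuclideanSpace ℝ (Fin (n + 1)) | ⟪v, y⟫ = t * ‖y‖}ᶜ}.Finite := by
          simpa [LinearMap.toSpanSingleton_apply] using h y
        exact this.measure_zero volume)
    rw [ae_iff] at this
    simpa using this
  rw [sphereMeasure, Measure.toSphere_apply' _
    (isClosed_eq (by fun_prop) (by fun_prop)).measurableSet]
  refine mul_eq_zero_of_right _ (measure_mono_null ?_ hcone)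
  rintro _ ⟨r, hr, _, ⟨x, hx, rfl⟩, rfl⟩
  have hx : ⟪v, (x : EuclideanSpace ℝ (Fin (n + 1)))⟫ = t := hx
  have hr' : (0 : ℝ) < r := hr.1
  have hx1 : ‖(x : EuclideanSpace ℝ (Fin (n + 1)))‖ = 1 := by simp
  simp only [Set.mem_ofPred_eq, inner_smul_right, norm_smul, hx, hx1]
  rw [Real.norm_of_nonneg hr'.le]
  ring

lemma sphereMeasure_hyperplane_zero {n : ℕ} {v : EuclideanSpace ℝ (Fin (n + 1))} (hv : v ≠ 0) :
    sphereMeasure n {x | ⟪v, (x : EuclideanSpace ℝ (Fin (n + 1)))⟫ = 0} = 0 := by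
  refine sphereMeasure_inner_eq_zero_of_finite (u := v) fun y => ?_
  refine (Set.finite_singleton (-⟪v, y⟫ / ⟪v, v⟫)).subset fun s hs => ?_
  have hv' : ⟪v, v⟫ ≠ 0 := by simpa using hv
  simp only [Set.mem_ofPred_eq, inner_add_right, inner_smul_right, zero_mul] at hs
  rw [Set.mem_singleton_iff, eq_div_iff hv']
  linarith

lemma sphereMeasure_hyperplane {n : ℕ} {v : EuclideanSpace ℝ (Fin (n + 1))} (hv : v ≠ 0)
    (hv0 : v 0 = 0) (t : ℝ) :
    sphereMeasure n {x | ⟪v, (x : EuclideanSpace ℝ (Fin (n + 1)))⟫ = t} = 0 := by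
  rcases eq_or_ne t 0 with rfl | ht
  · exact sphereMeasure_hyperplane_zero hv
  refine sphereMeasure_inner_eq_zero_of_finite (u := EuclideanSpace.single 0 1) fun y => ?_
  set D := (⟪v, y⟫ / t) ^ 2 - ‖y‖ ^ 2 + y 0 ^ 2 with hD
  refine (Set.toFinite {√D - y 0, -√D - y 0}).subset fun s hs => ?_
  have h1 : ⟪v, EuclideanSpace.single 0 (1 : ℝ)⟫ = 0 := by
    rw [EuclideanSpace.inner_single_right, hv0]
    simp
  have h2 : ⟪y, EuclideanSpace.single 0 (1 : ℝ)⟫ = y 0 := by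
    rw [EuclideanSpace.inner_single_right]
    simp
  simp only [Set.mem_ofPred_eq, inner_add_right, inner_smul_right, h1, mul_zero, add_zero] at hs
  have h3 : ‖y + s • EuclideanSpace.single 0 (1 : ℝ)‖ ^ 2 = ‖y‖ ^ 2 + 2 * (s * y 0) + s ^ 2 := by
    rw [norm_add_sq_real, inner_smul_right, h2, norm_smul]
    simp
  have h4 : (s + y 0) ^ 2 = D := by
    rw [hD, hs, mul_div_cancel_left₀ _ ht, h3]
    ring
  have h5 : |s + y 0| = √D := by rw [← h4, Real.sqrt_sq_eq_abs]
  rcases abs_choice (s + y 0) with h | h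
  · left
    linarith
  · right
    simp only [Set.mem_singleton_iff]
    linarith

end Null

section Fubini

open scoped RealInnerProductSpace

/-- The first standard basis vector of `ℝ^{n+1}`. -/
noncomputable abbrev verticalUnit (n : ℕ) : EuclideanSpace ℝ (Fin (n + 1)) :=
  EuclideanSpace.single 0 1

/-- The embedding of `ℝⁿ` as the hyperplane `x₀ = 0` of `ℝ^{n+1}`. -/
def horizontalEmbed {n : ℕ} (z : Fin n → ℝ) : EuclideanSpace ℝ (Fin (n + 1)) :=
  WithLp.toLp 2 (Fin.cons 0 z)

/-- The orthogonal projection of `ℝ^{n+1}` onto the hyperplane `x₀ = 0`. -/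
noncomputable def horizontalPart {n : ℕ} (w : EuclideanSpace ℝ (Fin (n + 1))) :
    EuclideanSpace ℝ (Fin (n + 1)) := w - w 0 • verticalUnit n

lemma integral_eq_integral_vertical {n : ℕ} {g : EuclideanSpace ℝ (Fin (n + 1)) → ℂ}
    (hg : Integrable g) :
    ∫ w, g w = ∫ z : Fin n → ℝ, ∫ s : ℝ, g (horizontalEmbed z + s • verticalUnit n) := by
  set e : ℝ × (Fin n → ℝ) → EuclideanSpace ℝ (Fin (n + 1)) :=
    fun q => WithLp.toLp 2 ((MeasurableEquiv.piFinSuccAbove (fun _ => ℝ) 0).symm q) with he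
  have hmp : MeasurePreserving e :=
    (PiLp.volume_preserving_toLp (Fin (n + 1))).comp
      (volume_preserving_piFinSuccAbove (fun _ => ℝ) 0).symm
  have hemb : MeasurableEmbedding e :=
    (MeasurableEquiv.toLp 2 (Fin (n + 1) → ℝ)).measurableEmbedding.comp
      (MeasurableEquiv.measurableEmbedding _)
  have hval : ∀ s z, e (s, z) = horizontalEmbed z + s • verticalUnit n := by
    intro s z
    ext i
    refine Fin.cases ?_ (fun j => ?_) i <;> simp [he, horizontalEmbed]
  rw [← hmp.integral_comp hemb g, Measure.volume_eq_prod, integral_prod_symm]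
  · simp only [hval]
  · rw [← Measure.volume_eq_prod]
    exact (hmp.integrable_comp_emb hemb).2 hg

end Fubini

section Horizontal

open scoped RealInnerProductSpace

variable {n : ℕ}

lemma inner_verticalUnit (v : EuclideanSpace ℝ (Fin (n + 1))) : ⟪v, verticalUnit n⟫ = v 0 := by
  rw [EuclideanSpace.inner_single_right]
  simp

lemma norm_verticalUnit : ‖verticalUnit n‖ = 1 := by simp

lemma horizontalPart_smul (r : ℝ) (w : EuclideanSpace ℝ (Fin (n + 1))) :
    horizontalPart (r • w) = r • horizontalPart w := by
  simp [horizontalPart, smul_sub, smul_smul]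

lemma horizontalPart_apply_zero (w : EuclideanSpace ℝ (Fin (n + 1))) : horizontalPart w 0 = 0 := by
  simp [horizontalPart]

lemma inner_horizontalPart {v : EuclideanSpace ℝ (Fin (n + 1))} (hv : v 0 = 0)
    (w : EuclideanSpace ℝ (Fin (n + 1))) : ⟪v, horizontalPart w⟫ = ⟪v, w⟫ := by
  rw [horizontalPart, inner_sub_right, inner_smul_right, inner_verticalUnit, hv]
  simp

lemma norm_horizontalPart_sq (w : EuclideanSpace ℝ (Fin (n + 1))) :
    ‖horizontalPart w‖ ^ 2 = ‖w‖ ^ 2 - w 0 ^ 2 := by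
  rw [horizontalPart, norm_sub_sq_real, inner_smul_right, inner_verticalUnit, norm_smul,
    norm_verticalUnit, Real.norm_eq_abs, mul_one, sq_abs]
  ring

lemma norm_horizontalPart_le (w : EuclideanSpace ℝ (Fin (n + 1))) : ‖horizontalPart w‖ ≤ ‖w‖ := by
  refine le_of_sq_le_sq ?_ (norm_nonneg w)
  rw [norm_horizontalPart_sq]
  linarith [sq_nonneg (w 0)]

lemma norm_le_norm_horizontalPart_add (w : EuclideanSpace ℝ (Fin (n + 1))) :
    ‖w‖ ≤ ‖horizontalPart w‖ + |w 0| := by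
  have h : w = horizontalPart w + w 0 • verticalUnit n := by simp [horizontalPart]
  conv_lhs => rw [h]
  refine (norm_add_le _ _).trans ?_
  rw [norm_smul, norm_verticalUnit, mul_one, Real.norm_eq_abs]

lemma continuous_horizontalPart : Continuous (horizontalPart (n := n)) := by
  unfold horizontalPart
  fun_prop

lemma horizontalEmbed_apply_zero (z : Fin n → ℝ) : horizontalEmbed z 0 = 0 := by
  simp [horizontalEmbed]

lemma horizontalPart_horizontalEmbed_add (z : Fin n → ℝ) (s : ℝ) :
    horizontalPart (horizontalEmbed z + s • verticalUnit n) = horizontalEmbed z := by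
  simp [horizontalPart, horizontalEmbed_apply_zero]

lemma norm_horizontalEmbed_add_sq (z : Fin n → ℝ) (s : ℝ) :
    ‖horizontalEmbed z + s • verticalUnit n‖ ^ 2 = s ^ 2 + ‖horizontalEmbed z‖ ^ 2 := by
  have := norm_horizontalPart_sq (horizontalEmbed z + s • verticalUnit n)
  rw [horizontalPart_horizontalEmbed_add] at this
  simp [horizontalEmbed_apply_zero] at this ⊢
  linarith

lemma norm_le_norm_horizontalEmbed (z : Fin n → ℝ) : ‖z‖ ≤ ‖horizontalEmbed z‖ := by
  refine (pi_norm_le_iff_of_nonneg (norm_nonneg _)).2 fun i => ?_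
  simpa [horizontalEmbed] using PiLp.norm_apply_le (horizontalEmbed z) i.succ

end Horizontal

section PoleKernel

/-- The kernel `(s - εi)^{-m}`. -/
noncomputable def poleKernel (m : ℕ) (ε s : ℝ) : ℂ := (((s : ℂ) - ε * Complex.I) ^ m)⁻¹

lemma abs_le_norm_sub_mul_I (ε s : ℝ) : |ε| ≤ ‖(s : ℂ) - ε * Complex.I‖ := by
  simpa using Complex.abs_im_le_norm ((s : ℂ) - ε * Complex.I)

lemma norm_poleKernel_le_of_pos (m : ℕ) {ε δ : ℝ} (hδ : 0 < δ) (hε : δ ≤ |ε|) (s : ℝ) :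
    ‖poleKernel m ε s‖ ≤ (δ ^ m)⁻¹ := by
  rw [poleKernel, norm_inv, norm_pow]
  gcongr
  exact hε.trans (abs_le_norm_sub_mul_I ε s)

lemma norm_poleKernel_le_of_le_abs (m : ℕ) (ε : ℝ) {s δ : ℝ} (hδ : 0 < δ) (hs : δ ≤ |s|) :
    ‖poleKernel m ε s‖ ≤ (δ ^ m)⁻¹ := by
  rw [poleKernel, norm_inv, norm_pow]
  gcongr
  refine hs.trans ?_
  simpa using Complex.abs_re_le_norm ((s : ℂ) - ε * Complex.I)

lemma poleKernel_mul_mul (m : ℕ) (ε s r : ℝ) :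
    poleKernel m (ε * r) (r * s) = ((r : ℂ) ^ m)⁻¹ * poleKernel m ε s := by
  rw [poleKernel, poleKernel, ← mul_inv, ← mul_pow]
  push_cast
  ring_nf

lemma measurable_poleKernel (m : ℕ) {α : Type*} [MeasurableSpace α] {f g : α → ℝ}
    (hf : Measurable f) (hg : Measurable g) : Measurable fun a => poleKernel m (f a) (g a) := by
  unfold poleKernel
  fun_prop

lemma integrable_poleKernel {n : ℕ} (m : ℕ) {ε : ℝ} (hε : 0 < ε) :
    Integrable (fun x : sphere (0 : EuclideanSpace ℝ (Fin (n + 1))) 1 =>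
      poleKernel m ε ((x : EuclideanSpace ℝ (Fin (n + 1))) 0)) (sphereMeasure n) :=
  Integrable.of_bound (measurable_poleKernel m measurable_const (by fun_prop)).aestronglyMeasurable
    ((ε ^ m)⁻¹) (ae_of_all _ fun _ => norm_poleKernel_le_of_pos m hε (le_abs_self ε) _)

end PoleKernel

section ApexBound

open scoped RealInnerProductSpace

variable {n : ℕ}

open Classical in
/-- The homogeneous extension of the pole kernel, in the coordinates given by `apexShift`,
truncated to a shell of the cone `K`. -/
noncomputable def shellKernel (K : Set (EuclideanSpace ℝ (Fin (n + 1)))) (ε : ℝ)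
    (w : EuclideanSpace ℝ (Fin (n + 1))) (r : ℝ) : ℂ :=
  if w ∈ K ∧ |w 0| ≤ ‖horizontalPart w‖ ∧ 1 ≤ ‖horizontalPart w‖ ∧ ‖horizontalPart w‖ ≤ 2 then
    poleKernel (n + 1) (ε * r) (w 0) else 0

lemma norm_apexShift_le {p : EuclideanSpace ℝ (Fin (n + 1))} (hp : ‖p‖ < 1)
    (x : EuclideanSpace ℝ (Fin (n + 1))) : ‖apexShift p x‖ ≤ 2 * ‖x‖ := by
  refine (norm_sub_le _ _).trans ?_
  rw [norm_smul, norm_norm]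
  nlinarith [norm_nonneg x]

lemma le_norm_apexShift (p x : EuclideanSpace ℝ (Fin (n + 1))) :
    (1 - ‖p‖) * ‖x‖ ≤ ‖apexShift p x‖ := by
  refine le_trans ?_ (norm_sub_norm_le _ _)
  rw [norm_smul, norm_norm]
  linarith

lemma continuous_apexShift (p : EuclideanSpace ℝ (Fin (n + 1))) : Continuous (apexShift p) := by
  unfold apexShift
  fun_prop

lemma integrable_shellKernel_apexShift {K : Set (EuclideanSpace ℝ (Fin (n + 1)))}
    (hK : MeasurableSet K) {p : EuclideanSpace ℝ (Fin (n + 1))} (hp : ‖p‖ < 1) {ε : ℝ}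
    (hε : 0 < ε) : Integrable fun x => shellKernel K ε (apexShift p x) ‖x‖ := by
  have hp' : 0 < 1 - ‖p‖ := sub_pos.2 hp
  have hψ := continuous_apexShift p
  have hh := continuous_horizontalPart.comp hψ
  have h0 : Continuous fun x => apexShift p x 0 := by fun_prop
  have hmeas : Measurable fun x => shellKernel K ε (apexShift p x) ‖x‖ := by
    unfold shellKernel
    refine Measurable.ite ?_ (measurable_poleKernel _ (by fun_prop) h0.measurable)
      measurable_const
    refine (hψ.measurable hK).inter ?_
    exact ((isClosed_le h0.abs hh.norm).inter
      ((isClosed_le continuous_const hh.norm).inter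
        (isClosed_le hh.norm continuous_const))).measurableSet
  have hsupp : ∀ x ∉ closedBall (0 : EuclideanSpace ℝ (Fin (n + 1))) (4 / (1 - ‖p‖)),
      shellKernel K ε (apexShift p x) ‖x‖ = 0 := by
    intro x hx
    rw [shellKernel, if_neg]
    rintro ⟨-, h1, -, h2⟩
    refine hx (mem_closedBall_zero_iff.2 ((le_div_iff₀ hp').2 ?_))
    linarith [le_norm_apexShift p x, norm_le_norm_horizontalPart_add (apexShift p x)]
  rw [← integrableOn_iff_integrable_of_support_subset
    (s := closedBall 0 (4 / (1 - ‖p‖))) (Function.support_subset_iff'.2 hsupp)]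
  refine Measure.integrableOn_of_bounded (M := ((ε * (1 / 2)) ^ (n + 1))⁻¹)
    measure_closedBall_lt_top.ne hmeas.aestronglyMeasurable (ae_of_all _ fun x => ?_)
  rw [shellKernel]
  split_ifs with h
  · refine norm_poleKernel_le_of_pos _ (by positivity) ?_ _
    have : 1 / 2 ≤ ‖x‖ := by
      linarith [norm_apexShift_le hp x, norm_horizontalPart_le (apexShift p x), h.2.2.1]
    rw [abs_of_nonneg (by positivity)]
    gcongr
  · rw [norm_zero]
    positivity

lemma norm_integral_shellKernel_fibre_le {K : Set (EuclideanSpace ℝ (Fin (n + 1)))}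
    (hKv : ∀ w (s : ℝ), w + s • verticalUnit n ∈ K ↔ w ∈ K)
    {p : EuclideanSpace ℝ (Fin (n + 1))} (hp : ‖p‖ < 1) (hp0 : p 0 = 0) {ε : ℝ}
    (hε : 0 < ε) (hεp : ε ≤ (1 - ‖p‖ ^ 2) / 16) (z : Fin n → ℝ) :
    ‖∫ s : ℝ, shellKernel K ε (horizontalEmbed z + s • verticalUnit n)
        (apexRadius p (horizontalEmbed z + s • verticalUnit n)) *
      ((apexRadius p (horizontalEmbed z + s • verticalUnit n) /
        apexRoot p (horizontalEmbed z + s • verticalUnit n) : ℝ) : ℂ)‖ ≤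
      (closedBall 0 2).indicator (fun _ => 5 * (2 ^ (n + 1) * (2 / (1 - ‖p‖ ^ 2)))) z := by
  have hc := one_sub_norm_sq_pos hp
  set ρ := ‖horizontalEmbed z‖
  have hw0 : ∀ s : ℝ, (horizontalEmbed z + s • verticalUnit n) 0 = s := by
    simp [horizontalEmbed_apply_zero]
  have hnn : 0 ≤ (closedBall (0 : Fin n → ℝ) 2).indicator
      (fun _ => 5 * (2 ^ (n + 1) * (2 / (1 - ‖p‖ ^ 2)))) z :=
    Set.indicator_nonneg (fun _ _ => by positivity) z
  by_cases hz : horizontalEmbed z ∈ K ∧ 1 ≤ ρ ∧ ρ ≤ 2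
  · obtain ⟨hzK, h1, h2⟩ := hz
    rw [Set.indicator_of_mem
      (mem_closedBall_zero_iff.2 ((norm_le_norm_horizontalEmbed z).trans h2))]
    have hroot : ∀ s : ℝ, apexRoot p (horizontalEmbed z + s • verticalUnit n) =
        √(⟪p, horizontalEmbed z⟫ ^ 2 + (1 - ‖p‖ ^ 2) * (s ^ 2 + ρ ^ 2)) := by
      intro s
      rw [apexRoot, norm_horizontalEmbed_add_sq, inner_add_right, inner_smul_right,
        inner_verticalUnit, hp0, mul_zero, add_zero]
    have hrad : ∀ s : ℝ, apexRadius p (horizontalEmbed z + s • verticalUnit n) =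
        (⟪p, horizontalEmbed z⟫ + √(⟪p, horizontalEmbed z⟫ ^ 2 +
          (1 - ‖p‖ ^ 2) * (s ^ 2 + ρ ^ 2))) / (1 - ‖p‖ ^ 2) := by
      intro s
      rw [apexRadius, hroot, inner_add_right, inner_smul_right,
        inner_verticalUnit, hp0, mul_zero, add_zero]
    have hb : |⟪p, horizontalEmbed z⟫| ≤ 2 :=
      (abs_real_inner_le_norm _ _).trans (by nlinarith [norm_nonneg p])
    have key := norm_integral_fibre_le (m := n + 1) hε hc
      (by nlinarith [norm_nonneg p]) hεp hb h1 h2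
    rw [intervalIntegral.integral_of_le (by linarith), ← integral_Icc_eq_integral_Ioc,
      ← integral_indicator measurableSet_Icc] at key
    refine (congrArg norm (integral_congr_ae (ae_of_all _ fun s => ?_))).trans_le key
    rw [shellKernel, horizontalPart_horizontalEmbed_add, hw0, hKv, hrad, hroot, Set.indicator_apply]
    by_cases hs : s ∈ Set.Icc (-ρ) ρ
    · rw [if_pos ⟨hzK, abs_le.2 hs, h1, h2⟩, if_pos hs, poleKernel]
      push_cast
      ring_nf
    · rw [if_neg fun h => hs (abs_le.1 h.2.1), if_neg hs, zero_mul]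
  · convert hnn
    rw [norm_eq_zero]
    refine integral_eq_zero_of_ae (ae_of_all _ fun s => ?_)
    simp only
    rw [shellKernel, horizontalPart_horizontalEmbed_add, hKv, if_neg fun h => hz ⟨h.1, h.2.2⟩,
      zero_mul, Pi.zero_apply]

lemma norm_integral_shellKernel_le {K : Set (EuclideanSpace ℝ (Fin (n + 1)))}
    (hK : MeasurableSet K) (hKv : ∀ w (s : ℝ), w + s • verticalUnit n ∈ K ↔ w ∈ K)
    {p : EuclideanSpace ℝ (Fin (n + 1))} (hp : ‖p‖ < 1) (hp0 : p 0 = 0) {ε : ℝ}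
    (hε : 0 < ε) (hεp : ε ≤ (1 - ‖p‖ ^ 2) / 16) :
    ‖∫ x, shellKernel K ε (apexShift p x) ‖x‖‖ ≤
      volume.real (closedBall (0 : Fin n → ℝ) 2) *
        (5 * (2 ^ (n + 1) * (2 / (1 - ‖p‖ ^ 2)))) := by
  rw [integral_comp_apexShift hp, integral_eq_integral_vertical
    ((integrable_comp_apexShift_iff hp _).2 (integrable_shellKernel_apexShift hK hp hε))]
  refine (norm_integral_le_of_norm_le ?_
    (ae_of_all _ (norm_integral_shellKernel_fibre_le hKv hp hp0 hε hεp))).trans_eq ?_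
  · exact (integrable_indicator_iff measurableSet_closedBall).2
      (integrableOn_const measure_closedBall_lt_top.ne)
  · rw [integral_indicator measurableSet_closedBall, setIntegral_const, smul_eq_mul]

lemma one_sub_norm_le_of_mem_sphere {p : EuclideanSpace ℝ (Fin (n + 1))} (hp0 : p 0 = 0)
    (x : sphere (0 : EuclideanSpace ℝ (Fin (n + 1))) 1) :
    1 - ‖p‖ ≤ ‖horizontalPart ((x : EuclideanSpace ℝ (Fin (n + 1))) - p)‖ +
      |(x : EuclideanSpace ℝ (Fin (n + 1))) 0| := by
  have h1 := norm_le_norm_horizontalPart_add ((x : EuclideanSpace ℝ (Fin (n + 1))) - p)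
  have h2 := norm_sub_norm_le (x : EuclideanSpace ℝ (Fin (n + 1))) p
  rw [PiLp.sub_apply, hp0, sub_zero] at h1
  rw [norm_eq_of_mem_sphere] at h2
  exact h2.trans h1

lemma integral_shellKernel_eq {K : Set (EuclideanSpace ℝ (Fin (n + 1)))}
    (hK : MeasurableSet K) (hKs : ∀ r : ℝ, 0 < r → ∀ w, r • w ∈ K ↔ w ∈ K)
    {p : EuclideanSpace ℝ (Fin (n + 1))} (hp : ‖p‖ < 1) (hp0 : p 0 = 0) {ε : ℝ}
    (hε : 0 < ε) :
    ∫ x, shellKernel K ε (apexShift p x) ‖x‖ = Real.log 2 *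
      ∫ x in {x : sphere (0 : EuclideanSpace ℝ (Fin (n + 1))) 1 |
          (x : EuclideanSpace ℝ (Fin (n + 1))) - p ∈ K ∧
            |(x : EuclideanSpace ℝ (Fin (n + 1))) 0| ≤
              ‖horizontalPart ((x : EuclideanSpace ℝ (Fin (n + 1))) - p)‖},
        poleKernel (n + 1) ε ((x : EuclideanSpace ℝ (Fin (n + 1))) 0) ∂(sphereMeasure n) := by
  have hsub : Continuous fun x : sphere (0 : EuclideanSpace ℝ (Fin (n + 1))) 1 =>
    (x : EuclideanSpace ℝ (Fin (n + 1))) - p := by fun_prop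
  have hh := (continuous_horizontalPart.comp hsub).norm
  have hx0 : Continuous fun x : sphere (0 : EuclideanSpace ℝ (Fin (n + 1))) 1 =>
    |(x : EuclideanSpace ℝ (Fin (n + 1))) 0| := by fun_prop
  have hA : MeasurableSet {x : sphere (0 : EuclideanSpace ℝ (Fin (n + 1))) 1 |
      (x : EuclideanSpace ℝ (Fin (n + 1))) - p ∈ K ∧ |(x : EuclideanSpace ℝ (Fin (n + 1))) 0| ≤
        ‖horizontalPart ((x : EuclideanSpace ℝ (Fin (n + 1))) - p)‖} :=
    (hsub.measurable hK).inter (isClosed_le hx0 hh).measurableSet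
  refine integral_shell_eq_log_two_mul volume (integrable_shellKernel_apexShift hK hp hε) hA _
    (fun x => ‖horizontalPart ((x : EuclideanSpace ℝ (Fin (n + 1))) - p)‖) ?_ ?_
  · rintro x ⟨-, hx⟩
    by_contra! hle
    linarith [one_sub_norm_le_of_mem_sphere hp0 x]
  · intro x r hr
    have h3 : ‖(x : EuclideanSpace ℝ (Fin (n + 1)))‖ = 1 := by simp
    have h5 : apexShift p (x : EuclideanSpace ℝ (Fin (n + 1))) = x - p := by
      rw [apexShift, h3, one_smul]
    rw [shellKernel, apexShift_smul p _ hr.le, h5, hKs r hr, horizontalPart_smul, norm_smul,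
      norm_smul, h3, mul_one, Real.norm_of_nonneg hr.le]
    have h4 : (r • ((x : EuclideanSpace ℝ (Fin (n + 1))) - p)) 0 =
        r * (x : EuclideanSpace ℝ (Fin (n + 1))) 0 := by
      simp [hp0]
    rw [h4, poleKernel_mul_mul, abs_mul, abs_of_pos hr, finrank_euclideanSpace_fin]
    congr 1
    rw [mul_le_mul_iff_right₀ hr, Set.mem_ofPred_eq, and_assoc]

end ApexBound

section BoundedPole

open scoped RealInnerProductSpace Topology

variable {n : ℕ}

/-- The integral over `A` of `(x₀ - εi)^{-(n+1)}` stays bounded as `ε → 0⁺`. -/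
def HasBoundedPole (A : Set (sphere (0 : EuclideanSpace ℝ (Fin (n + 1))) 1)) : Prop :=
  (fun ε : ℝ => ∫ x in A, poleKernel (n + 1) ε ((x : EuclideanSpace ℝ (Fin (n + 1))) 0)
    ∂(sphereMeasure n)) =O[𝓝[>] 0] fun _ => (1 : ℝ)

lemma hasBoundedPole_of_le_abs {A : Set (sphere (0 : EuclideanSpace ℝ (Fin (n + 1))) 1)} {δ : ℝ}
    (hδ : 0 < δ) (hA : ∀ x ∈ A, δ ≤ |(x : EuclideanSpace ℝ (Fin (n + 1))) 0|) :
    HasBoundedPole A := by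
  refine Asymptotics.IsBigO.of_bound ((δ ^ (n + 1))⁻¹ * (sphereMeasure n).real A)
    (Eventually.of_forall fun ε => ?_)
  rw [norm_one, mul_one]
  exact norm_setIntegral_le_of_norm_le_const (measure_lt_top _ _)
    fun x hx => norm_poleKernel_le_of_le_abs _ _ hδ (hA x hx)

lemma HasBoundedPole.union {A B : Set (sphere (0 : EuclideanSpace ℝ (Fin (n + 1))) 1)}
    (hA : HasBoundedPole A) (hB : HasBoundedPole B) (hBm : MeasurableSet B)
    (hAB : sphereMeasure n (A ∩ B) = 0) : HasBoundedPole (A ∪ B) := by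
  refine (hA.add hB).congr' ?_ EventuallyEq.rfl
  filter_upwards [self_mem_nhdsWithin] with ε hε
  exact (setIntegral_union₀ hAB hBm.nullMeasurableSet
    (integrable_poleKernel _ hε).integrableOn (integrable_poleKernel _ hε).integrableOn).symm

lemma hasBoundedPole_cone {K : Set (EuclideanSpace ℝ (Fin (n + 1)))}
    (hK : MeasurableSet K) (hKs : ∀ r : ℝ, 0 < r → ∀ w, r • w ∈ K ↔ w ∈ K)
    (hKv : ∀ w (s : ℝ), w + s • verticalUnit n ∈ K ↔ w ∈ K)
    {p : EuclideanSpace ℝ (Fin (n + 1))} (hp : ‖p‖ < 1) (hp0 : p 0 = 0) :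
    HasBoundedPole {x : sphere (0 : EuclideanSpace ℝ (Fin (n + 1))) 1 |
      (x : EuclideanSpace ℝ (Fin (n + 1))) - p ∈ K} := by
  have hsub : Continuous fun x : sphere (0 : EuclideanSpace ℝ (Fin (n + 1))) 1 =>
    (x : EuclideanSpace ℝ (Fin (n + 1))) - p := by fun_prop
  have hh := (continuous_horizontalPart.comp hsub).norm
  have hx0 : Continuous fun x : sphere (0 : EuclideanSpace ℝ (Fin (n + 1))) 1 =>
    |(x : EuclideanSpace ℝ (Fin (n + 1))) 0| := by fun_prop
  set A := {x : sphere (0 : EuclideanSpace ℝ (Fin (n + 1))) 1 |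
    (x : EuclideanSpace ℝ (Fin (n + 1))) - p ∈ K ∧
      |(x : EuclideanSpace ℝ (Fin (n + 1))) 0| ≤
        ‖horizontalPart ((x : EuclideanSpace ℝ (Fin (n + 1))) - p)‖}
  set B := {x : sphere (0 : EuclideanSpace ℝ (Fin (n + 1))) 1 |
    (x : EuclideanSpace ℝ (Fin (n + 1))) - p ∈ K ∧
      ‖horizontalPart ((x : EuclideanSpace ℝ (Fin (n + 1))) - p)‖ <
        |(x : EuclideanSpace ℝ (Fin (n + 1))) 0|}
  have hA : HasBoundedPole A := by
    refine Asymptotics.IsBigO.of_bound (volume.real (closedBall (0 : Fin n → ℝ) 2) *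
        (5 * (2 ^ (n + 1) * (2 / (1 - ‖p‖ ^ 2)))) / Real.log 2) ?_
    have hc := one_sub_norm_sq_pos hp
    filter_upwards [Ioc_mem_nhdsGT (show 0 < (1 - ‖p‖ ^ 2) / 16 by positivity)] with ε hε
    have hlog := Real.log_pos one_lt_two
    have key := norm_integral_shellKernel_le hK hKv hp hp0 hε.1 hε.2
    rw [integral_shellKernel_eq hK hKs hp hp0 hε.1, norm_mul, Complex.norm_real,
      Real.norm_of_nonneg hlog.le] at key
    rw [norm_one, mul_one, le_div_iff₀ hlog, mul_comm]
    exact key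
  have hB : HasBoundedPole B := by
    refine hasBoundedPole_of_le_abs (δ := (1 - ‖p‖) / 2) (by linarith) ?_
    rintro x ⟨-, hx⟩
    linarith [one_sub_norm_le_of_mem_sphere hp0 x]
  have hBm : MeasurableSet B := (hsub.measurable hK).inter
    (isOpen_lt hh hx0).measurableSet
  have hAB : A ∩ B = ∅ := by
    ext x
    simp only [Set.mem_inter_iff, Set.mem_empty_iff_false, iff_false]
    rintro ⟨h1, h2⟩
    exact h1.2.not_gt h2.2
  convert hA.union hB hBm (by rw [hAB, measure_empty]) using 1
  ext x
  simp only [A, B, Set.mem_union, Set.mem_ofPred_eq, ← and_or_left, le_or_gt, and_true]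

end BoundedPole

section Separation

/-- A finite system of affine equations without solution in the open unit ball admits a
nontrivial combination of constant sign on that ball. -/
lemma exists_sum_mul_inner_sub_nonpos {E ι : Type*} [NormedAddCommGroup E] [InnerProductSpace ℝ E]
    [Fintype ι] (v : ι → E) (t : ι → ℝ)
    (h : ¬∃ p : E, ‖p‖ < 1 ∧ ∀ i, inner ℝ (v i) p = t i) :
    ∃ c : ι → ℝ, (∃ i, c i ≠ 0) ∧ ∀ y : E, ‖y‖ < 1 → ∑ i, c i * (inner ℝ (v i) y - t i) ≤ 0 := by
  classical
  set A : E →ₗ[ℝ] ι → ℝ := LinearMap.pi fun i => (innerSL ℝ (v i) : E →ₗ[ℝ] ℝ) with hA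
  have hAi : ∀ y i, A y i = inner ℝ (v i) y := fun _ _ => rfl
  suffices H : ∃ f : (ι → ℝ) →ₗ[ℝ] ℝ, f ≠ 0 ∧ ∀ y : E, ‖y‖ < 1 → f (A y) ≤ f t by
    obtain ⟨f, hf0, hf⟩ := H
    refine ⟨fun i => f (Pi.single i 1), ?_, fun y hy => ?_⟩
    · by_contra! hc
      exact hf0 (LinearMap.pi_ext' fun i => LinearMap.ext_ring (by simpa using hc i))
    · have key := sub_nonpos.2 (hf y hy)
      rw [← map_sub, LinearMap.pi_apply_eq_sum_univ f (A y - t)] at key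
      have hsingle : ∀ i : ι, (fun j => if i = j then (1 : ℝ) else 0) = Pi.single i 1 := by
        intro i
        ext j
        simp [Pi.single_apply, eq_comm]
      simpa [hAi, mul_comm, hsingle] using key
  by_cases hsurj : LinearMap.range A = ⊤
  · have hopen : IsOpenMap A := A.isOpenMap_of_finiteDimensional (LinearMap.range_eq_top.1 hsurj)
    obtain ⟨f, hf⟩ := geometric_hahn_banach_open_point (s := A '' ball 0 1) (x := t)
      ((convex_ball 0 1).linear_image A) (hopen _ isOpen_ball) (by
        rintro ⟨p, hp, hpt⟩
        exact h ⟨p, mem_ball_zero_iff.1 hp, fun i => by rw [← hpt, hAi]⟩)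
    refine ⟨f, ?_, fun y hy => (hf _ ⟨y, mem_ball_zero_iff.2 hy, rfl⟩).le⟩
    intro hf0
    have h1 := hf _ ⟨0, mem_ball_self one_pos, rfl⟩
    have h2 : ∀ u, f u = 0 := fun u => LinearMap.congr_fun hf0 u
    rw [h2, h2] at h1
    exact h1.false
  · obtain ⟨f, hf0, hf⟩ := Submodule.exists_le_ker_of_lt_top _ (lt_top_iff_ne_top.2 hsurj)
    have hfA : ∀ y, f (A y) = 0 := fun y => hf ⟨y, rfl⟩
    rcases le_total 0 (f t) with ht | ht
    · exact ⟨f, hf0, fun y _ => by rw [hfA]; exact ht⟩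
    · exact ⟨-f, neg_ne_zero.2 hf0, fun y _ => by simpa [hfA] using ht⟩

end Separation

section Polytope

open scoped RealInnerProductSpace

variable {n : ℕ} {ι : Type*}

/-- The part of the sphere cut out by the half-spaces `t i ≤ ⟪v i, x⟫`, `i ∈ I`. -/
def sphericalRegion (I : Finset ι) (v : ι → EuclideanSpace ℝ (Fin (n + 1))) (t : ι → ℝ) :
    Set (sphere (0 : EuclideanSpace ℝ (Fin (n + 1))) 1) :=
  {x | ∀ i ∈ I, t i ≤ ⟪v i, (x : EuclideanSpace ℝ (Fin (n + 1)))⟫}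

lemma measurableSet_sphericalRegion (I : Finset ι) (v : ι → EuclideanSpace ℝ (Fin (n + 1)))
    (t : ι → ℝ) : MeasurableSet (sphericalRegion I v t) := by
  simp only [sphericalRegion, Set.ofPred_forall]
  exact I.measurableSet_biInter fun i _ => (isClosed_le (by fun_prop) (by fun_prop)).measurableSet

lemma HasBoundedPole.of_union {A B : Set (sphere (0 : EuclideanSpace ℝ (Fin (n + 1))) 1)}
    (hAB : HasBoundedPole (A ∪ B)) (hB : HasBoundedPole B) (hBm : MeasurableSet B)
    (h0 : sphereMeasure n (A ∩ B) = 0) : HasBoundedPole A := by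
  refine (hAB.sub hB).congr' ?_ EventuallyEq.rfl
  filter_upwards [self_mem_nhdsWithin] with ε hε
  rw [setIntegral_union₀ h0 hBm.nullMeasurableSet
    (integrable_poleKernel _ hε).integrableOn (integrable_poleKernel _ hε).integrableOn,
    add_sub_cancel_right]

lemma hasBoundedPole_of_measure_eq_zero {A : Set (sphere (0 : EuclideanSpace ℝ (Fin (n + 1))) 1)}
    (hA : sphereMeasure n A = 0) : HasBoundedPole A := by
  simp only [HasBoundedPole, setIntegral_measure_zero _ hA]
  exact Asymptotics.isBigO_zero _ _

lemma hasBoundedPole_sphericalRegion_of_apex {I : Finset ι}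
    {v : ι → EuclideanSpace ℝ (Fin (n + 1))} {t : ι → ℝ} (hv0 : ∀ i ∈ I, v i 0 = 0)
    {p : EuclideanSpace ℝ (Fin (n + 1))} (hp : ‖p‖ < 1) (hpt : ∀ i ∈ I, ⟪v i, p⟫ = t i) :
    HasBoundedPole (sphericalRegion I v t) := by
  have hcone := hasBoundedPole_cone (K := {w | ∀ i ∈ I, 0 ≤ ⟪v i, w⟫}) ?_ ?_ ?_
    ((norm_horizontalPart_le p).trans_lt hp) (horizontalPart_apply_zero p)
  · convert hcone using 1
    ext x
    refine forall₂_congr fun i hi => ?_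
    rw [inner_sub_right, inner_horizontalPart (hv0 i hi), hpt i hi, sub_nonneg]
  · simp only [Set.ofPred_forall]
    exact I.measurableSet_biInter fun i _ =>
      (isClosed_le (by fun_prop) (by fun_prop)).measurableSet
  · intro r hr w
    refine forall₂_congr fun i _ => ?_
    rw [inner_smul_right, mul_nonneg_iff_of_pos_left hr]
  · intro w s
    refine forall₂_congr fun i hi => ?_
    rw [inner_add_right, inner_smul_right, inner_verticalUnit, hv0 i hi, mul_zero, add_zero]

lemma hasBoundedPole_sphericalRegion_of_flip [DecidableEq ι] {I : Finset ι} {j : ι} (hj : j ∈ I)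
    {v v' : ι → EuclideanSpace ℝ (Fin (n + 1))} {t t' : ι → ℝ}
    (hvj : v j ≠ 0) (hvj0 : v j 0 = 0) (hv : ∀ i, i ≠ j → v' i = v i)
    (ht : ∀ i, i ≠ j → t' i = t i) (hv' : v' j = -v j) (ht' : t' j = -t j)
    (herase : HasBoundedPole (sphericalRegion (I.erase j) v t))
    (h : HasBoundedPole (sphericalRegion I v' t')) :
    HasBoundedPole (sphericalRegion I v t) := by
  have hmem : ∀ x, x ∈ sphericalRegion I v t ↔ t j ≤ ⟪v j, (x : EuclideanSpace ℝ (Fin (n + 1)))⟫ ∧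
      x ∈ sphericalRegion (I.erase j) v t := by
    intro x
    conv_lhs => rw [← Finset.insert_erase hj]
    exact Finset.forall_mem_insert _ _ _
  have hmem' : ∀ x, x ∈ sphericalRegion I v' t' ↔
      ⟪v j, (x : EuclideanSpace ℝ (Fin (n + 1)))⟫ ≤ t j ∧
        x ∈ sphericalRegion (I.erase j) v t := by
    intro x
    conv_lhs => rw [← Finset.insert_erase hj]
    refine (Finset.forall_mem_insert _ _ _).trans (and_congr ?_ (forall₂_congr fun i hi => ?_))
    · rw [hv', ht', inner_neg_left, neg_le_neg_iff]
    · rw [hv i (Finset.ne_of_mem_erase hi), ht i (Finset.ne_of_mem_erase hi)]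
  refine HasBoundedPole.of_union (B := sphericalRegion I v' t') ?_ h
    (measurableSet_sphericalRegion _ _ _)
    (measure_mono_null ?_ (sphereMeasure_hyperplane hvj hvj0 (t j)))
  · convert herase using 1
    ext x
    rw [Set.mem_union, hmem, hmem', ← or_and_right]
    exact and_iff_right (le_total _ _)
  · rintro x ⟨h1, h2⟩
    exact le_antisymm ((hmem' x).1 h2).1 ((hmem x).1 h1).1

lemma hasBoundedPole_sphericalRegion_of_flips [DecidableEq ι] {I : Finset ι}
    {v : ι → EuclideanSpace ℝ (Fin (n + 1))} {t : ι → ℝ}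
    (hv : ∀ i ∈ I, v i ≠ 0 ∧ v i 0 = 0)
    (hsub : ∀ J ⊂ I, ∀ (v : ι → EuclideanSpace ℝ (Fin (n + 1))) (t : ι → ℝ),
      (∀ i ∈ J, v i ≠ 0 ∧ v i 0 = 0) → HasBoundedPole (sphericalRegion J v t))
    (J : Finset ι) (hJ : J ⊆ I)
    (h : HasBoundedPole (sphericalRegion I (fun i => if i ∈ J then -v i else v i)
      fun i => if i ∈ J then -t i else t i)) :
    HasBoundedPole (sphericalRegion I v t) := by
  induction J using Finset.induction_on with
  | empty => simpa using h
  | insert j J hjJ ih =>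
    have hjI := hJ (Finset.mem_insert_self j J)
    refine ih ((Finset.subset_insert _ _).trans hJ)
      (hasBoundedPole_sphericalRegion_of_flip hjI ?_ ?_ ?_ ?_ ?_ ?_
        (hsub _ (Finset.erase_ssubset hjI) _ _ fun i hi => ?_) h)
    · simpa [hjJ] using (hv j hjI).1
    · simpa [hjJ] using (hv j hjI).2
    · intro i hi
      simp [hi]
    · intro i hi
      simp [hi]
    · simp [hjJ]
    · simp [hjJ]
    · have := hv i (Finset.mem_of_mem_erase hi)
      by_cases hiJ : i ∈ J <;> simp [hiJ, this]

lemma sphereMeasure_sphericalRegion_eq_zero {I : Finset ι}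
    {v : ι → EuclideanSpace ℝ (Fin (n + 1))} {t : ι → ℝ}
    (hv : ∀ i ∈ I, v i ≠ 0 ∧ v i 0 = 0) {c : ι → ℝ} (hc : ∃ i ∈ I, c i ≠ 0)
    (hsum : ∀ y : EuclideanSpace ℝ (Fin (n + 1)), ‖y‖ < 1 →
      ∑ i ∈ I, c i * (⟪v i, y⟫ - t i) ≤ 0) (hc0 : ∀ i ∈ I, 0 ≤ c i) :
    sphereMeasure n (sphericalRegion I v t) = 0 := by
  obtain ⟨j, hj, hcj⟩ := hc
  refine measure_mono_null ?_ (measure_union_null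
    (sphereMeasure_hyperplane_zero (v := verticalUnit n) (by simp))
    (sphereMeasure_hyperplane (hv j hj).1 (hv j hj).2 (t j)))
  intro x hx
  by_cases hx0 : (x : EuclideanSpace ℝ (Fin (n + 1))) 0 = 0
  · left
    rwa [Set.mem_ofPred_eq, real_inner_comm, inner_verticalUnit]
  right
  have hlt : ‖horizontalPart (x : EuclideanSpace ℝ (Fin (n + 1)))‖ < 1 := by
    have h1 := norm_horizontalPart_sq (x : EuclideanSpace ℝ (Fin (n + 1)))
    rw [norm_eq_of_mem_sphere] at h1
    have h2 := sq_pos_of_ne_zero hx0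
    exact (sq_lt_one_iff₀ (norm_nonneg _)).1 (by linarith)
  have hle := hsum _ hlt
  have hnn : ∀ i ∈ I,
      0 ≤ c i * (⟪v i, horizontalPart (x : EuclideanSpace ℝ (Fin (n + 1)))⟫ - t i) := by
    intro i hi
    rw [inner_horizontalPart (hv i hi).2]
    exact mul_nonneg (hc0 i hi) (sub_nonneg.2 (hx i hi))
  have hz := (Finset.sum_eq_zero_iff_of_nonneg hnn).1 (le_antisymm hle (Finset.sum_nonneg hnn)) j hj
  rw [inner_horizontalPart (hv j hj).2] at hz
  exact sub_eq_zero.1 ((mul_eq_zero.1 hz).resolve_left hcj)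

theorem hasBoundedPole_sphericalRegion [DecidableEq ι] (I : Finset ι)
    (v : ι → EuclideanSpace ℝ (Fin (n + 1))) (t : ι → ℝ) (hv : ∀ i ∈ I, v i ≠ 0 ∧ v i 0 = 0) :
    HasBoundedPole (sphericalRegion I v t) := by
  induction I using Finset.strongInduction generalizing v t with
  | H I ih =>
  by_cases hp : ∃ p : EuclideanSpace ℝ (Fin (n + 1)), ‖p‖ < 1 ∧ ∀ i : I, ⟪v i, p⟫ = t i
  · obtain ⟨p, hp, hpt⟩ := hp
    exact hasBoundedPole_sphericalRegion_of_apex (fun i hi => (hv i hi).2) hp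
      fun i hi => hpt ⟨i, hi⟩
  obtain ⟨c', ⟨j, hj⟩, hc'⟩ :=
    exists_sum_mul_inner_sub_nonpos (fun i : I => v i) (fun i : I => t i) hp
  set c : ι → ℝ := Function.extend Subtype.val c' 0
  have hcI : ∀ i : I, c i = c' i := fun i => Subtype.val_injective.extend_apply _ _ i
  have hc : ∀ y : EuclideanSpace ℝ (Fin (n + 1)), ‖y‖ < 1 →
      ∑ i ∈ I, c i * (⟪v i, y⟫ - t i) ≤ 0 := by
    intro y hy
    rw [← Finset.sum_coe_sort I fun i => c i * (⟪v i, y⟫ - t i)]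
    simpa only [hcI] using hc' y hy
  refine hasBoundedPole_sphericalRegion_of_flips hv ih {i ∈ I | c i < 0}
    (Finset.filter_subset _ _) (hasBoundedPole_of_measure_eq_zero
      (sphereMeasure_sphericalRegion_eq_zero (c := fun i => |c i|) ?_ ?_ ?_ ?_))
  · intro i hi
    have := hv i hi
    by_cases hci : c i < 0 <;> simp [hi, hci, this]
  · exact ⟨j, j.2, by simpa [hcI] using hj⟩
  · intro y hy
    refine (Finset.sum_congr rfl fun i hi => ?_).trans_le (hc y hy)
    by_cases hci : c i < 0
    · simp only [Finset.mem_filter, hi, hci, true_and, if_true, abs_of_neg hci, inner_neg_left]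
      ring
    · simp only [Finset.mem_filter, hci, and_false, if_false, abs_of_nonneg (not_lt.1 hci)]
  · exact fun i _ => abs_nonneg _

end Polytope

section Limit

open scoped Topology

variable {n : ℕ}

lemma HasBoundedPole.tendsto_ofReal_mul
    {A : Set (sphere (0 : EuclideanSpace ℝ (Fin (n + 1))) 1)} (hA : HasBoundedPole A) :
    Tendsto (fun ε : ℝ => (ε : ℂ) * ∫ x in A,
      poleKernel (n + 1) ε ((x : EuclideanSpace ℝ (Fin (n + 1))) 0) ∂(sphereMeasure n))
      (𝓝[>] 0) (𝓝 0) := by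
  have hε : Tendsto (fun ε : ℝ => (ε : ℂ)) (𝓝[>] 0) (𝓝 0) :=
    (Complex.continuous_ofReal.tendsto' 0 0 Complex.ofReal_zero).mono_left nhdsWithin_le_nhds
  exact hε.zero_mul_isBoundedUnder_le hA.isBoundedUnder_le

lemma setIntegral_mul_poleKernel_sub_setIntegral_poleKernel
    (A : Set (sphere (0 : EuclideanSpace ℝ (Fin (n + 1))) 1)) (m : ℕ) {ε : ℝ} (hε : 0 < ε) :
    (∫ x in A, ((x : EuclideanSpace ℝ (Fin (n + 1))) 0 : ℂ) *
        poleKernel (m + 1) ε ((x : EuclideanSpace ℝ (Fin (n + 1))) 0) ∂(sphereMeasure n)) -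
      ∫ x in A, poleKernel m ε ((x : EuclideanSpace ℝ (Fin (n + 1))) 0) ∂(sphereMeasure n) =
    ε * Complex.I * ∫ x in A,
      poleKernel (m + 1) ε ((x : EuclideanSpace ℝ (Fin (n + 1))) 0) ∂(sphereMeasure n) := by
  have h : ∀ s : ℝ, (s : ℂ) * poleKernel (m + 1) ε s =
      poleKernel m ε s + ε * Complex.I * poleKernel (m + 1) ε s := by
    intro s
    have hne : (s : ℂ) - ε * Complex.I ≠ 0 := by
      rw [← norm_pos_iff]
      exact (abs_pos.2 hε.ne').trans_le (abs_le_norm_sub_mul_I ε s)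
    rw [poleKernel, poleKernel, pow_succ]
    field_simp
    ring
  simp only [h]
  rw [integral_add (integrable_poleKernel _ hε).integrableOn
    ((integrable_poleKernel _ hε).const_mul _).integrableOn, add_sub_cancel_left,
    integral_const_mul]

end Limit

/-- **Lemma 7.3(2) and Corollary 7.4**: for a spherical DH-polytope `P ⊆ Sⁿ`,
`ε · ∫_P (x₀ - εi)^{-(n+1)} dσ → 0` as `ε → 0⁺`; since the difference of
`∫_P x₀ (x₀ - εi)^{-(n+1)} dσ` and `∫_P (x₀ - εi)^{-n} dσ` equals
`εi · ∫_P (x₀ - εi)^{-(n+1)} dσ`, the two families of integrals have the same limiting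
behavior as `ε → 0⁺` (so that `μ'_h(P) = μ_h(P)`). -/
theorem dh_sphere_eps_tendsto_zero (n : ℕ) (hn : 1 ≤ n)
    (P : Set (EuclideanSpace ℝ (Fin (n + 1))))
    (hP : IsSphericalDHPolytope n P) :
    Tendsto
      (fun ε : ℝ => (ε : ℂ) *
        ∫ x in (Subtype.val ⁻¹' P :
            Set (sphere (0 : EuclideanSpace ℝ (Fin (n + 1))) 1)),
          (((x : EuclideanSpace ℝ (Fin (n + 1))) 0 : ℂ) - (ε : ℂ) * Complex.I) ^ (-(n + 1 : ℤ))
          ∂(sphereMeasure n))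
      (nhdsWithin 0 (Set.Ioi 0)) (nhds 0) ∧
    (∀ ε : ℝ, 0 < ε →
      (∫ x in (Subtype.val ⁻¹' P :
            Set (sphere (0 : EuclideanSpace ℝ (Fin (n + 1))) 1)),
          ((x : EuclideanSpace ℝ (Fin (n + 1))) 0 : ℂ) *
            (((x : EuclideanSpace ℝ (Fin (n + 1))) 0 : ℂ) - (ε : ℂ) * Complex.I) ^ (-(n + 1 : ℤ))
          ∂(sphereMeasure n)) -
      (∫ x in (Subtype.val ⁻¹' P :
            Set (sphere (0 : EuclideanSpace ℝ (Fin (n + 1))) 1)),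
          (((x : EuclideanSpace ℝ (Fin (n + 1))) 0 : ℂ) - (ε : ℂ) * Complex.I) ^ (-(n : ℤ))
          ∂(sphereMeasure n)) =
      (ε : ℂ) * Complex.I *
        ∫ x in (Subtype.val ⁻¹' P :
            Set (sphere (0 : EuclideanSpace ℝ (Fin (n + 1))) 1)),
          (((x : EuclideanSpace ℝ (Fin (n + 1))) 0 : ℂ) - (ε : ℂ) * Complex.I) ^ (-(n + 1 : ℤ))
          ∂(sphereMeasure n)) ∧
    (∀ L : ℂ,
      Tendsto
        (fun ε : ℝ =>
          ∫ x in (Subtype.val ⁻¹' P :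
              Set (sphere (0 : EuclideanSpace ℝ (Fin (n + 1))) 1)),
            ((x : EuclideanSpace ℝ (Fin (n + 1))) 0 : ℂ) *
              (((x : EuclideanSpace ℝ (Fin (n + 1))) 0 : ℂ) - (ε : ℂ) * Complex.I) ^ (-(n + 1 : ℤ))
            ∂(sphereMeasure n))
        (nhdsWithin 0 (Set.Ioi 0)) (nhds L) ↔
      Tendsto
        (fun ε : ℝ =>
          ∫ x in (Subtype.val ⁻¹' P :
              Set (sphere (0 : EuclideanSpace ℝ (Fin (n + 1))) 1)),
            (((x : EuclideanSpace ℝ (Fin (n + 1))) 0 : ℂ) - (ε : ℂ) * Complex.I) ^ (-(n : ℤ))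
            ∂(sphereMeasure n))
        (nhdsWithin 0 (Set.Ioi 0)) (nhds L)) := by
  obtain ⟨S, hS, rfl⟩ := hP
  set A : Set (sphere (0 : EuclideanSpace ℝ (Fin (n + 1))) 1) := Subtype.val ⁻¹' (sphere 0 1 ∩
    ⋂ p ∈ S, {x : EuclideanSpace ℝ (Fin (n + 1)) | p.2 ≤ inner p.1 x (𝕜 := ℝ)}) with hA
  have hAS : A = sphericalRegion S Prod.fst Prod.snd := by
    ext x
    simp [hA, sphericalRegion]
  have hbdd : HasBoundedPole A := by
    classical
    exact hAS ▸ hasBoundedPole_sphericalRegion S _ _ hS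
  have hpole : ∀ (m : ℕ) (ε s : ℝ), ((s : ℂ) - ε * Complex.I) ^ (-(m : ℤ)) = poleKernel m ε s := by
    intro m ε s
    rw [zpow_neg, zpow_natCast, poleKernel]
  have hpole' : ∀ ε s : ℝ,
      ((s : ℂ) - ε * Complex.I) ^ (-(n + 1 : ℤ)) = poleKernel (n + 1) ε s := by
    intro ε s
    rw [← hpole]
    push_cast
    rfl
  simp only [hpole, hpole']
  have hlim := hbdd.tendsto_ofReal_mul
  have hdiff := fun (ε : ℝ) (hε : 0 < ε) =>
    setIntegral_mul_poleKernel_sub_setIntegral_poleKernel A n hε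
  refine ⟨hlim, hdiff, fun L => tendsto_iff_of_dist ?_⟩
  have hnorm := hlim.norm
  rw [norm_zero] at hnorm
  refine hnorm.congr' ?_
  filter_upwards [self_mem_nhdsWithin] with ε hε
  rw [dist_eq_norm, hdiff ε hε]
  simp
end

section
/- Let n ≥ 1, let R > 0, and let c ∈ ℝⁿ have first coordinate 0. Then lim_{ε→0⁺} ∫_{{x ∈ ℝⁿ : ‖x − c‖ ≤ R}} (x₀ − εi)^{−n} dx = (iⁿ/2) · (2π^{(n+1)/2}/Γ((n+1)/2)), where Γ is the Gamma function and 2π^{(n+1)/2}/Γ((n+1)/2) is the surface volume V_n(Sⁿ) of the unit n-sphere. (The volume of any single half-space of the double hyperbolic space DHⁿ is half the total volume iⁿ V_n(Sⁿ); in particular for n = 3 every ball has volume −π²i, encoding the paper's claim that all balls in ∂H³ have the same volume −2π.) -/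
open MeasureTheory Filter Metric

open Complex in
theorem add_sin_mul_I_ne_zero {ε : ℝ} (hε : 0 < ε) (θ : ℝ) :
    (ε : ℂ) + (Real.sin θ : ℂ) * I ≠ 0 := fun h => by
  have := congrArg Complex.re h
  simp at this
  exact hε.ne' this

open Complex in
theorem hasDerivAt_add_sin_mul_I (ε θ : ℝ) :
    HasDerivAt (fun θ : ℝ => (ε : ℂ) + (Real.sin θ : ℂ) * I) ((Real.cos θ : ℂ) * I) θ :=
  (((Real.hasDerivAt_sin θ).ofReal_comp).mul_const I).const_add (ε : ℂ)

open Complex in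
theorem hasDerivAt_cos_div_add_sin_mul_I {ε : ℝ} (hε : 0 < ε) (θ : ℝ) :
    HasDerivAt (fun θ : ℝ => (Real.cos θ : ℂ) / ((ε : ℂ) + (Real.sin θ : ℂ) * I))
      (-(ε * (Real.sin θ : ℂ) + I) / ((ε : ℂ) + (Real.sin θ : ℂ) * I) ^ 2) θ := by
  have h1 := ((Real.hasDerivAt_cos θ).ofReal_comp).div (hasDerivAt_add_sin_mul_I ε θ)
    (add_sin_mul_I_ne_zero hε θ)
  convert! h1 using 2
  have h2 : (Real.cos θ : ℂ) ^ 2 = 1 - (Real.sin θ : ℂ) ^ 2 := by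
    exact_mod_cast Real.cos_sq' θ
  rw [ofReal_neg]
  linear_combination I * h2

open Complex in
theorem continuous_cos_div_add_sin_mul_I {ε : ℝ} (hε : 0 < ε) :
    Continuous fun θ : ℝ => (Real.cos θ : ℂ) / ((ε : ℂ) + (Real.sin θ : ℂ) * I) :=
  continuous_iff_continuousAt.2 fun θ => (hasDerivAt_cos_div_add_sin_mul_I hε θ).continuousAt

open Complex in
theorem continuous_inv_add_sin_mul_I {ε : ℝ} (hε : 0 < ε) :
    Continuous fun θ : ℝ => ((ε : ℂ) + (Real.sin θ : ℂ) * I)⁻¹ :=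
  Continuous.inv₀ (by fun_prop) (add_sin_mul_I_ne_zero hε)

open Complex in
/-- Two-step recursion for the integrals of `(cos θ / (ε + i sin θ)) ^ n`. -/
theorem integral_cos_div_pow_add_two {ε : ℝ} (hε : 0 < ε) (n : ℕ) :
    ∫ θ in -(Real.pi / 2)..Real.pi / 2,
        ((Real.cos θ : ℂ) / ((ε : ℂ) + (Real.sin θ : ℂ) * I)) ^ (n + 2) =
      (∫ θ in -(Real.pi / 2)..Real.pi / 2,
        ((Real.cos θ : ℂ) / ((ε : ℂ) + (Real.sin θ : ℂ) * I)) ^ n) -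
      ε * ∫ θ in -(Real.pi / 2)..Real.pi / 2,
        ((Real.cos θ : ℂ) / ((ε : ℂ) + (Real.sin θ : ℂ) * I)) ^ n *
          ((ε : ℂ) + (Real.sin θ : ℂ) * I)⁻¹ := by
  have cu := continuous_cos_div_add_sin_mul_I hε
  have cD := continuous_inv_add_sin_mul_I hε
  have key := intervalIntegral.integral_eq_sub_of_hasDerivAt (a := -(Real.pi / 2))
    (b := Real.pi / 2)
    (f := fun θ : ℝ => I * ((Real.cos θ : ℂ) / ((ε : ℂ) + (Real.sin θ : ℂ) * I)) ^ (n + 1) /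
      (n + 1))
    (f' := fun θ : ℝ => ((Real.cos θ : ℂ) / ((ε : ℂ) + (Real.sin θ : ℂ) * I)) ^ (n + 2) -
      (((Real.cos θ : ℂ) / ((ε : ℂ) + (Real.sin θ : ℂ) * I)) ^ n -
      ε * (((Real.cos θ : ℂ) / ((ε : ℂ) + (Real.sin θ : ℂ) * I)) ^ n *
          ((ε : ℂ) + (Real.sin θ : ℂ) * I)⁻¹))) (fun θ _ => by
      have h1 := ((((hasDerivAt_cos_div_add_sin_mul_I hε θ).pow (n + 1)).const_mul I).div_const
        ((n : ℂ) + 1))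
      convert! h1 using 1
      have hn : (n : ℂ) + 1 ≠ 0 := by exact_mod_cast n.succ_ne_zero
      have hD := add_sin_mul_I_ne_zero hε θ
      have h2 : (Real.cos θ : ℂ) ^ 2 = 1 - (Real.sin θ : ℂ) ^ 2 := by
        exact_mod_cast Real.cos_sq' θ
      simp only [Nat.add_sub_cancel, Nat.cast_add, Nat.cast_one]
      rw [pow_add _ n 2]
      generalize ((Real.cos θ : ℂ) / ((ε : ℂ) + (Real.sin θ : ℂ) * I)) ^ n = U
      field_simp
      rw [h2]
      ring_nf
      simp only [I_sq]
      ring_nf) (by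
      apply Continuous.intervalIntegrable
      fun_prop)
  rw [intervalIntegral.integral_sub, intervalIntegral.integral_sub,
    intervalIntegral.integral_const_mul] at key
  · simp [-ofReal_cos, -ofReal_sin] at key
    linear_combination key
  all_goals
    apply Continuous.intervalIntegrable
    fun_prop

open Complex in
theorem integral_cos_div_pow_mul_inv_add_two {ε : ℝ} (hε : 0 < ε) (n : ℕ) :
    (n + 2) * (1 + ε ^ 2) * ∫ θ in -(Real.pi / 2)..Real.pi / 2,
        ((Real.cos θ : ℂ) / ((ε : ℂ) + (Real.sin θ : ℂ) * I)) ^ (n + 2) *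
          ((ε : ℂ) + (Real.sin θ : ℂ) * I)⁻¹ =
      (n + 1) * ∫ θ in -(Real.pi / 2)..Real.pi / 2,
        ((Real.cos θ : ℂ) / ((ε : ℂ) + (Real.sin θ : ℂ) * I)) ^ n *
          ((ε : ℂ) + (Real.sin θ : ℂ) * I)⁻¹ := by
  have cu := continuous_cos_div_add_sin_mul_I hε
  have cD := continuous_inv_add_sin_mul_I hε
  have key := intervalIntegral.integral_eq_sub_of_hasDerivAt (a := -(Real.pi / 2))
    (b := Real.pi / 2)
    (f := fun θ : ℝ => I * (((Real.cos θ : ℂ) / ((ε : ℂ) + (Real.sin θ : ℂ) * I)) ^ (n + 1) *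
      ((1 + ε ^ 2) * ((ε : ℂ) + (Real.sin θ : ℂ) * I)⁻¹ - ε)))
    (f' := fun θ : ℝ => (n + 2) * (1 + ε ^ 2) *
        (((Real.cos θ : ℂ) / ((ε : ℂ) + (Real.sin θ : ℂ) * I)) ^ (n + 2) *
          ((ε : ℂ) + (Real.sin θ : ℂ) * I)⁻¹) -
      (n + 1) * (((Real.cos θ : ℂ) / ((ε : ℂ) + (Real.sin θ : ℂ) * I)) ^ n *
          ((ε : ℂ) + (Real.sin θ : ℂ) * I)⁻¹)) (fun θ _ => by
      have hD := add_sin_mul_I_ne_zero hε θ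
      have h1 := (((hasDerivAt_cos_div_add_sin_mul_I hε θ).pow (n + 1)).mul
        ((((hasDerivAt_add_sin_mul_I ε θ).inv hD).const_mul (1 + (ε : ℂ) ^ 2)).sub_const
          (ε : ℂ))).const_mul I
      convert! h1 using 1
      have h2 : (Real.cos θ : ℂ) ^ 2 = 1 - (Real.sin θ : ℂ) ^ 2 := by
        exact_mod_cast Real.cos_sq' θ
      simp only [Nat.add_sub_cancel, Nat.cast_add, Nat.cast_one, Pi.pow_apply, Pi.inv_apply]
      rw [pow_add _ n 2, pow_succ _ n]
      generalize ((Real.cos θ : ℂ) / ((ε : ℂ) + (Real.sin θ : ℂ) * I)) ^ n = U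
      field_simp
      ring_nf
      simp only [I_sq, h2, I_pow_three]
      ring_nf) (by
      apply Continuous.intervalIntegrable
      fun_prop)
  rw [intervalIntegral.integral_sub, intervalIntegral.integral_const_mul,
    intervalIntegral.integral_const_mul] at key
  · simp [-ofReal_cos, -ofReal_sin] at key
    linear_combination key
  all_goals
    apply Continuous.intervalIntegrable
    fun_prop

theorem volume_real_ball_euclideanSpace_fin (m : ℕ) :
    volume.real (ball (0 : EuclideanSpace ℝ (Fin m)) 1) =
      Real.pi ^ ((m : ℝ) / 2) / Real.Gamma ((m : ℝ) / 2 + 1) := by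
  rcases m with _ | m
  · have : ball (0 : EuclideanSpace ℝ (Fin 0)) 1 = {0} := by
      ext x; simp [Subsingleton.elim x 0]
    rw [this, measureReal_def, volume_euclideanSpace_eq_dirac]
    simp
  · rw [measureReal_def, EuclideanSpace.volume_ball]
    rw [ENNReal.ofReal_one, one_pow, one_mul, ENNReal.toReal_ofReal (by positivity),
      Fintype.card_fin, Real.sqrt_eq_rpow, ← Real.rpow_natCast, ← Real.rpow_mul Real.pi_pos.le]
    congr 2
    ring

/-- Splitting off the first coordinate of Euclidean space preserves volume. -/
theorem measurePreserving_toLp_cons (m : ℕ) :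
    MeasurePreserving (fun p : ℝ × EuclideanSpace ℝ (Fin m) =>
      (WithLp.toLp 2 (Fin.cons p.1 p.2.ofLp : Fin (m + 1) → ℝ) :
        EuclideanSpace ℝ (Fin (m + 1)))) := by
  have h1 : MeasurePreserving (Prod.map id (WithLp.ofLp) :
      ℝ × EuclideanSpace ℝ (Fin m) → ℝ × (Fin m → ℝ)) :=
    (MeasurePreserving.id volume).prod (PiLp.volume_preserving_ofLp (Fin m))
  have h2 := (volume_preserving_piFinSuccAbove (fun _ : Fin (m + 1) => ℝ) 0).symm _
  have h3 := (PiLp.volume_preserving_toLp (Fin (m + 1))).comp (h2.comp h1)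
  convert! h3 using 1
  ext p i
  simp [MeasurableEquiv.piFinSuccAbove, Fin.insertNthEquiv]

theorem toLp_cons_mem_closedBall_iff {m : ℕ} {c : EuclideanSpace ℝ (Fin (m + 1))} (hc : c 0 = 0)
    {R : ℝ} (hR : 0 ≤ R) {t : ℝ} (ht : t ^ 2 ≤ R ^ 2) (y : EuclideanSpace ℝ (Fin m)) :
    (WithLp.toLp 2 (Fin.cons t y.ofLp : Fin (m + 1) → ℝ) : EuclideanSpace ℝ (Fin (m + 1))) ∈
        closedBall c R ↔
      y ∈ closedBall (WithLp.toLp 2 (Fin.tail c.ofLp) : EuclideanSpace ℝ (Fin m))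
        √(R ^ 2 - t ^ 2) := by
  rw [mem_closedBall, mem_closedBall, EuclideanSpace.dist_eq, EuclideanSpace.dist_eq,
    Real.sqrt_le_left hR, Real.sqrt_le_sqrt_iff (by linarith), Fin.sum_univ_succ]
  simp [hc, Real.dist_eq, Fin.tail]
  constructor <;> intro h <;> linarith

theorem sq_le_sq_of_toLp_cons_mem_closedBall {m : ℕ} {c : EuclideanSpace ℝ (Fin (m + 1))}
    (hc : c 0 = 0) {R : ℝ} (hR : 0 ≤ R) {t : ℝ} {y : EuclideanSpace ℝ (Fin m)}
    (h : (WithLp.toLp 2 (Fin.cons t y.ofLp : Fin (m + 1) → ℝ) : EuclideanSpace ℝ (Fin (m + 1))) ∈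
      closedBall c R) : t ^ 2 ≤ R ^ 2 := by
  rw [mem_closedBall, EuclideanSpace.dist_eq, Real.sqrt_le_left hR, Fin.sum_univ_succ] at h
  have : 0 ≤ ∑ i : Fin m, dist ((WithLp.toLp 2 (Fin.cons t y.ofLp : Fin (m + 1) → ℝ) :
    EuclideanSpace ℝ (Fin (m + 1))) i.succ) (c i.succ) ^ 2 := by positivity
  simp [hc, Real.dist_eq] at h this
  linarith

/-- Slicing a ball along its first coordinate. -/
theorem integral_closedBall_comp_apply_zero {m : ℕ} {c : EuclideanSpace ℝ (Fin (m + 1))}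
    (hc : c 0 = 0) {R : ℝ} (hR : 0 ≤ R) {g : ℝ → ℂ} (hg : Continuous g) :
    ∫ x in closedBall c R, g (x 0) =
      volume.real (ball (0 : EuclideanSpace ℝ (Fin m)) 1) *
        ∫ t in -R..R, (√(R ^ 2 - t ^ 2) : ℂ) ^ m * g t := by
  have hmp := measurePreserving_toLp_cons m
  set ψ := fun p : ℝ × EuclideanSpace ℝ (Fin m) =>
      (WithLp.toLp 2 (Fin.cons p.1 p.2.ofLp : Fin (m + 1) → ℝ) :
        EuclideanSpace ℝ (Fin (m + 1))) with hψ
  have hint : IntegrableOn (fun x : EuclideanSpace ℝ (Fin (m + 1)) => g (x 0))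
      (closedBall c R) :=
    ContinuousOn.integrableOn_compact (isCompact_closedBall c R)
      (Continuous.continuousOn (by fun_prop))
  rw [← integrable_indicator_iff measurableSet_closedBall, ← hmp.map_eq] at hint
  rw [← integral_indicator measurableSet_closedBall, ← hmp.map_eq,
    integral_map hmp.aemeasurable hint.1]
  have hint' := hint.comp_aemeasurable hmp.aemeasurable
  rw [Measure.volume_eq_prod] at hint' ⊢
  change ∫ z, ((closedBall c R).indicator (fun x => g (x 0)) ∘ ψ) z ∂_ = _
  rw [integral_prod _ hint', ← intervalIntegral.integral_const_mul,
    intervalIntegral.integral_of_le (by linarith), ← integral_Icc_eq_integral_Ioc,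
    ← integral_indicator measurableSet_Icc]
  congr 1 with t
  change ∫ y, (closedBall c R).indicator (fun x => g (x 0)) (ψ (t, y)) = _
  by_cases ht : t ^ 2 ≤ R ^ 2
  · have ht' : t ∈ Set.Icc (-R) R := abs_le.1 (abs_le_of_sq_le_sq ht hR)
    rw [Set.indicator_of_mem ht']
    have : ∀ y, (closedBall c R).indicator (fun x => g (x 0)) (ψ (t, y)) =
        (closedBall (WithLp.toLp 2 (Fin.tail c.ofLp) : EuclideanSpace ℝ (Fin m))
          √(R ^ 2 - t ^ 2)).indicator (fun _ => g t) y := fun y => by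
      by_cases hy : ψ (t, y) ∈ closedBall c R
      · rw [Set.indicator_of_mem hy,
          Set.indicator_of_mem ((toLp_cons_mem_closedBall_iff hc hR ht y).1 hy)]
        simp [hψ]
      · rw [Set.indicator_of_notMem hy,
          Set.indicator_of_notMem (mt (toLp_cons_mem_closedBall_iff hc hR ht y).2 hy)]
    simp_rw [this]
    rw [integral_indicator measurableSet_closedBall, setIntegral_const,
      Measure.addHaar_real_closedBall _ _ (Real.sqrt_nonneg _), finrank_euclideanSpace_fin]
    simp only [Complex.real_smul]
    push_cast
    ring
  · have ht' : t ∉ Set.Icc (-R) R := fun h => ht (sq_le_sq.2 (by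
      rw [abs_of_nonneg hR]; exact abs_le.2 h))
    rw [Set.indicator_of_notMem ht', integral_eq_zero_of_ae]
    refine .of_forall fun y => Set.indicator_of_notMem (fun hy => ht ?_) _
    exact sq_le_sq_of_toLp_cons_mem_closedBall hc hR hy

/-- The substitution `t = R sin θ`. -/
theorem integral_sqrt_pow_mul {R : ℝ} (hR : 0 ≤ R) (m : ℕ) {g : ℝ → ℂ} (hg : Continuous g) :
    ∫ t in -R..R, (√(R ^ 2 - t ^ 2) : ℂ) ^ m * g t =
      ∫ θ in -(Real.pi / 2)..Real.pi / 2,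
        ((R * Real.cos θ : ℝ) : ℂ) ^ (m + 1) * g (R * Real.sin θ) := by
  have h := intervalIntegral.integral_deriv_smul_comp (a := -(Real.pi / 2)) (b := Real.pi / 2)
    (f := fun θ => R * Real.sin θ) (f' := fun θ => R * Real.cos θ)
    (g := fun t => (√(R ^ 2 - t ^ 2) : ℂ) ^ m * g t)
    (fun θ _ => (Real.hasDerivAt_sin θ).const_mul R)
    (Continuous.continuousOn (by fun_prop)) (by fun_prop)
  simp only [Real.sin_neg, Real.sin_pi_div_two, mul_neg, mul_one] at h
  rw [← h]
  refine intervalIntegral.integral_congr fun θ hθ => ?_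
  rw [Set.uIcc_of_le (by linarith [Real.pi_pos])] at hθ
  have h1 : √(R ^ 2 - (R * Real.sin θ) ^ 2) = R * Real.cos θ := by
    rw [Real.sqrt_eq_iff_mul_self_eq (by nlinarith [Real.sin_sq_le_one θ, sq_nonneg R])
      (mul_nonneg hR (Real.cos_nonneg_of_mem_Icc hθ))]
    linear_combination -R ^ 2 * Real.sin_sq_add_cos_sq θ
  simp only [Function.comp, h1, Complex.real_smul]
  ring

open Complex in
theorem tendsto_mul_integral_cos_div_pow_mul_inv (n : ℕ) :
    Tendsto (fun ε : ℝ => (ε : ℂ) * ∫ θ in -(Real.pi / 2)..Real.pi / 2,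
        ((Real.cos θ : ℂ) / ((ε : ℂ) + (Real.sin θ : ℂ) * I)) ^ n *
          ((ε : ℂ) + (Real.sin θ : ℂ) * I)⁻¹) (nhdsWithin 0 (Set.Ioi 0)) (nhds 0) := by
  have hid : Tendsto (fun ε : ℝ => (ε : ℂ)) (nhdsWithin 0 (Set.Ioi 0)) (nhds 0) :=
    (Complex.continuous_ofReal.tendsto' 0 0 ofReal_zero).mono_left nhdsWithin_le_nhds
  induction n using Nat.twoStepInduction with
  | zero =>
    simp only [pow_zero, one_mul, ← intervalIntegral.integral_const_mul]
    have h := intervalIntegral.tendsto_integral_filter_of_dominated_convergence (μ := volume)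
      (a := -(Real.pi / 2)) (b := Real.pi / 2) (l := nhdsWithin (0 : ℝ) (Set.Ioi 0))
      (F := fun (ε θ : ℝ) => (ε : ℂ) * ((ε : ℂ) + (Real.sin θ : ℂ) * I)⁻¹)
      (f := fun _ => 0) (fun _ => 1) ?_ ?_ intervalIntegrable_const ?_
    · simpa using h
    · filter_upwards [self_mem_nhdsWithin] with ε hε
      have := continuous_inv_add_sin_mul_I hε
      exact Continuous.aestronglyMeasurable (by fun_prop)
    · filter_upwards [self_mem_nhdsWithin] with ε hε
      refine .of_forall fun θ _ => ?_
      rw [← div_eq_mul_inv, norm_div]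
      refine div_le_one_of_le₀ ?_ (norm_nonneg _)
      have := abs_re_le_norm ((ε : ℂ) + (Real.sin θ : ℂ) * I)
      simpa [-ofReal_sin] using this
    · filter_upwards [compl_mem_ae_iff.2 (measure_singleton (0 : ℝ))] with θ h0 hθ
      rw [Set.uIoc_of_le (by linarith [Real.pi_pos])] at hθ
      have hs : Real.sin θ ≠ 0 := fun h => h0 <|
        (Real.sin_eq_zero_iff_of_lt_of_lt (by linarith [hθ.1, Real.pi_pos])
          (by linarith [hθ.2, Real.pi_pos])).1 h
      have hs' : 0 + (Real.sin θ : ℂ) * I ≠ 0 := by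
        rw [zero_add]
        exact mul_ne_zero (ofReal_ne_zero.2 hs) I_ne_zero
      have h1 := hid.mul ((hid.add_const ((Real.sin θ : ℂ) * I)).inv₀ hs')
      rwa [zero_mul] at h1
  | one =>
    have h1 : Tendsto (fun ε : ℝ => (ε : ℂ) * (I * ((ε : ℂ) + I)⁻¹ - I * ((ε : ℂ) - I)⁻¹))
        (nhdsWithin 0 (Set.Ioi 0)) (nhds (0 * (I * (0 + I)⁻¹ - I * (0 - I)⁻¹))) :=
      hid.mul ((((hid.add_const I).inv₀ (by simp)).const_mul I).sub
        (((hid.sub_const I).inv₀ (by simp)).const_mul I))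
    rw [zero_mul] at h1
    refine h1.congr' ?_
    filter_upwards [self_mem_nhdsWithin] with ε hε
    have cu := continuous_cos_div_add_sin_mul_I hε
    have cD := continuous_inv_add_sin_mul_I hε
    rw [intervalIntegral.integral_eq_sub_of_hasDerivAt (a := -(Real.pi / 2))
      (f := fun θ : ℝ => I * ((ε : ℂ) + (Real.sin θ : ℂ) * I)⁻¹)]
    · simp [-ofReal_sin, sub_eq_add_neg]
    · intro θ _
      have hD := add_sin_mul_I_ne_zero hε θ
      convert! ((hasDerivAt_add_sin_mul_I ε θ).inv hD).const_mul I using 1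
      field_simp
      simp
    · apply Continuous.intervalIntegrable
      fun_prop
  | more n ih _ =>
    refine squeeze_zero_norm' ?_ (tendsto_zero_iff_norm_tendsto_zero.1 ih)
    filter_upwards [self_mem_nhdsWithin] with ε hε
    rw [norm_mul, norm_mul]
    gcongr
    have h := congrArg norm (integral_cos_div_pow_mul_inv_add_two hε n)
    have h1 : ‖((n : ℂ) + 2) * (1 + (ε : ℂ) ^ 2)‖ = (n + 2) * (1 + ε ^ 2) := by
      rw [show ((n : ℂ) + 2) * (1 + (ε : ℂ) ^ 2) = (((n + 2) * (1 + ε ^ 2) : ℝ) : ℂ) by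
        push_cast; ring, Complex.norm_of_nonneg (by positivity)]
    have h2 : ‖(n : ℂ) + 1‖ = n + 1 := by
      rw [show (n : ℂ) + 1 = ((n + 1 : ℝ) : ℂ) by push_cast; ring,
        Complex.norm_of_nonneg (by positivity)]
    rw [norm_mul, h1, norm_mul, h2] at h
    refine le_of_mul_le_mul_left ?_ (show (0 : ℝ) < n + 1 by positivity)
    rw [← h]
    refine mul_le_mul_of_nonneg_right ?_ (norm_nonneg _)
    nlinarith [sq_nonneg ε, mul_nonneg (Nat.cast_nonneg (α := ℝ) n) (sq_nonneg ε)]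

open Complex in
theorem tendsto_integral_cos_div_pow (n : ℕ) :
    Tendsto (fun ε : ℝ => ∫ θ in -(Real.pi / 2)..Real.pi / 2,
        ((Real.cos θ : ℂ) / ((ε : ℂ) + (Real.sin θ : ℂ) * I)) ^ n)
      (nhdsWithin 0 (Set.Ioi 0)) (nhds Real.pi) := by
  induction n using Nat.twoStepInduction with
  | zero => simp
  | one =>
    have hid : Tendsto (fun ε : ℝ => (ε : ℂ)) (nhdsWithin 0 (Set.Ioi 0)) (nhds 0) :=
      (Complex.continuous_ofReal.tendsto' 0 0 ofReal_zero).mono_left nhdsWithin_le_nhds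
    have h1 : Tendsto (fun ε : ℝ => -I * log ((ε : ℂ) + I) - -I * log ((ε : ℂ) - I))
        (nhdsWithin 0 (Set.Ioi 0)) (nhds (-I * log (0 + I) - -I * log (0 - I))) :=
      (((hid.add_const I).clog (by simp [slitPlane])).const_mul (-I)).sub
        (((hid.sub_const I).clog (by simp [slitPlane])).const_mul (-I))
    rw [zero_add, zero_sub, log_I, log_neg_I,
      show -I * (Real.pi / 2 * I) - -I * (-(Real.pi / 2) * I) = (Real.pi : ℂ) by
        linear_combination -(Real.pi : ℂ) * I_sq] at h1
    refine h1.congr' ?_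
    filter_upwards [self_mem_nhdsWithin] with ε hε
    have cu := continuous_cos_div_add_sin_mul_I hε
    rw [intervalIntegral.integral_eq_sub_of_hasDerivAt (a := -(Real.pi / 2))
      (f := fun θ : ℝ => -I * log ((ε : ℂ) + (Real.sin θ : ℂ) * I))]
    · simp [-ofReal_sin, sub_eq_add_neg]
    · intro θ _
      have hD : (ε : ℂ) + (Real.sin θ : ℂ) * I ∈ slitPlane := by
        left
        simpa [-ofReal_sin] using hε
      convert! ((hasDerivAt_add_sin_mul_I ε θ).clog_real hD).const_mul (-I) using 1
      linear_combination (Real.cos θ : ℂ) / ((ε : ℂ) + (Real.sin θ : ℂ) * I) * I_sq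
    · apply Continuous.intervalIntegrable
      fun_prop
  | more n ih _ =>
    have h := ih.sub (tendsto_mul_integral_cos_div_pow_mul_inv n)
    rw [sub_zero] at h
    refine h.congr' ?_
    filter_upwards [self_mem_nhdsWithin] with ε hε
    exact (integral_cos_div_pow_add_two hε n).symm

open Complex in
theorem integral_closedBall_sub_mul_I_zpow {m : ℕ} {c : EuclideanSpace ℝ (Fin (m + 1))}
    (hc : c 0 = 0) {R : ℝ} (hR : 0 < R) {ε : ℝ} (hε : 0 < ε) :
    ∫ x in closedBall c R, ((x 0 : ℂ) - (ε : ℂ) * I) ^ (-((m + 1 : ℕ) : ℤ)) =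
      volume.real (ball (0 : EuclideanSpace ℝ (Fin m)) 1) * (I ^ (m + 1) *
        ∫ θ in -(Real.pi / 2)..Real.pi / 2,
          ((Real.cos θ : ℂ) / (((ε / R : ℝ) : ℂ) + (Real.sin θ : ℂ) * I)) ^ (m + 1)) := by
  have h0 : ∀ t : ℝ, (t : ℂ) - (ε : ℂ) * I ≠ 0 := fun t h => by
    have := congrArg Complex.im h
    simp at this
    exact hε.ne' this
  have hg : Continuous fun t : ℝ => ((t : ℂ) - (ε : ℂ) * I) ^ (-((m + 1 : ℕ) : ℤ)) :=
    Continuous.zpow₀ (by fun_prop) _ fun t => .inl (h0 t)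
  rw [integral_closedBall_comp_apply_zero hc hR.le hg, integral_sqrt_pow_mul hR.le m hg,
    ← intervalIntegral.integral_const_mul (I ^ (m + 1))]
  congr 1
  refine intervalIntegral.integral_congr fun θ _ => ?_
  have hR' : (R : ℂ) ≠ 0 := ofReal_ne_zero.2 hR.ne'
  have hD := add_sin_mul_I_ne_zero (div_pos hε hR) θ
  rw [zpow_neg, zpow_natCast, ← inv_pow, ← mul_pow, ← mul_pow]
  congr 1
  have h1 := h0 (R * Real.sin θ)
  rw [← div_eq_mul_inv, mul_div_assoc', div_eq_div_iff h1 hD]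
  push_cast
  field_simp
  linear_combination Complex.cos θ * ε * I_sq

/-- **Volume of a half-space (ball) in the double hyperbolic space `DHⁿ`**: in the upper
half-space model, the volume of any closed ball centered on the boundary hyperplane
`x₀ = 0` equals half the total volume, `(iⁿ/2) · V_n(Sⁿ)` with
`V_n(Sⁿ) = 2π^{(n+1)/2}/Γ((n+1)/2)`. -/
theorem dh_volume_ball (n : ℕ) [NeZero n] (R : ℝ) (hR : 0 < R)
    (c : EuclideanSpace ℝ (Fin n)) (hc : c 0 = 0) :
    Tendsto
      (fun ε : ℝ => ∫ x in closedBall c R,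
        ((x 0 : ℂ) - (ε : ℂ) * Complex.I) ^ (-(n : ℤ)))
      (nhdsWithin 0 (Set.Ioi 0))
      (nhds (Complex.I ^ n / 2 *
        ((2 * Real.pi ^ ((n + 1 : ℝ) / 2) / Real.Gamma ((n + 1 : ℝ) / 2) : ℝ) : ℂ))) := by
  obtain ⟨m, rfl⟩ := Nat.exists_eq_add_one_of_ne_zero (NeZero.ne n)
  have hscale : Tendsto (fun ε : ℝ => ε / R) (nhdsWithin 0 (Set.Ioi 0))
      (nhdsWithin 0 (Set.Ioi 0)) := by
    refine tendsto_nhdsWithin_iff.2 ⟨?_, ?_⟩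
    · exact ((continuous_id.div_const R).tendsto' 0 0 (zero_div R)).mono_left nhdsWithin_le_nhds
    · filter_upwards [self_mem_nhdsWithin] with ε hε using div_pos hε hR
  have h := (((tendsto_integral_cos_div_pow (m + 1)).comp hscale).const_mul
    (Complex.I ^ (m + 1))).const_mul (volume.real (ball (0 : EuclideanSpace ℝ (Fin m)) 1) : ℂ)
  rw [show Complex.I ^ (m + 1) / 2 * ((2 * Real.pi ^ (((m + 1 : ℕ) + 1 : ℝ) / 2) /
      Real.Gamma (((m + 1 : ℕ) + 1 : ℝ) / 2) : ℝ) : ℂ) =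
      (volume.real (ball (0 : EuclideanSpace ℝ (Fin m)) 1) : ℂ) *
        (Complex.I ^ (m + 1) * (Real.pi : ℂ)) by
    rw [volume_real_ball_euclideanSpace_fin,
      show ((m + 1 : ℕ) + 1 : ℝ) / 2 = m / 2 + 1 by push_cast; ring,
      Real.rpow_add_one Real.pi_ne_zero]
    push_cast
    ring]
  refine h.congr' ?_
  filter_upwards [self_mem_nhdsWithin] with ε hε
  exact (integral_closedBall_sub_mul_I_zpow hc hR hε).symm
end

section
/- Let b₁, b₂ ∈ ℝ and r₁, r₂ > 0, set d = |b₁ − b₂|, and assume |r₁ − r₂| < d < r₁ + r₂ (so the two circles of radius rⱼ centered at cⱼ = (0, bⱼ) ∈ ℝ² intersect transversally at two points). Let θ = arccos((d² − r₁² − r₂²)/(2 r₁ r₂)) ∈ (0, π) be the interior angle of the lens P = {x ∈ ℝ² : ‖x − c₁‖ ≤ r₁} ∩ {x ∈ ℝ² : ‖x − c₂‖ ≤ r₂} at its two corner points. Then lim_{ε→0⁺} ∫_P (x₀ − εi)^{−2} dx = −2θ. (The volume of a lune in DH², the intersection of two half-spaces meeting at dihedral angle θ, equals −2θ; Example 4.1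 and Corollary 6.2.) -/
open MeasureTheory Filter Metric

/-- The horizontal slice of the density integrates to a real number. -/
lemma integral_Icc_sub_mul_I_zpow {ε w : ℝ} (hε : 0 < ε) (hw : 0 ≤ w) :
    ∫ x in Set.Icc (-w) w, ((x : ℂ) - (ε : ℂ) * Complex.I) ^ (-2 : ℤ) =
      ((-2 * (w / (w ^ 2 + ε ^ 2)) : ℝ) : ℂ) := by
  have hne : ∀ x : ℝ, (x : ℂ) - (ε : ℂ) * Complex.I ≠ 0 := fun x h => by
    have := congrArg Complex.im h
    simp at this
    exact hε.ne' this
  have hder : ∀ x : ℝ, HasDerivAt (fun x : ℝ => -((x : ℂ) - (ε : ℂ) * Complex.I)⁻¹)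
      (((x : ℂ) - (ε : ℂ) * Complex.I) ^ (-2 : ℤ)) x := fun x => by
    have h1 : HasDerivAt (fun x : ℝ => (x : ℂ) - (ε : ℂ) * Complex.I) 1 x :=
      (Complex.ofRealCLM.hasDerivAt (x := x)).sub_const _
    refine (h1.inv (hne x)).neg.congr_deriv ?_
    rw [zpow_neg]
    simp [neg_div]
  have hcont : Continuous fun x : ℝ => ((x : ℂ) - (ε : ℂ) * Complex.I) ^ (-2 : ℤ) := by
    refine Continuous.zpow₀ (by fun_prop) _ fun x => Or.inl (hne x)
  rw [integral_Icc_eq_integral_Ioc, ← intervalIntegral.integral_of_le (by linarith),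
    intervalIntegral.integral_eq_sub_of_hasDerivAt (fun x _ => hder x)
      (hcont.intervalIntegrable _ _)]
  have h1 := hne w
  have h2 := hne (-w)
  have h3 : ((w : ℂ) ^ 2 + (ε : ℂ) ^ 2) ≠ 0 := by
    have : w ^ 2 + ε ^ 2 ≠ 0 := by positivity
    exact_mod_cast this
  push_cast at h2 ⊢
  have h4 : ((w : ℂ) ^ 2 + (ε : ℂ) ^ 2) = -((w : ℂ) - ε * Complex.I) * (-w - ε * Complex.I) := by
    ring_nf
    simp
  rw [h4]
  field_simp
  ring

section Semicircle

variable {r : ℝ} (b : ℝ)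

lemma hasDerivAt_arcsin_sub_div (hr : 0 < r) {y : ℝ} (hy : y ∈ Set.Ioo (b - r) (b + r)) :
    HasDerivAt (fun y => Real.arcsin ((y - b) / r)) (1 / √(r ^ 2 - (y - b) ^ 2)) y := by
  have h1 : (y - b) / r ≠ -1 := by
    rw [Ne, div_eq_iff hr.ne']; intro h; linarith [hy.1]
  have h2 : (y - b) / r ≠ 1 := by
    rw [Ne, div_eq_iff hr.ne']; intro h; linarith [hy.2]
  have h := (Real.hasDerivAt_arcsin h1 h2).comp y (((hasDerivAt_id y).sub_const b).div_const r)
  refine h.congr_deriv ?_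
  have : r ^ 2 - (y - b) ^ 2 = r ^ 2 * (1 - ((y - b) / r) ^ 2) := by field_simp
  rw [this, Real.sqrt_mul (sq_nonneg r), Real.sqrt_sq hr.le]
  field_simp

lemma one_div_sqrt_eq_zero_of_notMem (hr : 0 < r) {y : ℝ}
    (hy : y ∉ Set.Ioo (b - r) (b + r)) : 1 / √(r ^ 2 - (y - b) ^ 2) = 0 := by
  rw [Real.sqrt_eq_zero_of_nonpos, div_zero]
  by_contra! h
  have := abs_lt_of_sq_lt_sq (by linarith : (y - b) ^ 2 < r ^ 2) hr.le
  rw [abs_lt] at this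
  exact hy ⟨by linarith, by linarith⟩

lemma integrable_one_div_sqrt (hr : 0 < r) :
    Integrable fun y : ℝ => 1 / √(r ^ 2 - (y - b) ^ 2) := by
  have h : IntegrableOn (fun y : ℝ => 1 / √(r ^ 2 - (y - b) ^ 2)) (Set.Ioc (b - r) (b + r)) :=
    intervalIntegral.integrableOn_deriv_of_nonneg
      (g := fun y => Real.arcsin ((y - b) / r))
      (by fun_prop)
      (fun y hy => hasDerivAt_arcsin_sub_div b hr hy) (fun y _ => by positivity)
  exact h.integrable_of_forall_notMem_eq_zero fun y hy =>
    one_div_sqrt_eq_zero_of_notMem b hr fun h => hy (Set.Ioo_subset_Ioc_self h)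

lemma setIntegral_Ioi_one_div_sqrt (hr : 0 < r) {h : ℝ} (hh : h ∈ Set.Icc (b - r) (b + r)) :
    ∫ y in Set.Ioi h, 1 / √(r ^ 2 - (y - b) ^ 2) = Real.arccos ((h - b) / r) := by
  rw [setIntegral_eq_of_subset_of_forall_sdiff_eq_zero (s := Set.Ioc h (b + r)) measurableSet_Ioi
    (fun y hy => hy.1) (fun y hy => one_div_sqrt_eq_zero_of_notMem b hr fun h' =>
      hy.2 ⟨hy.1, h'.2.le⟩), ← intervalIntegral.integral_of_le hh.2,
    intervalIntegral.integral_eq_sub_of_hasDerivAt_of_le hh.2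
      (f := fun y => Real.arcsin ((y - b) / r)) (by fun_prop)
      (fun y hy => hasDerivAt_arcsin_sub_div b hr ⟨hh.1.trans_lt hy.1, hy.2⟩)
      (integrable_one_div_sqrt b hr).intervalIntegrable]
  simp [hr.ne', Real.arccos]

lemma setIntegral_Iic_one_div_sqrt (hr : 0 < r) {h : ℝ} (hh : h ∈ Set.Icc (b - r) (b + r)) :
    ∫ y in Set.Iic h, 1 / √(r ^ 2 - (y - b) ^ 2) = Real.arccos ((b - h) / r) := by
  rw [setIntegral_eq_of_subset_of_forall_sdiff_eq_zero (s := Set.Ioc (b - r) h) measurableSet_Iic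
    (fun y hy => hy.2) (fun y hy => one_div_sqrt_eq_zero_of_notMem b hr fun h' =>
      hy.2 ⟨h'.1, hy.1⟩), ← intervalIntegral.integral_of_le hh.1,
    intervalIntegral.integral_eq_sub_of_hasDerivAt_of_le hh.1
      (f := fun y => Real.arcsin ((y - b) / r)) (by fun_prop)
      (fun y hy => hasDerivAt_arcsin_sub_div b hr ⟨hy.1, hy.2.trans_le hh.2⟩)
      (integrable_one_div_sqrt b hr).intervalIntegrable]
  have h1 : (b - r - b) / r = -1 := by field_simp; ring
  have h2 : (b - h) / r = -((h - b) / r) := by ring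
  simp only [h1, h2, Real.arccos, Real.arcsin_neg, Real.arcsin_one]
  ring

end Semicircle

/-- The interior angle of a lens is the sum of the half-angles its corners subtend. -/
lemma arccos_add_arccos_lens {A B r₁ r₂ : ℝ} (hr₁ : 0 < r₁) (hr₂ : 0 < r₂)
    (hA : |A| < r₁) (hAB : 0 < A + B) (hpow : r₁ ^ 2 - A ^ 2 = r₂ ^ 2 - B ^ 2) :
    Real.arccos (A / r₁) + Real.arccos (B / r₂) =
      Real.arccos (((A + B) ^ 2 - r₁ ^ 2 - r₂ ^ 2) / (2 * r₁ * r₂)) := by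
  have hpos : 0 < r₁ ^ 2 - A ^ 2 := by
    have := sq_lt_sq' (neg_lt_of_abs_lt hA) (lt_of_abs_lt hA)
    linarith
  have hB : |B| < r₂ := abs_lt_of_sq_lt_sq (by linarith) hr₂.le
  set a := √(r₁ ^ 2 - A ^ 2) with ha
  have ha0 : 0 < a := Real.sqrt_pos.2 hpos
  have ha2 : a ^ 2 = r₁ ^ 2 - A ^ 2 := Real.sq_sqrt hpos.le
  have key : ∀ {C r : ℝ}, 0 < r → |C| < r → r ^ 2 - C ^ 2 = r₁ ^ 2 - A ^ 2 →
      Real.cos (Real.arccos (C / r)) = C / r ∧ Real.sin (Real.arccos (C / r)) = a / r := by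
    intro C r hr hC h
    rw [abs_lt] at hC
    refine ⟨Real.cos_arccos ?_ ?_, ?_⟩
    · rw [le_div_iff₀ hr]; linarith
    · rw [div_le_iff₀ hr]; linarith
    · rw [Real.sin_arccos, ha, ← h]
      have : 1 - (C / r) ^ 2 = (r ^ 2 - C ^ 2) / r ^ 2 := by field_simp
      rw [this, Real.sqrt_div' _ (sq_nonneg r), Real.sqrt_sq hr.le]
  obtain ⟨hc1, hs1⟩ := key hr₁ hA rfl
  obtain ⟨hc2, hs2⟩ := key hr₂ hB hpow.symm
  set α := Real.arccos (A / r₁) with hα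
  set β := Real.arccos (B / r₂) with hβ
  have hcos : Real.cos (α + β) = ((A + B) ^ 2 - r₁ ^ 2 - r₂ ^ 2) / (2 * r₁ * r₂) := by
    rw [Real.cos_add, hc1, hs1, hc2, hs2]
    field_simp
    nlinarith
  have hsin : 0 < Real.sin (α + β) := by
    rw [Real.sin_add, hc1, hs1, hc2, hs2]
    have : a / r₁ * (B / r₂) + A / r₁ * (a / r₂) = a * (A + B) / (r₁ * r₂) := by
      field_simp; ring
    rw [this]; positivity
  have h0 : 0 ≤ α + β := add_nonneg (Real.arccos_nonneg _) (Real.arccos_nonneg _)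
  have h2π : α + β ≤ 2 * Real.pi := by
    linarith [Real.arccos_le_pi (A / r₁), Real.arccos_le_pi (B / r₂)]
  have hπ : α + β ≤ Real.pi := by
    by_contra! h
    have := Real.sin_nonneg_of_nonneg_of_le_pi (x := α + β - Real.pi) (by linarith) (by linarith)
    rw [Real.sin_sub_pi] at this
    linarith
  rw [← hcos, Real.arccos_cos h0 hπ]

/-- The integral over an intersection of two disks centered on `x₀ = 0`, by horizontal slices. -/
lemma integral_lens_eq (b₁ b₂ : ℝ) {r₁ r₂ : ℝ} (hr₁ : 0 < r₁) (hr₂ : 0 < r₂)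
    {c₁ c₂ : EuclideanSpace ℝ (Fin 2)} (hc₁ : c₁ = ![0, b₁]) (hc₂ : c₂ = ![0, b₂])
    {ε : ℝ} (hε : 0 < ε) :
    ∫ x in closedBall c₁ r₁ ∩ closedBall c₂ r₂,
        ((x 0 : ℂ) - (ε : ℂ) * Complex.I) ^ (-2 : ℤ) =
      ((∫ y : ℝ, -2 * (√(min (r₁ ^ 2 - (y - b₁) ^ 2) (r₂ ^ 2 - (y - b₂) ^ 2)) /
        (√(min (r₁ ^ 2 - (y - b₁) ^ 2) (r₂ ^ 2 - (y - b₂) ^ 2)) ^ 2 + ε ^ 2)) : ℝ) : ℂ) := by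
  set q : ℝ → ℝ := fun y => min (r₁ ^ 2 - (y - b₁) ^ 2) (r₂ ^ 2 - (y - b₂) ^ 2) with hq
  let S : Set (ℝ × ℝ) := {p | p.1 ^ 2 ≤ q p.2}
  let e : EuclideanSpace ℝ (Fin 2) ≃ᵐ ℝ × ℝ :=
    (MeasurableEquiv.toLp 2 (Fin 2 → ℝ)).symm.trans MeasurableEquiv.finTwoArrow
  have he : MeasurePreserving e volume volume :=
    (volume_preserving_finTwoArrow ℝ).comp
      (EuclideanSpace.volume_preserving_symm_measurableEquiv_toLp (Fin 2))
  let f : ℝ × ℝ → ℂ := fun p => ((p.1 : ℂ) - (ε : ℂ) * Complex.I) ^ (-2 : ℤ)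
  have hball : ∀ {c : EuclideanSpace ℝ (Fin 2)} {b r : ℝ}, 0 < r → c = ![0, b] →
      ∀ x, x ∈ closedBall c r ↔ (x 0) ^ 2 ≤ r ^ 2 - (x 1 - b) ^ 2 := by
    intro c b r hr hc x
    have h0 : c 0 = 0 := by rw [hc]; rfl
    have h1 : c 1 = b := by rw [hc]; rfl
    rw [mem_closedBall, EuclideanSpace.dist_eq, Real.sqrt_le_left hr.le]
    simp [h0, h1, Real.dist_eq, sq_abs, le_sub_iff_add_le]
  have hpre : closedBall c₁ r₁ ∩ closedBall c₂ r₂ = e ⁻¹' S := by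
    ext x
    rw [Set.mem_inter_iff, hball hr₁ hc₁, hball hr₂ hc₂, ← le_min_iff]
    rfl
  have hqc : Continuous q := by fun_prop
  have hSclosed : IsClosed S := isClosed_le (by fun_prop) (by fun_prop)
  have hSm : MeasurableSet S := hSclosed.measurableSet
  have hne : ∀ x : ℝ, (x : ℂ) - (ε : ℂ) * Complex.I ≠ 0 := fun x h => by
    have := congrArg Complex.im h
    simp at this
    exact hε.ne' this
  have hfc : Continuous f :=
    Continuous.zpow₀ (by fun_prop) _ fun p => Or.inl (hne p.1)
  have hScomp : IsCompact S := by
    refine (isCompact_Icc (a := ((-r₁, b₁ - r₁) : ℝ × ℝ)) (b := (r₁, b₁ + r₁))).of_isClosed_subset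
      hSclosed fun p hp => ?_
    have h1 : p.1 ^ 2 ≤ r₁ ^ 2 - (p.2 - b₁) ^ 2 := le_trans hp (min_le_left _ _)
    have h2 := abs_le_of_sq_le_sq' (by nlinarith [sq_nonneg (p.2 - b₁)] : p.1 ^ 2 ≤ r₁ ^ 2) hr₁.le
    have h3 := abs_le_of_sq_le_sq' (by nlinarith [sq_nonneg p.1] : (p.2 - b₁) ^ 2 ≤ r₁ ^ 2) hr₁.le
    exact ⟨⟨h2.1, by simpa using by linarith [h3.1]⟩, ⟨h2.2, by simpa using by linarith [h3.2]⟩⟩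
  have hint : Integrable (S.indicator f) :=
    (integrable_indicator_iff hSm).2 (hfc.continuousOn.integrableOn_compact hScomp)
  calc ∫ x in closedBall c₁ r₁ ∩ closedBall c₂ r₂, ((x 0 : ℂ) - (ε : ℂ) * Complex.I) ^ (-2 : ℤ)
      = ∫ p in S, f p := by
        rw [hpre, ← he.setIntegral_preimage_emb e.measurableEmbedding f S]
        rfl
    _ = ∫ y : ℝ, ∫ x : ℝ, S.indicator f (x, y) := by
        rw [← integral_indicator hSm]
        exact integral_prod_symm _ hint
    _ = ∫ y : ℝ, ((-2 * (√(q y) / (√(q y) ^ 2 + ε ^ 2)) : ℝ) : ℂ) := by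
        congr 1
        funext y
        rcases le_or_gt 0 (q y) with h | h
        · rw [← integral_Icc_sub_mul_I_zpow hε (Real.sqrt_nonneg _),
            ← integral_indicator measurableSet_Icc]
          congr 1
          funext x
          have : (x, y) ∈ S ↔ x ∈ Set.Icc (-√(q y)) (√(q y)) := by
            rw [Set.mem_Icc, ← Real.sq_le h]
            rfl
          by_cases hx : (x, y) ∈ S
          · rw [Set.indicator_of_mem hx, Set.indicator_of_mem (this.1 hx)]
          · rw [Set.indicator_of_notMem hx, Set.indicator_of_notMem (mt this.2 hx)]
        · have : ∀ x, S.indicator f (x, y) = 0 := fun x =>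
            Set.indicator_of_notMem (fun hx => by
              have : x ^ 2 ≤ q y := hx
              nlinarith [sq_nonneg x]) _
          simp [this, Real.sqrt_eq_zero_of_nonpos h.le]
    _ = _ := integral_ofReal

lemma div_sq_add_sq_le_one_div {w : ℝ} (hw : 0 ≤ w) (ε : ℝ) : w / (w ^ 2 + ε ^ 2) ≤ 1 / w := by
  rcases hw.eq_or_lt with rfl | hw
  · simp
  · rw [div_le_div_iff₀ (by positivity) hw]
    nlinarith [sq_nonneg ε]

lemma tendsto_div_sq_add_sq (w : ℝ) :
    Tendsto (fun ε : ℝ => w / (w ^ 2 + ε ^ 2)) (nhdsWithin 0 (Set.Ioi 0)) (nhds (1 / w)) := by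
  rcases eq_or_ne w 0 with rfl | hw
  · simp
  · have hc : ContinuousAt (fun ε : ℝ => w / (w ^ 2 + ε ^ 2)) 0 :=
      ContinuousAt.div (by fun_prop) (by fun_prop) (by positivity)
    have := hc.tendsto.mono_left (nhdsWithin_le_nhds (s := Set.Ioi 0))
    convert this using 2
    field_simp
    simp

lemma dh2_volume_lens_of_lt (b₁ b₂ r₁ r₂ : ℝ) (hr₁ : 0 < r₁) (hr₂ : 0 < r₂)
    (c₁ c₂ : EuclideanSpace ℝ (Fin 2))
    (hc₁ : c₁ = ![0, b₁]) (hc₂ : c₂ = ![0, b₂]) (hb : b₁ < b₂)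
    (hlow : |r₁ - r₂| < b₂ - b₁) (hhigh : b₂ - b₁ < r₁ + r₂) :
    Tendsto
      (fun ε : ℝ => ∫ x in closedBall c₁ r₁ ∩ closedBall c₂ r₂,
        ((x 0 : ℂ) - (ε : ℂ) * Complex.I) ^ (-2 : ℤ))
      (nhdsWithin 0 (Set.Ioi 0))
      (nhds ((-2 * Real.arccos (((b₂ - b₁) ^ 2 - r₁ ^ 2 - r₂ ^ 2) / (2 * r₁ * r₂)) : ℝ) : ℂ)) := by
  set q : ℝ → ℝ := fun y => min (r₁ ^ 2 - (y - b₁) ^ 2) (r₂ ^ 2 - (y - b₂) ^ 2) with hq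
  set d := b₂ - b₁ with hd
  have hd0 : 0 < d := sub_pos.2 hb
  set A := (d ^ 2 + r₁ ^ 2 - r₂ ^ 2) / (2 * d) with hA
  set h := b₁ + A with hh
  have hAd : 2 * d * A = d ^ 2 + r₁ ^ 2 - r₂ ^ 2 := by rw [hA]; field_simp
  rw [abs_lt] at hlow
  have hA1 : |A| < r₁ := by
    rw [abs_lt, hA, lt_div_iff₀ (by positivity), div_lt_iff₀ (by positivity)]
    constructor <;> nlinarith
  have hpow : r₁ ^ 2 - A ^ 2 = r₂ ^ 2 - (d - A) ^ 2 := by linarith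
  have hB1 : |d - A| < r₂ := by
    refine abs_lt_of_sq_lt_sq ?_ hr₂.le
    have := sq_lt_sq' (neg_lt_of_abs_lt hA1) (lt_of_abs_lt hA1)
    linarith
  rw [abs_lt] at hB1
  have hqIoi : ∀ y ∈ Set.Ioi h, q y = r₁ ^ 2 - (y - b₁) ^ 2 := fun y hy =>
    min_eq_left (by
      have : (0 : ℝ) ≤ 2 * d * (y - b₁ - A) :=
        mul_nonneg (by positivity) (by linarith [Set.mem_Ioi.1 hy])
      nlinarith)
  have hqIic : ∀ y ∈ Set.Iic h, q y = r₂ ^ 2 - (y - b₂) ^ 2 := fun y hy =>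
    min_eq_right (by
      have : (0 : ℝ) ≤ 2 * d * (A - (y - b₁)) :=
        mul_nonneg (by positivity) (by linarith [Set.mem_Iic.1 hy])
      nlinarith)
  let G : ℝ → ℝ := fun y => 2 * (1 / √(r₁ ^ 2 - (y - b₁) ^ 2) + 1 / √(r₂ ^ 2 - (y - b₂) ^ 2))
  have hG : Integrable G :=
    ((integrable_one_div_sqrt b₁ hr₁).add (integrable_one_div_sqrt b₂ hr₂)).const_mul 2
  have hqG : ∀ y, 2 * (1 / √(q y)) ≤ G y := fun y => by
    have h1 : 0 ≤ 1 / √(r₁ ^ 2 - (y - b₁) ^ 2) := by positivity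
    have h2 : 0 ≤ 1 / √(r₂ ^ 2 - (y - b₂) ^ 2) := by positivity
    rcases lt_or_ge h y with hy | hy
    · rw [hqIoi y hy]; simp only [G]; linarith
    · rw [hqIic y hy]; simp only [G]; linarith
  have hqc : Continuous q := by fun_prop
  have hlim : Tendsto (fun ε : ℝ => ∫ y : ℝ, -2 * (√(q y) / (√(q y) ^ 2 + ε ^ 2)))
      (nhdsWithin 0 (Set.Ioi 0)) (nhds (∫ y : ℝ, -2 * (1 / √(q y)))) := by
    refine tendsto_integral_filter_of_dominated_convergence G ?_ ?_ hG ?_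
    · refine Eventually.of_forall fun ε => Measurable.aestronglyMeasurable ?_
      have := hqc.measurable
      fun_prop
    · refine Eventually.of_forall fun ε => Eventually.of_forall fun y => ?_
      have h1 := div_sq_add_sq_le_one_div (Real.sqrt_nonneg (q y)) ε
      have h2 : 0 ≤ √(q y) / (√(q y) ^ 2 + ε ^ 2) := by positivity
      rw [Real.norm_eq_abs, abs_mul, abs_of_nonneg h2]
      norm_num
      linarith [hqG y]
    · exact Eventually.of_forall fun y => (tendsto_div_sq_add_sq _).const_mul _
  have hqint : Integrable fun y => 1 / √(q y) := by
    refine hG.mono' (Measurable.aestronglyMeasurable ?_) (Eventually.of_forall fun y => ?_)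
    · have := hqc.measurable
      fun_prop
    · have : 0 ≤ 1 / √(q y) := by positivity
      rw [Real.norm_of_nonneg this]
      linarith [hqG y]
  have hval : ∫ y : ℝ, -2 * (1 / √(q y)) =
      -2 * Real.arccos ((d ^ 2 - r₁ ^ 2 - r₂ ^ 2) / (2 * r₁ * r₂)) := by
    rw [integral_const_mul, ← integral_add_compl (measurableSet_Ioi (a := h)) hqint, Set.compl_Ioi,
      setIntegral_congr_fun (g := fun y => 1 / √(r₁ ^ 2 - (y - b₁) ^ 2)) measurableSet_Ioi
        (fun y hy => by simp only [hqIoi y hy]),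
      setIntegral_congr_fun (g := fun y => 1 / √(r₂ ^ 2 - (y - b₂) ^ 2)) measurableSet_Iic
        (fun y hy => by simp only [hqIic y hy]),
      setIntegral_Ioi_one_div_sqrt b₁ hr₁ ⟨by linarith [abs_lt.1 hA1], by linarith [abs_lt.1 hA1]⟩,
      setIntegral_Iic_one_div_sqrt b₂ hr₂ ⟨by linarith, by linarith⟩]
    have e1 : h - b₁ = A := by rw [hh]; ring
    have e2 : b₂ - h = d - A := by rw [hh, hd]; ring
    rw [e1, e2, arccos_add_arccos_lens hr₁ hr₂ hA1 (by linarith) hpow, add_sub_cancel]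
  rw [hval] at hlim
  refine ((Complex.continuous_ofReal.tendsto _).comp hlim).congr' ?_
  filter_upwards [self_mem_nhdsWithin] with ε hε
  exact (integral_lens_eq b₁ b₂ hr₁ hr₂ hc₁ hc₂ hε).symm

/-- **Volume of a lune in `DH²`** (Example 4.1 / Corollary 6.2): the lens-shaped
intersection `P` of two closed disks centered on the line `x₀ = 0`, meeting transversally
with interior angle `θ` at their two corner points, has volume `V₂(P) = -2θ`. -/
theorem dh2_volume_lens (b₁ b₂ r₁ r₂ : ℝ) (hr₁ : 0 < r₁) (hr₂ : 0 < r₂)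
    (c₁ c₂ : EuclideanSpace ℝ (Fin 2))
    (hc₁ : c₁ = ![0, b₁]) (hc₂ : c₂ = ![0, b₂])
    (d θ : ℝ) (hd : d = |b₁ - b₂|)
    (hlow : |r₁ - r₂| < d) (hhigh : d < r₁ + r₂)
    (hθ : θ = Real.arccos ((d ^ 2 - r₁ ^ 2 - r₂ ^ 2) / (2 * r₁ * r₂))) :
    Tendsto
      (fun ε : ℝ => ∫ x in closedBall c₁ r₁ ∩ closedBall c₂ r₂,
        ((x 0 : ℂ) - (ε : ℂ) * Complex.I) ^ (-2 : ℤ))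
      (nhdsWithin 0 (Set.Ioi 0))
      (nhds ((-2 * θ : ℝ) : ℂ)) := by
  subst hθ hd
  rcases lt_trichotomy b₁ b₂ with hb | hb | hb
  · have e : |b₁ - b₂| = b₂ - b₁ := by rw [abs_of_neg (by linarith)]; ring
    rw [e] at hlow hhigh ⊢
    exact dh2_volume_lens_of_lt b₁ b₂ r₁ r₂ hr₁ hr₂ c₁ c₂ hc₁ hc₂ hb hlow hhigh
  · rw [hb, sub_self, abs_zero] at hlow
    exact absurd hlow (abs_nonneg _).not_gt
  · have e : |b₁ - b₂| = b₁ - b₂ := abs_of_pos (by linarith)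
    rw [e] at hlow hhigh ⊢
    rw [abs_sub_comm] at hlow
    have := dh2_volume_lens_of_lt b₂ b₁ r₂ r₁ hr₂ hr₁ c₂ c₁ hc₂ hc₁ hb hlow (by linarith)
    rwa [Set.inter_comm, sub_right_comm, mul_right_comm 2 r₂ r₁] at this
end
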